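/- Let T and U be computable consistent extensions of PA and n ≥ 1. (1) If (T,U) is a C^∧_n-pair, then there is a Σ_n sentence which is simultaneously exactly hereditarily Δ_n-conservative over T and U. (2) If there is a sentence which is simultaneously exactly hereditarily Δ_n-conservative over T and U, then (T,U) is a C_n-pair. -/

import Mathlib

open FirstOrder Language
open scoped FirstOrder

namespace Guaspari

/-- The first-order language of arithmetic: a constant `0`, a unary function `S`,
binary functions `+` (coded `false`) and `·` (coded `true`), and a binary relation `≤`. -/
def LA : FirstOrder.Language :=
  ⟨fun n => match n with | 0 => Unit | 1 => Unit | 2 => Bool | _ => Empty,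
   fun n => match n with | 2 => Unit | _ => Empty⟩

/-- Sentences of the language of arithmetic. -/
abbrev Snt : Type := LA.Sentence

/-- Theories (sets of sentences) in the language of arithmetic. -/
abbrev Thy : Type := LA.Theory

/-- The term `0`. -/
def zeroT {α : Type} {n : ℕ} : LA.Term (α ⊕ Fin n) :=
  Constants.term (show LA.Constants from Unit.unit)

/-- The term `S t`. -/
def succT {α : Type} {n : ℕ} (t : LA.Term (α ⊕ Fin n)) : LA.Term (α ⊕ Fin n) :=
  Functions.apply₁ (show LA.Functions 1 from Unit.unit) t

/-- The term `t + u`. -/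
def addT {α : Type} {n : ℕ} (t u : LA.Term (α ⊕ Fin n)) : LA.Term (α ⊕ Fin n) :=
  Functions.apply₂ (show LA.Functions 2 from false) t u

/-- The term `t * u`. -/
def mulT {α : Type} {n : ℕ} (t u : LA.Term (α ⊕ Fin n)) : LA.Term (α ⊕ Fin n) :=
  Functions.apply₂ (show LA.Functions 2 from true) t u

/-- The atomic formula `t ≤ u`. -/
def leF {α : Type} {n : ℕ} (t u : LA.Term (α ⊕ Fin n)) : LA.BoundedFormula α n :=
  Relations.boundedFormula₂ (show LA.Relations 2 from Unit.unit) t u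

/-- The `i`-th (de Bruijn-indexed) bound variable as a term. -/
def vT {m : ℕ} (i : Fin m) : LA.Term (Empty ⊕ Fin m) := Term.var (Sum.inr i)

/-- The induction axiom for the formula `φ(x₀,…,x_{k-1}, x_k)` with induction on `x_k`,
universally closed over the parameters `x₀,…,x_{k-1}`. -/
def indAxiom {k : ℕ} (φ : LA.BoundedFormula Empty (k + 1)) : Snt :=
  let base := ∀' ((vT (Fin.last k) =' zeroT) ⟹ φ)
  let step := ∀' (φ ⟹
    ∀' ((vT (Fin.last (k + 1)) =' succT (vT (Fin.castSucc (Fin.last k)))) ⟹ φ.liftAt 1 k))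
  ((base ⊓ step) ⟹ ∀' φ).alls

/-- The axioms of Peano arithmetic `PA`: the basic axioms for `0`, `S`, `+`, `·`, `≤`,
together with the full induction scheme. -/
def PAAx : Thy :=
  {∀' ∼(succT (vT 0) =' zeroT),
   ∀' ∀' ((succT (vT 0) =' succT (vT 1)) ⟹ (vT 0 =' vT 1)),
   ∀' (addT (vT 0) zeroT =' vT 0),
   ∀' ∀' (addT (vT 0) (succT (vT 1)) =' succT (addT (vT 0) (vT 1))),
   ∀' (mulT (vT 0) zeroT =' zeroT),
   ∀' ∀' (mulT (vT 0) (succT (vT 1)) =' addT (mulT (vT 0) (vT 1)) (vT 0)),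
   ∀' ∀' (leF (vT 0) (vT 1) ⇔ ∃' (addT (vT 2) (vT 0) =' vT 1))} ∪
  {φ | ∃ (k : ℕ) (ψ : LA.BoundedFormula Empty (k + 1)), φ = indAxiom ψ}

/-- `Prv T φ`: the sentence `φ` is provable from the theory `T` (equivalently, by the
Gödel completeness theorem, `φ` holds in every model of `T`). -/
def Prv (T : Thy) (φ : Snt) : Prop := T ⊨ᵇ φ

/-- `Th T`: the set of sentences provable from `T`. -/
def Th (T : Thy) : Set Snt := {φ | Prv T φ}

/-- `Con T`: the theory `T` is consistent. -/
def Con (T : Thy) : Prop := ¬ Prv T ⊥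

/-- The theory `T + φ`. -/
def add (T : Thy) (φ : Snt) : Thy := insert φ T

/-- `T` is an extension of `PA`. -/
def ExtPA (T : Thy) : Prop := ∀ φ ∈ PAAx, Prv T φ

/-- `V` is a subtheory of `T` (containing `PA`, as assumed throughout the paper). -/
def SubThy (V T : Thy) : Prop := ExtPA V ∧ ∀ φ, Prv V φ → Prv T φ

/-- Δ₀ (bounded) formulas. -/
inductive IsDelta0 : ∀ {m : ℕ}, LA.BoundedFormula Empty m → Prop
  | falsum {m : ℕ} : IsDelta0 (⊥ : LA.BoundedFormula Empty m)
  | equal {m : ℕ} (t u : LA.Term (Empty ⊕ Fin m)) : IsDelta0 (t =' u)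
  | le {m : ℕ} (t u : LA.Term (Empty ⊕ Fin m)) : IsDelta0 (leF t u)
  | imp {m : ℕ} {φ ψ : LA.BoundedFormula Empty m} :
      IsDelta0 φ → IsDelta0 ψ → IsDelta0 (φ ⟹ ψ)
  | ball {m : ℕ} (t : LA.Term (Empty ⊕ Fin m)) {φ : LA.BoundedFormula Empty (m + 1)} :
      IsDelta0 φ →
      IsDelta0 (∀' (leF (vT (Fin.last m)) (t.relabel (Sum.map id Fin.castSucc)) ⟹ φ))
  | bex {m : ℕ} (t : LA.Term (Empty ⊕ Fin m)) {φ : LA.BoundedFormula Empty (m + 1)} :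
      IsDelta0 φ →
      IsDelta0 (∃' (leF (vT (Fin.last m)) (t.relabel (Sum.map id Fin.castSucc)) ⊓ φ))

mutual
  /-- `Σ_k` formulas (cumulatively: every `Π_k` formula is `Σ_{k+1}`). -/
  inductive IsSigmaFml : ℕ → ∀ {m : ℕ}, LA.BoundedFormula Empty m → Prop
    | ofDelta0 {m : ℕ} {φ : LA.BoundedFormula Empty m} : IsDelta0 φ → IsSigmaFml 0 φ
    | ofPi {k : ℕ} {m : ℕ} {φ : LA.BoundedFormula Empty m} :
        IsPiFml k φ → IsSigmaFml (k + 1) φ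
    | ex {k : ℕ} {m : ℕ} {φ : LA.BoundedFormula Empty (m + 1)} :
        IsSigmaFml (k + 1) φ → IsSigmaFml (k + 1) (∃' φ)
  /-- `Π_k` formulas (cumulatively: every `Σ_k` formula is `Π_{k+1}`). -/
  inductive IsPiFml : ℕ → ∀ {m : ℕ}, LA.BoundedFormula Empty m → Prop
    | ofDelta0 {m : ℕ} {φ : LA.BoundedFormula Empty m} : IsDelta0 φ → IsPiFml 0 φ
    | ofSigma {k : ℕ} {m : ℕ} {φ : LA.BoundedFormula Empty m} :
        IsSigmaFml k φ → IsPiFml (k + 1) φ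
    | all {k : ℕ} {m : ℕ} {φ : LA.BoundedFormula Empty (m + 1)} :
        IsPiFml (k + 1) φ → IsPiFml (k + 1) (∀' φ)
end

/-- The set of `Σ_k` sentences. -/
def SigmaS (k : ℕ) : Set Snt := {φ | IsSigmaFml k φ}

/-- The set of `Π_k` sentences. -/
def PiS (k : ℕ) : Set Snt := {φ | IsPiFml k φ}

/-- The set of `Σ_k ∧ Π_k` sentences, i.e. sentences of the form `σ ∧ π` with
`σ` a `Σ_k` sentence and `π` a `Π_k` sentence. -/
def SigAndPiS (k : ℕ) : Set Snt :=
  {φ | ∃ σ ∈ SigmaS k, ∃ π ∈ PiS k, φ = σ ⊓ π}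

/-- `B(Σ_k)` sentences: Boolean combinations of `Σ_k` sentences. -/
inductive IsBoolSigma (k : ℕ) : Snt → Prop
  | base {φ : Snt} : φ ∈ SigmaS k → IsBoolSigma k φ
  | not {φ : Snt} : IsBoolSigma k φ → IsBoolSigma k (∼φ)
  | imp {φ ψ : Snt} : IsBoolSigma k φ → IsBoolSigma k ψ → IsBoolSigma k (φ ⟹ ψ)
  | inf {φ ψ : Snt} : IsBoolSigma k φ → IsBoolSigma k ψ → IsBoolSigma k (φ ⊓ ψ)
  | sup {φ ψ : Snt} : IsBoolSigma k φ → IsBoolSigma k ψ → IsBoolSigma k (φ ⊔ ψ)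

/-- The set of `B(Σ_k)` sentences. -/
def BSigmaS (k : ℕ) : Set Snt := {φ | IsBoolSigma k φ}

/-- The set of `Γ` sentences provable in `T`, `Th_Γ(T)`. -/
def ThIn (Γ : Set Snt) (T : Thy) : Set Snt := Γ ∩ Th T

instance (i : ℕ) : Encodable (LA.Functions i) :=
  match i with
  | 0 => inferInstanceAs (Encodable Unit)
  | 1 => inferInstanceAs (Encodable Unit)
  | 2 => inferInstanceAs (Encodable Bool)
  | (_ + 3) => inferInstanceAs (Encodable Empty)

instance (i : ℕ) : Encodable (LA.Relations i) :=
  match i with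
  | 0 => inferInstanceAs (Encodable Empty)
  | 1 => inferInstanceAs (Encodable Empty)
  | 2 => inferInstanceAs (Encodable Unit)
  | (_ + 3) => inferInstanceAs (Encodable Empty)

/-- A Gödel numbering of sentences, via Mathlib's encoding of bounded formulas. -/
def gnum (φ : Snt) : ℕ :=
  Encodable.encode
    (show List ((Σ k, LA.Term (Empty ⊕ Fin k)) ⊕ ((Σ n, LA.Relations n) ⊕ ℕ)) from
      BoundedFormula.encoding.encode (⟨0, φ⟩ : Σ n, LA.BoundedFormula Empty n))

/-- The (axiom set of the) theory `T` is computable. -/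
def CompThy (T : Thy) : Prop :=
  ComputablePred (fun m : ℕ => ∃ φ ∈ T, gnum φ = m)

/-- `T` is a computable consistent extension of `PA`. -/
def GoodThy (T : Thy) : Prop := CompThy T ∧ Con T ∧ ExtPA T

/-- `φ` is `Γ`-conservative over `T` for a class of sentences `Γ`:
every `Γ` sentence provable in `T + φ` is provable in `T`. -/
def ConsIn (Γ : Set Snt) (T : Thy) (φ : Snt) : Prop :=
  ∀ γ ∈ Γ, Prv (add T φ) γ → Prv T γ

/-- `φ` is hereditarily `Γ`-conservative over `T`: `Γ`-conservative over every
subtheory of `T` (containing `PA`). -/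
def HConsIn (Γ : Set Snt) (T : Thy) (φ : Snt) : Prop :=
  ∀ V : Thy, SubThy V T → ConsIn Γ V φ

/-- `φ` is `Σ_k↓Π_k`-conservative over `V`. -/
def SPCons (k : ℕ) (V : Thy) (φ : Snt) : Prop :=
  ∀ σ ∈ SigmaS k, ∀ π ∈ PiS k, Prv (add V φ) (σ ⊓ π) → Prv V (σ ⊔ π)

/-- `φ` is hereditarily `Σ_k↓Π_k`-conservative over `T`. -/
def HSPCons (k : ℕ) (T : Thy) (φ : Snt) : Prop :=
  ∀ V : Thy, SubThy V T → SPCons k V φ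

/-- The theory `S` is `Σ_k↓Π_k`-conservative over `PA`. -/
def ThySPConsPA (k : ℕ) (S : Thy) : Prop :=
  ∀ σ ∈ SigmaS k, ∀ π ∈ PiS k, Prv S (σ ⊓ π) → Prv PAAx (σ ⊔ π)

/-- `δ` is a `Δ_k(S)` sentence: `S`-provably equivalent to both a `Σ_k` sentence
and a `Π_k` sentence. -/
def IsDeltaIn (k : ℕ) (S : Thy) (δ : Snt) : Prop :=
  (∃ σ ∈ SigmaS k, Prv S (δ ⇔ σ)) ∧ ∃ π ∈ PiS k, Prv S (δ ⇔ π)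

/-- `φ` is `Δ_k(S)`-conservative over `V`. -/
def DeltaConsRel (k : ℕ) (S V : Thy) (φ : Snt) : Prop :=
  ∀ δ : Snt, IsDeltaIn k S δ → Prv (add V φ) δ → Prv V δ

/-- `φ` is `Δ_k`-conservative over `T`, i.e. `Δ_k(Th(T))`-conservative over `T`. -/
def DeltaCons (k : ℕ) (T : Thy) (φ : Snt) : Prop := DeltaConsRel k (Th T) T φ

/-- `φ` is hereditarily `Δ_k`-conservative over `T`. -/
def HDeltaCons (k : ℕ) (T : Thy) (φ : Snt) : Prop :=
  ∀ V : Thy, SubThy V T → DeltaConsRel k (Th V) V φ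

/-- `φ` is doubly `Π_k`-conservative over `T`: `φ` is `Π_k`-conservative and `¬φ` is
`Σ_k`-conservative over `T`. -/
def DCons (k : ℕ) (T : Thy) (φ : Snt) : Prop :=
  ConsIn (PiS k) T φ ∧ ConsIn (SigmaS k) T (∼φ)

/-- `φ` is hereditarily doubly `Π_k`-conservative over `T`. -/
def HDCons (k : ℕ) (T : Thy) (φ : Snt) : Prop :=
  ∀ V : Thy, SubThy V T → DCons k V φ

/-- `(T,U)` is a `B_n`-pair. -/
def Bpair (n : ℕ) (T U : Thy) : Prop :=
  (¬ ThIn (PiS n) T ⊆ Th U ∨ Con (T ∪ ThIn (PiS n) U)) ∧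
  (¬ ThIn (PiS n) U ⊆ Th T ∨ Con (U ∪ ThIn (PiS n) T))

/-- `(T,U)` is a `C_n`-pair. -/
def Cpair (n : ℕ) (T U : Thy) : Prop :=
  Con (T ∪ ThIn (PiS n) U) ∧ Con (U ∪ ThIn (PiS n) T)

/-- `(T,U)` is a `C⁻_n`-pair. -/
def Cmpair (n : ℕ) (T U : Thy) : Prop :=
  Con (T ∪ ThIn (PiS n) U) ∨ Con (U ∪ ThIn (PiS n) T)

/-- `(T,U)` is a `C^∧_n`-pair. -/
def Capair (n : ℕ) (T U : Thy) : Prop :=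
  Con (T ∪ ThIn (SigAndPiS n) U) ∧ Con (U ∪ ThIn (SigAndPiS n) T)

/-- `(T,U)` is a `C^B_n`-pair. -/
def CBpair (n : ℕ) (T U : Thy) : Prop :=
  Con (T ∪ ThIn (BSigmaS n) U)


/-- `φ` is simultaneously exactly hereditarily `Δ_n`-conservative over `T` and `U`. -/
def SimExHDelta (n : ℕ) (T U : Thy) (φ : Snt) : Prop :=
  HDeltaCons n T φ ∧ HDeltaCons n U φ ∧
  (∃ ψ ∈ SigmaS n, Prv (add PAAx φ) ψ ∧ ¬ Prv T ψ ∧ ¬ Prv U ψ) ∧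
  (∃ ψ ∈ PiS n, Prv (add PAAx φ) ψ ∧ ¬ Prv T ψ ∧ ¬ Prv U ψ)

section

/-- Bundled models of PA. -/
structure PAM : Type 1 where
  car : Type
  [str : LA.Structure car]
  [ne : Nonempty car]
  mod : car ⊨ PAAx

instance : CoeSort PAM Type := ⟨PAM.car⟩

section Ops
variable (X : Type) [LA.Structure X]

/-- zero of a structure -/
def opZ : X := Structure.funMap (show LA.Functions 0 from Unit.unit) ![]
variable {X}
/-- succ of a structure -/
def opS (x : X) : X := Structure.funMap (show LA.Functions 1 from Unit.unit) ![x]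
/-- add of a structure -/
def opA (x y : X) : X := Structure.funMap (show LA.Functions 2 from false) ![x, y]
/-- mul of a structure -/
def opM (x y : X) : X := Structure.funMap (show LA.Functions 2 from true) ![x, y]
/-- le of a structure -/
def opL (x y : X) : Prop := Structure.RelMap (show LA.Relations 2 from Unit.unit) ![x, y]

variable {α : Type} {n : ℕ} (v : α ⊕ Fin n → X)

theorem realize_zeroT : (zeroT : LA.Term (α ⊕ Fin n)).realize v = opZ X := by
  simp only [zeroT, Constants.term, Term.realize, opZ]
  congr 1; exact Subsingleton.elim _ _

theorem realize_succT (t : LA.Term (α ⊕ Fin n)) : (succT t).realize v = opS (t.realize v) := by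
  exact Term.realize_functions_apply₁

theorem realize_addT (t u : LA.Term (α ⊕ Fin n)) :
    (addT t u).realize v = opA (t.realize v) (u.realize v) := by
  exact Term.realize_functions_apply₂

theorem realize_mulT (t u : LA.Term (α ⊕ Fin n)) :
    (mulT t u).realize v = opM (t.realize v) (u.realize v) := by
  exact Term.realize_functions_apply₂

theorem realize_leF (t u : LA.Term (α ⊕ Fin n)) (v : α → X) (xs : Fin n → X) :
    (leF t u).Realize v xs ↔ opL (t.realize (Sum.elim v xs)) (u.realize (Sum.elim v xs)) := by
  exact BoundedFormula.realize_rel₂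

theorem realize_vT (v : Empty → X) (xs : Fin n → X) (i : Fin n) :
    (vT i).realize (Sum.elim v xs) = xs i := rfl

end Ops

namespace PAM
attribute [instance] PAM.str PAM.ne
variable {M : PAM}

instance : Zero M := ⟨opZ M⟩
instance : One M := ⟨opS (opZ M)⟩
instance : Add M := ⟨opA⟩
instance : Mul M := ⟨opM⟩
instance : LE M := ⟨opL⟩

theorem modS {φ : Snt} (h : φ ∈ PAAx) : (M : Type) ⊨ φ := M.mod.realize_of_mem φ h

theorem ax1 (x : M) : opS x ≠ 0 := by
  have h := modS (M := M) (φ := _) (Or.inl (Or.inl rfl))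
  have := h x
  simp only [BoundedFormula.realize_not, BoundedFormula.realize_bdEqual, realize_succT, realize_zeroT, realize_vT] at this
  exact this

theorem ax2 (x y : M) (h : opS x = opS y) : x = y := by
  have h' := modS (M := M) (φ := _) (Or.inl (Or.inr (Or.inl rfl)))
  have := h' x y
  simp only [BoundedFormula.realize_imp, BoundedFormula.realize_bdEqual, realize_succT, realize_vT] at this
  exact this h

theorem ax3 (x : M) : x + 0 = x := by
  have h' := modS (M := M) (φ := _) (Or.inl (Or.inr (Or.inr (Or.inl rfl))))
  have := h' x
  simp only [BoundedFormula.realize_bdEqual, realize_addT, realize_zeroT, realize_vT] at this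
  exact this

theorem ax4 (x y : M) : x + opS y = opS (x + y) := by
  have h' := modS (M := M) (φ := _) (Or.inl (Or.inr (Or.inr (Or.inr (Or.inl rfl)))))
  have := h' x y
  simp only [BoundedFormula.realize_bdEqual, realize_addT, realize_succT, realize_vT] at this
  exact this

theorem ax5 (x : M) : x * 0 = 0 := by
  have h' := modS (M := M) (φ := _) (Or.inl (Or.inr (Or.inr (Or.inr (Or.inr (Or.inl rfl))))))
  have := h' x
  simp only [BoundedFormula.realize_bdEqual, realize_mulT, realize_zeroT, realize_vT] at this
  exact this

theorem ax6 (x y : M) : x * opS y = x * y + x := by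
  have h' := modS (M := M) (φ := _) (Or.inl (Or.inr (Or.inr (Or.inr (Or.inr (Or.inr (Or.inl rfl)))))))
  have := h' x y
  simp only [BoundedFormula.realize_bdEqual, realize_addT, realize_mulT, realize_succT, realize_vT] at this
  exact this

theorem ax7 (x y : M) : x ≤ y ↔ ∃ z, z + x = y := by
  have h' := modS (M := M) (φ := _) (Or.inl (Or.inr (Or.inr (Or.inr (Or.inr (Or.inr (Or.inr rfl)))))))
  have := h' x y
  simp only [BoundedFormula.realize_iff, BoundedFormula.realize_ex, BoundedFormula.realize_bdEqual,
    realize_leF, realize_addT, realize_vT] at this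
  exact this

/-- Term-definable functions with parameters. -/
def DT {k : ℕ} (f : (Fin k → M) → M) : Prop :=
  ∃ t : LA.Term (M ⊕ Fin k), ∀ v, t.realize (Sum.elim id v) = f v

/-- Definability with parameters. -/
def Def {k : ℕ} (R : (Fin k → M) → Prop) : Prop :=
  ∃ φ : LA.BoundedFormula M k, ∀ v, φ.Realize id v ↔ R v

/-- Definable unary predicates. -/
def D1 (P : M → Prop) : Prop := Def (fun v : Fin 1 → M => P (v 0))

theorem indS (P : M → Prop) (hP : D1 P) (h0 : P 0) (hs : ∀ x, P x → P (opS x)) : ∀ x, P x := by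
  obtain ⟨φ, hφ⟩ := hP
  classical
  let s := φ.freeVarFinset
  let e : s ≃ Fin s.card := s.equivFin
  let ψ0 : LA.BoundedFormula s 1 := φ.restrictFreeVar id
  let ψ : LA.BoundedFormula Empty (s.card + 1) := ψ0.relabel (fun i => Sum.inr (e i))
  have hψ : ∀ (xs : Fin (s.card + 1) → M), (∀ i : s, xs (Fin.castSucc (e i)) = i) →
      (ψ.Realize default xs ↔ P (xs (Fin.last _))) := by
    intro xs hxs
    rw [BoundedFormula.realize_relabel, BoundedFormula.realize_restrictFreeVar (v' := id)]
    · rw [hφ]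
      have : (xs ∘ Fin.natAdd s.card) 0 = xs (Fin.last s.card) := by
        simp only [Function.comp]; congr 1
      show P ((xs ∘ Fin.natAdd s.card) 0) ↔ _
      rw [this]
    · intro a
      simp only [Function.comp, Sum.elim_inr, id]
      have := hxs a
      exact this
  have hax := modS (M := M) (φ := indAxiom ψ) (Or.inr ⟨_, _, rfl⟩)
  simp only [indAxiom] at hax
  have hax := BoundedFormula.realize_alls.1 hax (fun i => (e.symm i : M))
  simp only [BoundedFormula.realize_imp, BoundedFormula.realize_inf, BoundedFormula.realize_all,
    BoundedFormula.realize_bdEqual, realize_vT, realize_zeroT, realize_succT] at hax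
  have key : ∀ x : M, ψ.Realize default (Fin.snoc (fun i => (e.symm i : M)) x) ↔ P x := by
    intro x
    rw [hψ]
    · simp
    · intro i; simp
  intro x
  rw [← key]
  apply hax
  constructor
  · intro a ha
    rw [key]
    simp at ha
    rw [ha]; exact h0
  · intro a ha b hb
    rw [BoundedFormula.realize_liftAt_one (by omega)]
    rw [key] at ha
    simp at hb
    rw [hψ]
    · have : ((Fin.snoc (Fin.snoc (fun i => (e.symm i : M)) a : Fin (s.card+1) → M) b : Fin (s.card+1+1) → M) ∘
          fun i : Fin (s.card+1) => if (i:ℕ) < s.card then i.castSucc else i.succ) (Fin.last s.card) = b := by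
        simp only [Function.comp, Fin.val_last, lt_irrefl, if_false, Fin.succ_last, Fin.snoc_last]
      rw [this, hb]; exact hs a ha
    · intro i
      simp

end PAM
end

section
namespace PAM
variable {M : PAM}

section DefRules
variable {k : ℕ}

theorem opS_eq (x : M) : opS x = x + 1 := by
  have := ax4 x (0 : M)
  rw [ax3] at this
  exact this.symm

theorem DT.var (i : Fin k) : DT (fun v : Fin k → M => v i) := ⟨.var (Sum.inr i), fun _ => rfl⟩
theorem DT.const (a : M) : DT (fun _ : Fin k → M => a) := ⟨.var (Sum.inl a), fun _ => rfl⟩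
theorem DT.add {f g : (Fin k → M) → M} (hf : DT f) (hg : DT g) : DT (fun v => f v + g v) := by
  obtain ⟨t, ht⟩ := hf
  obtain ⟨u, hu⟩ := hg
  exact ⟨addT t u, fun v => by rw [realize_addT, ht, hu]; rfl⟩
theorem DT.mul {f g : (Fin k → M) → M} (hf : DT f) (hg : DT g) : DT (fun v => f v * g v) := by
  obtain ⟨t, ht⟩ := hf
  obtain ⟨u, hu⟩ := hg
  exact ⟨mulT t u, fun v => by rw [realize_mulT, ht, hu]; rfl⟩
theorem DT.succ {f : (Fin k → M) → M} (hf : DT f) : DT (fun v => opS (f v)) := by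
  obtain ⟨t, ht⟩ := hf
  exact ⟨succT t, fun v => by rw [realize_succT, ht]⟩

theorem Def.eq {f g : (Fin k → M) → M} (hf : DT f) (hg : DT g) : Def (fun v => f v = g v) := by
  obtain ⟨t, ht⟩ := hf
  obtain ⟨u, hu⟩ := hg
  exact ⟨t =' u, fun v => by rw [BoundedFormula.realize_bdEqual, ht, hu]⟩
theorem Def.le {f g : (Fin k → M) → M} (hf : DT f) (hg : DT g) : Def (fun v => f v ≤ g v) := by
  obtain ⟨t, ht⟩ := hf
  obtain ⟨u, hu⟩ := hg
  exact ⟨leF t u, fun v => by rw [realize_leF, ht, hu]; rfl⟩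
theorem Def.imp {P Q : (Fin k → M) → Prop} (hP : Def P) (hQ : Def Q) :
    Def (fun v => P v → Q v) := by
  obtain ⟨t, ht⟩ := hP
  obtain ⟨u, hu⟩ := hQ
  exact ⟨t ⟹ u, fun v => by rw [BoundedFormula.realize_imp, ht, hu]⟩
theorem Def.false : Def (fun _ : Fin k → M => False) := ⟨⊥, fun _ => Iff.rfl⟩
theorem Def.not {P : (Fin k → M) → Prop} (hP : Def P) : Def (fun v => ¬ P v) :=
  hP.imp Def.false
theorem Def.true : Def (fun _ : Fin k → M => True) := ⟨⊤, fun v => by simp⟩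
theorem Def.const (p : Prop) : Def (fun _ : Fin k → M => p) := by
  by_cases h : p
  · simpa [h] using Def.true
  · simpa [h] using Def.false
theorem Def.and {P Q : (Fin k → M) → Prop} (hP : Def P) (hQ : Def Q) :
    Def (fun v => P v ∧ Q v) := by
  obtain ⟨t, ht⟩ := hP
  obtain ⟨u, hu⟩ := hQ
  exact ⟨t ⊓ u, fun v => by rw [BoundedFormula.realize_inf, ht, hu]⟩
theorem Def.or {P Q : (Fin k → M) → Prop} (hP : Def P) (hQ : Def Q) :
    Def (fun v => P v ∨ Q v) := by
  obtain ⟨t, ht⟩ := hP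
  obtain ⟨u, hu⟩ := hQ
  exact ⟨t ⊔ u, fun v => by rw [BoundedFormula.realize_sup, ht, hu]⟩
theorem Def.iff {P Q : (Fin k → M) → Prop} (hP : Def P) (hQ : Def Q) :
    Def (fun v => P v ↔ Q v) := by
  obtain ⟨t, ht⟩ := hP
  obtain ⟨u, hu⟩ := hQ
  exact ⟨t ⇔ u, fun v => by rw [BoundedFormula.realize_iff, ht, hu]⟩
theorem Def.all {Q : (Fin k → M) → M → Prop}
    (h : Def (fun w : Fin (k+1) → M => Q (fun i => w i.castSucc) (w (Fin.last k)))) :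
    Def (fun v => ∀ x, Q v x) := by
  obtain ⟨t, ht⟩ := h
  refine ⟨∀' t, fun v => ?_⟩
  rw [BoundedFormula.realize_all]
  refine forall_congr' fun a => ?_
  rw [ht]; simp
theorem Def.ex {Q : (Fin k → M) → M → Prop}
    (h : Def (fun w : Fin (k+1) → M => Q (fun i => w i.castSucc) (w (Fin.last k)))) :
    Def (fun v => ∃ x, Q v x) := by
  obtain ⟨t, ht⟩ := h
  refine ⟨∃' t, fun v => ?_⟩
  rw [BoundedFormula.realize_ex]
  refine exists_congr fun a => ?_
  rw [ht]; simp
theorem DT.func {m : ℕ} (F : LA.Functions m) {f : Fin m → (Fin k → M) → M}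
    (hf : ∀ i, DT (f i)) : DT (fun v => Structure.funMap F (fun i => f i v)) := by
  choose t ht using hf
  exact ⟨.func F t, fun v => by simp only [Term.realize, ht]⟩
theorem DT.realize {α : Type} (val : α → M) {m : ℕ} (t : LA.Term (α ⊕ Fin m))
    {f : Fin m → (Fin k → M) → M}
    (hf : ∀ i, DT (f i)) : DT (fun v => t.realize (Sum.elim val (fun i => f i v))) := by
  induction t with
  | var x =>
    rcases x with x | x
    · exact DT.const _
    · exact hf x
  | func F ts ih => exact DT.func F ih
/-- Substituting terms into a formula. -/
theorem Def.realize {α : Type} (val : α → M) {m : ℕ} (φ : LA.BoundedFormula α m) {k : ℕ}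
    {f : Fin m → (Fin k → M) → M}
    (hf : ∀ i, DT (f i)) : Def (fun v => φ.Realize val (fun i => f i v)) := by
  induction φ generalizing k with
  | falsum => exact Def.false
  | equal t u => exact Def.eq (DT.realize val t hf) (DT.realize val u hf)
  | rel R ts =>
    choose t ht using fun i => DT.realize val (ts i) hf
    exact ⟨.rel R t, fun v => by simp only [BoundedFormula.Realize, ht]⟩
  | imp _ _ ih1 ih2 => exact Def.imp (ih1 hf) (ih2 hf)
  | all φ ih =>
    simp only [BoundedFormula.realize_all]
    refine Def.all (Q := fun v x => φ.Realize val (Fin.snoc (fun i => f i v) x)) ?_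
    have := ih (k := k+1) (f := Fin.snoc (fun i w => f i (fun j => w j.castSucc)) (fun w => w (Fin.last k))) ?_
    · convert this using 3 with w
      funext i
      refine Fin.lastCases ?_ (fun i => ?_) i <;> simp
    · intro i
      refine Fin.lastCases ?_ (fun i => ?_) i
      · simpa using DT.var _
      · obtain ⟨t, ht⟩ := hf i
        refine ⟨t.relabel (Sum.map id Fin.castSucc), fun v => ?_⟩
        rw [Term.realize_relabel]
        simp only [Fin.snoc_castSucc]
        rw [← ht]
        congr 1
        funext x; rcases x with x | x <;> rfl
theorem Def.subst {m : ℕ} {R : (Fin m → M) → Prop} (hR : Def R) {f : Fin m → (Fin k → M) → M}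
    (hf : ∀ i, DT (f i)) : Def (fun v => R (fun i => f i v)) := by
  obtain ⟨φ, hφ⟩ := hR
  simp only [← hφ]
  exact Def.realize id φ hf
theorem D1.comp {P : M → Prop} (hP : D1 P) {f : (Fin k → M) → M} (hf : DT f) :
    Def (fun v => P (f v)) := Def.subst hP (f := fun _ => f) (fun _ => hf)
end DefRules

theorem ind (P : M → Prop) (hP : D1 P) (h0 : P 0) (hs : ∀ x, P x → P (x + 1)) : ∀ x, P x :=
  indS P hP h0 (fun x hx => by rw [opS_eq]; exact hs x hx)

theorem ax1' (x : M) : x + 1 ≠ 0 := by rw [← opS_eq]; exact ax1 x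
theorem ax2' (x y : M) (h : x + 1 = y + 1) : x = y := by
  rw [← opS_eq, ← opS_eq] at h; exact ax2 x y h
theorem ax4' (x y : M) : x + (y + 1) = x + y + 1 := by
  rw [← opS_eq, ← opS_eq]; exact ax4 x y
theorem ax6' (x y : M) : x * (y + 1) = x * y + x := by
  rw [← opS_eq]; exact ax6 x y

theorem zero_add_ (x : M) : 0 + x = x := by
  refine ind (fun x => 0 + x = x) ?_ (ax3 0) ?_ x
  · exact Def.eq (DT.add (DT.const _) (DT.var _)) (DT.var _)
  · intro x h; rw [ax4', h]
theorem add_assoc_ (x y z : M) : x + y + z = x + (y + z) := by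
  refine ind (fun z => x + y + z = x + (y + z)) ?_ (by rw [ax3, ax3]) ?_ z
  · repeat' first | apply Def.eq | apply DT.add | apply DT.var | apply DT.const
  · intro z h; simp only [ax4', h]
theorem succ_add_ (x y : M) : x + 1 + y = x + y + 1 := by
  refine ind (fun y => x + 1 + y = x + y + 1) ?_ (by rw [ax3, ax3]) ?_ y
  · repeat' first | apply Def.eq | apply DT.add | apply DT.var | apply DT.const
  · intro z h; simp only [ax4', h]
theorem add_comm_ (x y : M) : x + y = y + x := by
  refine ind (fun y => x + y = y + x) ?_ (by rw [ax3, zero_add_]) ?_ y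
  · repeat' first | apply Def.eq | apply DT.add | apply DT.var | apply DT.const
  · intro z h; simp only [ax4', h, succ_add_]
theorem zero_mul_ (x : M) : 0 * x = 0 := by
  refine ind (fun x => 0 * x = 0) ?_ (ax5 0) ?_ x
  · repeat' first | apply Def.eq | apply DT.mul | apply DT.var | apply DT.const
  · intro x h; rw [ax6', h, ax3]
theorem succ_mul_ (x y : M) : (x + 1) * y = x * y + y := by
  refine ind (fun y => (x + 1) * y = x * y + y) ?_ (by rw [ax5, ax5, ax3]) ?_ y
  · repeat' first | apply Def.eq | apply DT.add | apply DT.mul | apply DT.var | apply DT.const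
  · intro z h; rw [ax6', h, ax6', add_assoc_, add_assoc_, ax4', ax4', ax4', ax4', add_comm_ x z]
theorem mul_comm_ (x y : M) : x * y = y * x := by
  refine ind (fun y => x * y = y * x) ?_ (by rw [ax5, zero_mul_]) ?_ y
  · repeat' first | apply Def.eq | apply DT.add | apply DT.mul | apply DT.var | apply DT.const
  · intro z h; rw [ax6', h, succ_mul_]
theorem mul_add_ (x y z : M) : x * (y + z) = x * y + x * z := by
  refine ind (fun z => x * (y + z) = x * y + x * z) ?_ (by rw [ax5, ax3, ax3]) ?_ z
  · repeat' first | apply Def.eq | apply DT.add | apply DT.mul | apply DT.var | apply DT.const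
  · intro z h; rw [ax4', ax6', ax6', h, add_assoc_]
theorem mul_assoc_ (x y z : M) : x * y * z = x * (y * z) := by
  refine ind (fun z => x * y * z = x * (y * z)) ?_ (by rw [ax5, ax5, ax5]) ?_ z
  · repeat' first | apply Def.eq | apply DT.add | apply DT.mul | apply DT.var | apply DT.const
  · intro z h; rw [ax6', ax6', mul_add_, h]
theorem one_mul_ (x : M) : 1 * x = x := by
  rw [← zero_add_ (1 : M), succ_mul_, zero_mul_, zero_add_]

instance : CommSemiring M where
  add_assoc := add_assoc_
  zero_add := zero_add_
  add_zero := ax3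
  add_comm := add_comm_
  nsmul := nsmulRec
  left_distrib := mul_add_
  right_distrib x y z := by rw [mul_comm_, mul_add_, mul_comm_, mul_comm_ z]
  zero_mul := zero_mul_
  mul_zero := ax5
  mul_assoc := mul_assoc_
  one_mul := one_mul_
  mul_one x := by rw [mul_comm_, one_mul_]
  mul_comm := mul_comm_

theorem add_right_cancel_ (x y z : M) : x + z = y + z → x = y := by
  refine ind (fun z => x + z = y + z → x = y) ?_ (by simp) ?_ z
  · repeat' first | apply Def.imp | apply Def.eq | apply DT.add | apply DT.mul | apply DT.var | apply DT.const
  · intro z h h'; apply h; apply ax2'; rw [add_assoc, h', add_assoc]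

instance : IsRightCancelAdd M := ⟨fun a _ _ h => add_right_cancel_ _ _ a h⟩
instance : IsCancelAdd M := AddCommMagma.IsRightCancelAdd.toIsCancelAdd _

theorem le_iff (x y : M) : x ≤ y ↔ ∃ z, y = x + z := by
  rw [ax7]; exact exists_congr fun z => by rw [add_comm, eq_comm]

theorem cases_ (x : M) : x = 0 ∨ ∃ y, x = y + 1 := by
  refine ind (fun x => x = 0 ∨ ∃ y, x = y + 1) ?_ (by simp) ?_ x
  · repeat' first | apply Def.or | apply Def.ex | apply Def.eq | apply DT.add | apply DT.mul | apply DT.var | apply DT.const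
  · intro z h; exact Or.inr ⟨z, rfl⟩

theorem add_eq_zero_ {x y : M} (h : x + y = 0) : y = 0 := by
  rcases cases_ y with h' | ⟨z, rfl⟩
  · exact h'
  · rw [← add_assoc] at h; exact (ax1' _ h).elim

noncomputable instance : LinearOrder M where
  le_refl x := (le_iff _ _).2 ⟨0, by simp⟩
  le_trans x y z := by
    simp only [le_iff]; rintro ⟨a, rfl⟩ ⟨b, rfl⟩; exact ⟨a + b, by rw [add_assoc]⟩
  le_antisymm x y := by
    simp only [le_iff]
    rintro ⟨a, rfl⟩ ⟨b, h⟩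
    rw [add_assoc] at h
    have : a + b = 0 := add_left_cancel (a := x) (by rw [← h, add_zero])
    rw [add_comm] at this
    rw [add_eq_zero_ this, add_zero]
  le_total x y := by
    refine ind (fun y => x ≤ y ∨ y ≤ x) ?_ ?_ ?_ y
    · repeat' first | apply Def.or | apply Def.le | apply DT.var | apply DT.const
    · exact Or.inr ((le_iff _ _).2 ⟨x, by simp⟩)
    · rintro y (h | h)
      · obtain ⟨a, rfl⟩ := (le_iff _ _).1 h
        exact Or.inl ((le_iff _ _).2 ⟨a + 1, by rw [add_assoc]⟩)
      · obtain ⟨a, rfl⟩ := (le_iff _ _).1 h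
        rcases cases_ a with rfl | ⟨b, rfl⟩
        · exact Or.inl ((le_iff _ _).2 ⟨1, by simp⟩)
        · exact Or.inr ((le_iff _ _).2 ⟨b, by ring⟩)
  toDecidableLE := Classical.decRel _

theorem zero_le_ (x : M) : 0 ≤ x := (le_iff _ _).2 ⟨x, by simp⟩

instance : IsOrderedAddMonoid M where
  add_le_add_left x y h z := by
    obtain ⟨a, rfl⟩ := (le_iff _ _).1 h
    exact (le_iff _ _).2 ⟨a, by ring⟩

instance : IsOrderedCancelAddMonoid M where
  le_of_add_le_add_left x y z h := by
    obtain ⟨a, h⟩ := (le_iff _ _).1 h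
    exact (le_iff _ _).2 ⟨a, by rw [add_assoc] at h; exact add_left_cancel h⟩

instance : CanonicallyOrderedAdd M where
  le_add_self x y := (le_iff _ _).2 ⟨y, by ring⟩
  le_self_add x y := (le_iff _ _).2 ⟨y, by ring⟩
  exists_add_of_le h := (le_iff _ _).1 h

theorem lt_succ {x y : M} : x < y + 1 ↔ x ≤ y := by
  constructor
  · intro h
    by_contra h'
    push Not at h'
    obtain ⟨a, rfl⟩ := (le_iff _ _).1 h'.le
    rcases cases_ a with rfl | ⟨b, rfl⟩
    · simp at h'
    · rw [← add_assoc, add_right_comm] at h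
      have : y + 1 ≤ y + 1 + b := (le_iff _ _).2 ⟨b, rfl⟩
      exact absurd h (not_lt.2 this)
  · intro h
    refine lt_of_le_of_ne (le_trans h ((le_iff _ _).2 ⟨1, rfl⟩)) ?_
    rintro rfl
    obtain ⟨a, ha⟩ := (le_iff _ _).1 h
    rw [add_assoc] at ha
    have : 1 + a = 0 := add_left_cancel (a := y) (by rw [← ha, add_zero])
    rw [add_comm] at this
    exact ax1' _ this

instance : Nontrivial M := ⟨⟨0, 1, fun h => ax1' (0 : M) (by rw [← h, add_zero])⟩⟩

theorem succ_le {x y : M} : x + 1 ≤ y ↔ x < y := by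
  rw [← not_lt, lt_succ, not_le]

theorem pos_cases {x : M} (h : 0 < x) : ∃ y, x = y + 1 := by
  rcases cases_ x with rfl | h'
  · simp at h
  · exact h'

instance : IsStrictOrderedRing M where
  zero_le_one := zero_le_ _
  mul_lt_mul_of_pos_left x hx y z h := by
    obtain ⟨x', rfl⟩ := pos_cases hx
    obtain ⟨a, rfl⟩ := (le_iff _ _).1 (succ_le.2 h)
    rw [← succ_le]
    exact (le_iff _ _).2 ⟨a + x' + x' * a, by ring⟩
  mul_lt_mul_of_pos_right x hx y z h := by
    obtain ⟨x', rfl⟩ := pos_cases hx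
    obtain ⟨a, rfl⟩ := (le_iff _ _).1 (succ_le.2 h)
    rw [← succ_le]
    exact (le_iff _ _).2 ⟨a + x' + x' * a, by ring⟩

theorem Def.lt {k : ℕ} {f g : (Fin k → M) → M} (hf : DT f) (hg : DT g) :
    Def (fun v => f v < g v) := by
  simp only [← not_le]
  exact (Def.le hg hf).not

theorem Def.dvd {k : ℕ} {f g : (Fin k → M) → M} (hf : DT f) (hg : DT g) :
    Def (fun v => f v ∣ g v) := by
  obtain ⟨t, ht⟩ := hf
  obtain ⟨u, hu⟩ := hg
  refine ⟨∃' ((u.relabel (Sum.map id Fin.castSucc)) =' mulT (t.relabel (Sum.map id Fin.castSucc)) (.var (Sum.inr (Fin.last k)))), fun v => ?_⟩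
  simp only [BoundedFormula.realize_ex, BoundedFormula.realize_bdEqual, realize_mulT, Term.realize_relabel]
  have : ∀ a : M, Sum.elim id (Fin.snoc v a : Fin (k+1) → M) ∘ Sum.map id Fin.castSucc = Sum.elim id v := by
    intro a; funext x; rcases x with x | x <;> simp
  simp only [this, ht, hu, Term.realize, Sum.elim_inr, Fin.snoc_last]
  rfl

end PAM
end

section
namespace PAM
variable {M : PAM}

theorem pos_or (x : M) : x = 0 ∨ 1 ≤ x := by
  rcases cases_ x with h | ⟨y, rfl⟩
  · exact Or.inl h
  · exact Or.inr le_add_self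

theorem strong_ind (P : M → Prop) (hP : D1 P) (h : ∀ x, (∀ y, y < x → P y) → P x) (x : M) : P x := by
  have : ∀ x, ∀ y, y < x → P y := by
    refine ind _ ?_ (fun y hy => absurd hy (not_lt.2 (zero_le_ y))) ?_
    · apply Def.all; apply Def.imp
      · exact Def.lt (DT.var _) (DT.var _)
      · exact hP.comp (DT.var _)
    · intro x hx y hy
      rcases eq_or_lt_of_le (lt_succ.1 hy) with rfl | h'
      · exact h _ hx
      · exact hx y h'
  exact this (x + 1) x (lt_succ.2 le_rfl)

theorem D1.not {P : M → Prop} (hP : D1 P) : D1 (fun x => ¬ P x) := Def.not hP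

theorem exists_least (P : M → Prop) (hP : D1 P) {x : M} (hx : P x) : ∃ y, P y ∧ ∀ z, z < y → ¬ P z := by
  by_contra hc
  push Not at hc
  refine strong_ind (fun x => ¬ P x) hP.not ?_ x hx
  intro y hy hPy
  obtain ⟨z, hz, hPz⟩ := hc y hPy
  exact hy z hz hPz

/-- Collection. -/
theorem collect {R : M → M → Prop} (hR : Def (fun v : Fin 2 → M => R (v 0) (v 1))) (a : M)
    (h : ∀ x, x < a → ∃ y, R x y) : ∃ b, ∀ x, x < a → ∃ y, y ≤ b ∧ R x y := by
  have : ∀ c, c ≤ a → ∃ b, ∀ x, x < c → ∃ y, y ≤ b ∧ R x y := by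
    refine ind _ ?_ (fun _ => ⟨0, fun x hx => absurd hx (not_lt.2 (zero_le_ x))⟩) ?_
    · repeat' first | apply Def.const | apply Def.lt | apply Def.le | apply Def.ex | apply Def.all | apply Def.imp | apply Def.and | apply DT.var | apply DT.const
      exact Def.subst hR (f := ![fun w => w 2, fun w => w 3]) (fun i => by fin_cases i <;> exact DT.var _)
    · intro c ih hc
      obtain ⟨b, hb⟩ := ih (le_trans le_self_add hc)
      obtain ⟨y, hy⟩ := h c (succ_le.1 hc)
      refine ⟨max b y, fun x hx => ?_⟩
      rcases eq_or_lt_of_le (lt_succ.1 hx) with rfl | h'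
      · exact ⟨y, le_max_right _ _, hy⟩
      · obtain ⟨z, hz, h''⟩ := hb x h'
        exact ⟨z, le_trans hz (le_max_left _ _), h''⟩
  exact this a le_rfl

/-- Polynomial pairing. -/
def pr (x y : M) : M := (x + y) * (x + y) + x

theorem le_sq (s : M) : s ≤ s * s := by
  rcases pos_or s with rfl | h
  · simp
  · exact le_mul_of_one_le_left' h
theorem le_pr_left (x y : M) : x ≤ pr x y := le_add_self
theorem le_pr_right (x y : M) : y ≤ pr x y :=
  le_trans (le_trans le_add_self (le_sq (x + y))) le_self_add

theorem pr_mono {x y x' y' : M} (hx : x ≤ x') (hy : y ≤ y') : pr x y ≤ pr x' y' := by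
  unfold pr; gcongr

theorem pr_aux {s s' x x' : M} (hx : x ≤ s) (h : s * s + x = s' * s' + x') : ¬ s < s' := by
  intro hs
  obtain ⟨d, rfl⟩ := (le_iff _ _).1 (succ_le.2 hs)
  obtain ⟨e, rfl⟩ := (le_iff _ _).1 hx
  have h2 : (x + e) * (x + e) + x < (x + e + 1 + d) * (x + e + 1 + d) + x' := by
    rw [← succ_le, le_iff]
    exact ⟨x + e + e + d + (x + e + d) * d + (x + e) * d + d + x', by ring⟩
  exact absurd h h2.ne

theorem pr_inj {x y x' y' : M} (h : pr x y = pr x' y') : x = x' ∧ y = y' := by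
  have h1 := pr_aux (x' := x') (s' := x' + y') (s := x + y) (x := x) le_self_add h
  have h2 := pr_aux (x' := x) (s' := x + y) (s := x' + y') (x := x') le_self_add h.symm
  have h3 : x + y = x' + y' := le_antisymm (not_lt.1 h2) (not_lt.1 h1)
  unfold pr at h
  rw [h3] at h
  have := add_left_cancel h
  subst this
  exact ⟨rfl, add_left_cancel h3⟩

theorem pr_inj_iff {x y x' y' : M} : pr x y = pr x' y' ↔ x = x' ∧ y = y' :=
  ⟨pr_inj, fun ⟨h, h'⟩ => by rw [h, h']⟩

theorem DT.pr {k : ℕ} {f g : (Fin k → M) → M} (hf : DT f) (hg : DT g) :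
    DT (fun v => pr (f v) (g v)) :=
  DT.add (DT.mul (DT.add hf hg) (DT.add hf hg)) hf

/-! ### Comprehension -/

theorem dvd_cancel {u a b : M} (h : u ∣ a + b) (h' : u ∣ a) : u ∣ b := by
  obtain ⟨a', rfl⟩ := h'
  obtain ⟨c, hc⟩ := h
  rcases pos_or u with rfl | hu
  · simp at hc; simp [hc]
  · have hu' : 0 < u := lt_of_lt_of_le zero_lt_one hu
    have : a' ≤ c := le_of_mul_le_mul_left (hc ▸ le_self_add) hu'
    obtain ⟨e, rfl⟩ := (le_iff _ _).1 this
    refine ⟨e, ?_⟩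
    rw [mul_add] at hc
    exact add_left_cancel hc

theorem exists_common (a : M) : ∃ m : M, 0 < m ∧ ∀ i, 0 < i → i ≤ a → i ∣ m := by
  refine ind (fun a => ∃ m : M, 0 < m ∧ ∀ i, 0 < i → i ≤ a → i ∣ m) ?_ ?_ ?_ a
  · repeat' first | apply Def.const | apply Def.dvd | apply Def.lt | apply Def.le | apply Def.ex | apply Def.all | apply Def.imp | apply Def.and | apply DT.var | apply DT.const
  · exact ⟨1, zero_lt_one, fun i hi hi' => absurd hi (not_lt.2 hi')⟩
  · rintro x ⟨m, hm, h⟩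
    refine ⟨m * (x + 1), mul_pos hm (lt_succ.2 (zero_le_ _)), fun i hi hi' => ?_⟩
    rcases eq_or_lt_of_le hi' with rfl | h'
    · exact Dvd.intro_left m rfl
    · exact Dvd.dvd.mul_right (h i hi (lt_succ.1 h')) _

/-- Strong coprimality. -/
def Cop (u v : M) : Prop := ∀ w, u ∣ v * w → u ∣ w

theorem Cop.mul {u a b : M} (ha : Cop u a) (hb : Cop u b) : Cop u (a * b) :=
  fun w h => hb w (ha _ (by rwa [mul_assoc] at h))

theorem cop_base (m p : M) : Cop (1 + (p + 1) * m) m := by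
  intro w h
  have h1 : (1 + (p + 1) * m) ∣ (p + 1) * (m * w) + w := by
    exact ⟨w, by ring⟩
  exact dvd_cancel h1 (Dvd.dvd.mul_left h _)

theorem cop_of_dvd {u d m : M} (h : Cop u m) (hd : d ∣ m) : Cop u d := by
  intro w hw
  obtain ⟨m', rfl⟩ := hd
  apply h
  rw [mul_right_comm]
  exact Dvd.dvd.mul_right hw _

theorem cop_uu {a m p q : M} (hm : ∀ i, 0 < i → i ≤ a → i ∣ m) (hp : p < a) (hq : q < a) (hpq : p ≠ q) :
    Cop (1 + (p + 1) * m) (1 + (q + 1) * m) := by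
  rcases lt_or_gt_of_ne hpq with h | h
  · obtain ⟨d, rfl⟩ := (le_iff _ _).1 (succ_le.2 h)
    intro w hw
    have hd : (d + 1) ∣ m := hm _ (lt_succ.2 (zero_le_ _)) (by
      refine le_trans ?_ hq.le
      rw [add_right_comm, add_assoc]; exact le_add_self)
    have hc := (cop_of_dvd (cop_base m p) hd).mul (cop_base m p)
    apply hc
    refine dvd_cancel (a := (1 + (p + 1) * m) * w) (b := (d + 1) * m * w) ?_ (Dvd.intro _ rfl)
    convert hw using 1; ring
  · obtain ⟨d, rfl⟩ := (le_iff _ _).1 (succ_le.2 h)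
    intro w hw
    have hd : (d + 1) ∣ m := hm _ (lt_succ.2 (zero_le_ _)) (by
      refine le_trans ?_ hp.le
      rw [add_right_comm, add_assoc]; exact le_add_self)
    have hc := (cop_of_dvd (cop_base m (q + 1 + d)) hd).mul (cop_base m (q + 1 + d))
    apply hc
    refine dvd_cancel (a := (1 + (q + 1) * m) * w) (b := (d + 1) * m * w) ?_ hw
    exact ⟨w, by ring⟩

theorem comprehension (D : M → Prop) (hD : D1 D) (a : M) :
    ∃ c m : M, ∀ p, p < a → ((1 + (p + 1) * m) ∣ c ↔ D p) := by
  obtain ⟨m, hm0, hm⟩ := exists_common a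
  have key : ∀ b : M, ∃ c : M, ∀ p, p < a → ((p < b ∧ D p) → (1 + (p + 1) * m) ∣ c) ∧
      (¬ (p < b ∧ D p) → ∀ w, (1 + (p + 1) * m) ∣ c * w → (1 + (p + 1) * m) ∣ w) := by
    refine ind _ ?_ ?_ ?_
    · repeat' first | apply Def.const | apply Def.dvd | apply Def.lt | apply Def.le | apply Def.ex | apply Def.all | apply Def.not | apply Def.and | apply Def.imp | apply DT.var | apply DT.const | apply DT.add | apply DT.mul | apply hD.comp
    · exact ⟨1, fun p _ => ⟨fun h => absurd h.1 (not_lt.2 (zero_le_ _)), fun _ w => by simp⟩⟩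
    · rintro b ⟨c, hc⟩
      by_cases hb : b < a ∧ D b
      · refine ⟨c * (1 + (b + 1) * m), fun p hp => ⟨?_, ?_⟩⟩
        · rintro ⟨h1, h2⟩
          rcases eq_or_lt_of_le (lt_succ.1 h1) with rfl | h'
          · exact Dvd.intro_left _ rfl
          · exact Dvd.dvd.mul_right ((hc p hp).1 ⟨h', h2⟩) _
        · intro h
          have hpb : p ≠ b := by
            rintro rfl
            exact h ⟨lt_succ.2 le_rfl, hb.2⟩
          refine Cop.mul ((hc p hp).2 ?_) (cop_uu hm hp hb.1 hpb)
          rintro ⟨h1, h2⟩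
          exact h ⟨h1.trans (lt_succ.2 le_rfl), h2⟩
      · refine ⟨c, fun p hp => ?_⟩
        have : (p < b + 1 ∧ D p) ↔ (p < b ∧ D p) := by
          constructor
          · rintro ⟨h1, h2⟩
            refine ⟨lt_of_le_of_ne (lt_succ.1 h1) ?_, h2⟩
            rintro rfl
            exact hb ⟨hp, h2⟩
          · rintro ⟨h1, h2⟩
            exact ⟨h1.trans (lt_succ.2 le_rfl), h2⟩
        simp only [this]; exact hc p hp
  obtain ⟨c, hc⟩ := key a
  refine ⟨c, m, fun p hp => ⟨fun h => ?_, fun h => (hc p hp).1 ⟨hp, h⟩⟩⟩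
  by_contra hDp
  have h1 := (hc p hp).2 (fun h => hDp h.2) 1 (by simpa using h)
  obtain ⟨e, he⟩ := h1
  rcases pos_or e with rfl | h'
  · simp at he
  · have : (1 : M) < (1 + (p + 1) * m) * e := by
      refine lt_of_lt_of_le ?_ (le_mul_of_one_le_right' h')
      have h3 : 0 < (p + 1) * m := mul_pos (lt_succ.2 (zero_le_ _)) hm0
      exact lt_add_of_pos_right _ h3
    exact absurd he this.ne

end PAM
end

section

theorem func_cases {β : Type} : ∀ {n : ℕ} (F : LA.Functions n) (ts : Fin n → LA.Term β),
    (Term.func F ts = Constants.term (show LA.Constants from Unit.unit)) ∨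
    (∃ i, Term.func F ts = Functions.apply₁ (show LA.Functions 1 from Unit.unit) (ts i)) ∨
    (∃ i j b, Term.func F ts = Functions.apply₂ (show LA.Functions 2 from b) (ts i) (ts j)) := by
  intro n F ts
  match n, F, ts with
  | 0, F, ts => left; exact congrArg (Term.func F) (Subsingleton.elim _ _)
  | 1, F, ts =>
    right; left
    refine ⟨0, ?_⟩
    have : ts = ![ts 0] := by funext i; fin_cases i; rfl
    show Term.func F ts = Term.func _ ![ts 0]
    rw [← this]
    rfl
  | 2, F, ts =>
    right; right
    refine ⟨0, 1, F, ?_⟩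
    have : ts = ![ts 0, ts 1] := by funext i; fin_cases i <;> rfl
    show Term.func F ts = Term.func _ ![ts 0, ts 1]
    rw [← this]
  | (n + 3), F, ts => exact Empty.elim F

/-- Induction principle for terms of arithmetic. -/
theorem term_ind {α : Type} {n : ℕ} {P : LA.Term (α ⊕ Fin n) → Prop}
    (hl : ∀ a, P (.var (Sum.inl a))) (hv : ∀ i, P (.var (Sum.inr i))) (h0 : P zeroT)
    (hs : ∀ t, P t → P (succT t)) (ha : ∀ t u, P t → P u → P (addT t u))
    (hm : ∀ t u, P t → P u → P (mulT t u)) (t : LA.Term (α ⊕ Fin n)) : P t := by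
  induction t with
  | var x => rcases x with x | x; exacts [hl x, hv x]
  | func F ts ih =>
    rcases func_cases F ts with h | ⟨i, h⟩ | ⟨i, j, b, h⟩
    · rw [h]; exact h0
    · rw [h]; exact hs _ (ih i)
    · rw [h]
      cases b
      · exact ha _ _ (ih i) (ih j)
      · exact hm _ _ (ih i) (ih j)

/-- The standard structure. -/
@[reducible] def natStr : LA.Structure ℕ where
  funMap {n} F v := match n, F, v with
    | 0, _, _ => 0
    | 1, _, v => v 0 + 1
    | 2, false, v => v 0 + v 1
    | 2, true, v => v 0 * v 1
    | (_ + 3), F, _ => Empty.elim F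
  RelMap {n} F v := match n, F, v with
    | 0, F, _ => Empty.elim F
    | 1, F, _ => Empty.elim F
    | 2, _, v => v 0 ≤ v 1
    | (_ + 3), F, _ => Empty.elim F

theorem nat_models : @Theory.Model LA ℕ natStr PAAx := by
  let _ := natStr
  have e0 : opZ ℕ = 0 := rfl
  have eS : ∀ x : ℕ, opS x = x + 1 := fun _ => rfl
  have eA : ∀ x y : ℕ, opA x y = x + y := fun _ _ => rfl
  have eM : ∀ x y : ℕ, opM x y = x * y := fun _ _ => rfl
  have eL : ∀ x y : ℕ, opL x y ↔ x ≤ y := fun _ _ => Iff.rfl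
  have s0 : ∀ (f : Fin 0 → ℕ) (x : ℕ), (Fin.snoc f x : Fin 1 → ℕ) 0 = x := fun _ _ => rfl
  have s1 : ∀ (f : Fin 1 → ℕ) (x : ℕ), (Fin.snoc f x : Fin 2 → ℕ) 0 = f 0 := fun _ _ => rfl
  have s2 : ∀ (f : Fin 1 → ℕ) (x : ℕ), (Fin.snoc f x : Fin 2 → ℕ) 1 = x := fun _ _ => rfl
  have s3 : ∀ (f : Fin 2 → ℕ) (x : ℕ), (Fin.snoc f x : Fin 3 → ℕ) 0 = f 0 := fun _ _ => rfl
  have s4 : ∀ (f : Fin 2 → ℕ) (x : ℕ), (Fin.snoc f x : Fin 3 → ℕ) 1 = f 1 := fun _ _ => rfl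
  have s5 : ∀ (f : Fin 2 → ℕ) (x : ℕ), (Fin.snoc f x : Fin 3 → ℕ) 2 = x := fun _ _ => rfl
  constructor
  rintro φ ((rfl | rfl | rfl | rfl | rfl | rfl | rfl) | ⟨k, ψ, rfl⟩)
  · intro x
    simp only [BoundedFormula.realize_not, BoundedFormula.realize_bdEqual, realize_succT, realize_zeroT, realize_vT, s0, e0, eS]
    omega
  · intro x y
    simp only [BoundedFormula.realize_imp, BoundedFormula.realize_bdEqual, realize_succT, realize_vT, s0, s1, s2, eS]
    omega
  · intro x
    simp only [BoundedFormula.realize_bdEqual, realize_addT, realize_zeroT, realize_vT, s0, e0, eA]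
    omega
  · intro x y
    simp only [BoundedFormula.realize_bdEqual, realize_succT, realize_addT, realize_vT, s0, s1, s2, eS, eA]
    omega
  · intro x
    simp only [BoundedFormula.realize_bdEqual, realize_mulT, realize_zeroT, realize_vT, s0, e0, eM]
    omega
  · intro x y
    simp only [BoundedFormula.realize_bdEqual, realize_succT, realize_addT, realize_mulT, realize_vT, s0, s1, s2, eS, eA, eM]
    ring
  · intro x y
    simp only [BoundedFormula.realize_iff, BoundedFormula.realize_ex, BoundedFormula.realize_bdEqual,
      realize_leF, realize_addT, realize_vT, s0, s1, s2, s3, s4, s5, eA, eL]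
    exact ⟨fun h => ⟨y - x, by omega⟩, fun ⟨z, hz⟩ => by omega⟩
  · show (indAxiom ψ).Realize ℕ
    refine BoundedFormula.realize_alls.2 fun xs => ?_
    simp only [BoundedFormula.realize_imp, BoundedFormula.realize_inf, BoundedFormula.realize_all,
      BoundedFormula.realize_bdEqual, realize_vT, realize_zeroT, realize_succT, Fin.snoc_last,
      Fin.snoc_castSucc, e0, eS]
    rintro ⟨h0, h1⟩ x
    induction x with
    | zero => exact h0 0 rfl
    | succ x ih =>
      have := h1 x ih (x + 1) rfl
      rw [BoundedFormula.realize_liftAt_one (by omega)] at this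
      convert this using 1
      funext i
      refine Fin.lastCases ?_ (fun i => ?_) i <;> simp

/-- The standard model. -/
def NN : PAM := @PAM.mk ℕ natStr _ nat_models

namespace PAM
variable {M : PAM}

theorem NN_cast (x : NN) : ∃ n : ℕ, x = (Nat.cast n : NN) := by
  have : ∀ k : ℕ, ∃ n : ℕ, @Eq NN k (Nat.cast n : NN) := by
    intro k
    induction k with
    | zero => exact ⟨0, Nat.cast_zero.symm⟩
    | succ k ih =>
      obtain ⟨n, hn⟩ := ih
      refine ⟨n + 1, ?_⟩
      have h2 : opS (X := NN) (Nat.cast n : NN) = (Nat.cast (n + 1) : NN) := by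
        rw [opS_eq, Nat.cast_succ]
      have h3 : @Eq NN (opS (X := NN) k) (Nat.cast (n + 1) : NN) := by rw [← h2, ← hn]
      exact h3
  exact this x

attribute [irreducible] NN

theorem le_cast {n : ℕ} {x : M} (h : x ≤ (n : M)) : ∃ m : ℕ, m ≤ n ∧ x = (m : M) := by
  induction n with
  | zero => exact ⟨0, le_rfl, le_antisymm h (by simp)⟩
  | succ n ih =>
    rcases eq_or_lt_of_le h with rfl | h
    · exact ⟨n + 1, le_rfl, rfl⟩
    · push_cast at h
      obtain ⟨m, hm, rfl⟩ := ih (lt_succ.1 h)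
      exact ⟨m, by omega, rfl⟩

theorem term_cast {m : ℕ} (t : LA.Term (Empty ⊕ Fin m)) (v : Fin m → ℕ) :
    ∃ n : ℕ, ∀ M : PAM, t.realize (Sum.elim default (fun i => (v i : M))) = (n : M) := by
  induction t using term_ind with
  | hl a => exact a.elim
  | hv i => exact ⟨v i, fun M => rfl⟩
  | h0 => exact ⟨0, fun M => by rw [realize_zeroT]; simp; rfl⟩
  | hs t ih =>
    obtain ⟨n, hn⟩ := ih
    exact ⟨n + 1, fun M => by rw [realize_succT, hn, opS_eq]; simp⟩
  | ha t u ih1 ih2 =>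
    obtain ⟨n, hn⟩ := ih1
    obtain ⟨n', hn'⟩ := ih2
    exact ⟨n + n', fun M => by rw [realize_addT, hn, hn']; push_cast; rfl⟩
  | hm t u ih1 ih2 =>
    obtain ⟨n, hn⟩ := ih1
    obtain ⟨n', hn'⟩ := ih2
    exact ⟨n * n', fun M => by rw [realize_mulT, hn, hn']; push_cast; rfl⟩

theorem realize_up {X : Type} [LA.Structure X] {m : ℕ} (t : LA.Term (Empty ⊕ Fin m)) (v : Fin m → X) (x : X) :
    (t.relabel (Sum.map id Fin.castSucc)).realize (Sum.elim default (Fin.snoc v x : Fin (m+1) → X))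
      = t.realize (Sum.elim default v) := by
  rw [Term.realize_relabel]
  congr 1
  funext x; rcases x with x | x <;> simp

theorem realize_vlast {X : Type} [LA.Structure X] {m : ℕ} (v : Fin m → X) (x : X) :
    (vT (Fin.last m)).realize (Sum.elim default (Fin.snoc v x : Fin (m+1) → X)) = x := by
  rw [realize_vT]; simp

theorem snoc_cast {m : ℕ} (v : Fin m → ℕ) (n : ℕ) :
    (Fin.snoc (fun i => (v i : M)) (n : M) : Fin (m+1) → M) = fun i => ((Fin.snoc v n : Fin (m+1) → ℕ) i : M) := by
  funext i; refine Fin.lastCases ?_ (fun i => ?_) i <;> simp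

theorem delta0_abs {m : ℕ} {φ : LA.BoundedFormula Empty m} (h : IsDelta0 φ) (v : Fin m → ℕ) (M N : PAM) :
    φ.Realize default (fun i => (v i : M)) ↔ φ.Realize default (fun i => (v i : N)) := by
  induction h with
  | falsum => exact Iff.rfl
  | equal t u =>
    obtain ⟨n, hn⟩ := term_cast t v
    obtain ⟨n', hn'⟩ := term_cast u v
    rw [BoundedFormula.realize_bdEqual, BoundedFormula.realize_bdEqual, hn, hn', hn, hn']
    simp
  | le t u =>
    obtain ⟨n, hn⟩ := term_cast t v
    obtain ⟨n', hn'⟩ := term_cast u v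
    rw [realize_leF, realize_leF, hn, hn', hn, hn']
    show (n : M) ≤ (n' : M) ↔ (n : N) ≤ (n' : N)
    simp
  | imp _ _ ih1 ih2 => rw [BoundedFormula.realize_imp, BoundedFormula.realize_imp, ih1, ih2]
  | ball t _ ih =>
    obtain ⟨n, hn⟩ := term_cast t v
    simp only [BoundedFormula.realize_all, BoundedFormula.realize_imp, realize_leF, realize_up, realize_vlast, hn]
    constructor
    · intro h x hx
      obtain ⟨j, hj, rfl⟩ := le_cast (M := N) hx
      rw [snoc_cast, ← ih, ← snoc_cast]
      exact h _ (show (j : M) ≤ (n : M) by exact_mod_cast hj)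
    · intro h x hx
      obtain ⟨j, hj, rfl⟩ := le_cast (M := M) hx
      rw [snoc_cast, ih, ← snoc_cast]
      exact h _ (show (j : N) ≤ (n : N) by exact_mod_cast hj)
  | bex t _ ih =>
    obtain ⟨n, hn⟩ := term_cast t v
    simp only [BoundedFormula.realize_ex, BoundedFormula.realize_inf, realize_leF, realize_up, realize_vlast, hn]
    constructor
    · rintro ⟨x, hx, h⟩
      obtain ⟨j, hj, rfl⟩ := le_cast (M := M) hx
      rw [snoc_cast, ih, ← snoc_cast] at h
      exact ⟨_, (show (j : N) ≤ (n : N) by exact_mod_cast hj), h⟩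
    · rintro ⟨x, hx, h⟩
      obtain ⟨j, hj, rfl⟩ := le_cast (M := N) hx
      rw [snoc_cast, ← ih, ← snoc_cast] at h
      exact ⟨_, (show (j : M) ≤ (n : M) by exact_mod_cast hj), h⟩

end PAM
end

section
open PAM

/-- Uniform term functions. -/
def Tt {k : ℕ} (f : ∀ M : PAM, (Fin k → M) → M) : Prop :=
  ∃ t : LA.Term (Empty ⊕ Fin k), ∀ (M : PAM) (v : Fin k → M), t.realize (Sum.elim default v) = f M v

/-- Uniformly bounded-definable relations. -/
def D0 {k : ℕ} (R : ∀ M : PAM, (Fin k → M) → Prop) : Prop :=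
  ∃ φ : LA.BoundedFormula Empty k, IsDelta0 φ ∧ ∀ (M : PAM) (v : Fin k → M), φ.Realize default v ↔ R M v

section
variable {k : ℕ}

theorem Tt.var (i : Fin k) : Tt (fun _ v => v i) := ⟨.var (Sum.inr i), fun _ _ => rfl⟩
theorem Tt.zero : Tt (k := k) (fun _ _ => 0) := ⟨zeroT, fun _ _ => realize_zeroT _⟩
theorem Tt.add {f g : ∀ M : PAM, (Fin k → M) → M} (hf : Tt f) (hg : Tt g) :
    Tt (fun M v => f M v + g M v) := by
  obtain ⟨t, ht⟩ := hf
  obtain ⟨u, hu⟩ := hg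
  exact ⟨addT t u, fun M v => by rw [realize_addT, ht, hu]; rfl⟩
theorem Tt.mul {f g : ∀ M : PAM, (Fin k → M) → M} (hf : Tt f) (hg : Tt g) :
    Tt (fun M v => f M v * g M v) := by
  obtain ⟨t, ht⟩ := hf
  obtain ⟨u, hu⟩ := hg
  exact ⟨mulT t u, fun M v => by rw [realize_mulT, ht, hu]; rfl⟩
theorem Tt.one : Tt (k := k) (fun _ _ => 1) := ⟨succT zeroT, fun _ _ => by rw [realize_succT, realize_zeroT]; rfl⟩
theorem Tt.num (n : ℕ) : Tt (k := k) (fun _ _ => (n : _)) := by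
  induction n with
  | zero => simpa using Tt.zero
  | succ n ih => simpa using Tt.add ih Tt.one
theorem Tt.pr {f g : ∀ M : PAM, (Fin k → M) → M} (hf : Tt f) (hg : Tt g) :
    Tt (fun M v => pr (f M v) (g M v)) := ((hf.add hg).mul (hf.add hg)).add hf
theorem Tt.up {f : ∀ M : PAM, (Fin k → M) → M} (hf : Tt f) :
    Tt (fun M (v : Fin (k+1) → M) => f M (fun i => v i.castSucc)) := by
  obtain ⟨t, ht⟩ := hf
  refine ⟨t.relabel (Sum.map id Fin.castSucc), fun M v => ?_⟩
  show _ = f M (fun i => v i.castSucc)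
  rw [Term.realize_relabel, ← ht]
  congr 1
  funext x; rcases x with x | x <;> rfl

theorem Tt.realize {m : ℕ} (t : LA.Term (Empty ⊕ Fin m)) {f : Fin m → ∀ M : PAM, (Fin k → M) → M}
    (hf : ∀ i, Tt (f i)) : Tt (fun M v => t.realize (Sum.elim default (fun i => f i M v))) := by
  induction t with
  | var x =>
    rcases x with x | x
    · exact x.elim
    · exact hf x
  | func F ts ih =>
    choose t ht using ih
    exact ⟨.func F t, fun M v => by simp only [Term.realize, ht]⟩

theorem D0.congr {R S : ∀ M : PAM, (Fin k → M) → Prop} (h : D0 R) (h' : ∀ M v, S M v ↔ R M v) : D0 S := by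
  obtain ⟨φ, h1, h2⟩ := h
  exact ⟨φ, h1, fun M v => (h2 M v).trans (h' M v).symm⟩
theorem D0.eq {f g : ∀ M : PAM, (Fin k → M) → M} (hf : Tt f) (hg : Tt g) :
    D0 (fun M v => f M v = g M v) := by
  obtain ⟨t, ht⟩ := hf
  obtain ⟨u, hu⟩ := hg
  exact ⟨t =' u, .equal _ _, fun M v => by rw [BoundedFormula.realize_bdEqual, ht, hu]⟩
theorem D0.le {f g : ∀ M : PAM, (Fin k → M) → M} (hf : Tt f) (hg : Tt g) :
    D0 (fun M v => f M v ≤ g M v) := by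
  obtain ⟨t, ht⟩ := hf
  obtain ⟨u, hu⟩ := hg
  exact ⟨leF t u, .le _ _, fun M v => by rw [realize_leF, ht, hu]; rfl⟩
theorem D0.false : D0 (fun _ (_ : Fin k → _) => False) := ⟨⊥, .falsum, fun _ _ => Iff.rfl⟩
theorem D0.imp {P Q : ∀ M : PAM, (Fin k → M) → Prop} (hP : D0 P) (hQ : D0 Q) :
    D0 (fun M v => P M v → Q M v) := by
  obtain ⟨t, ht', ht⟩ := hP
  obtain ⟨u, hu', hu⟩ := hQ
  exact ⟨t ⟹ u, .imp ht' hu', fun M v => by rw [BoundedFormula.realize_imp, ht, hu]⟩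
theorem D0.not {P : ∀ M : PAM, (Fin k → M) → Prop} (hP : D0 P) : D0 (fun M v => ¬ P M v) :=
  hP.imp D0.false
theorem D0.true : D0 (fun _ (_ : Fin k → _) => True) := D0.congr D0.false.not (by simp)
theorem D0.or {P Q : ∀ M : PAM, (Fin k → M) → Prop} (hP : D0 P) (hQ : D0 Q) :
    D0 (fun M v => P M v ∨ Q M v) :=
  D0.congr (hP.not.imp hQ) (fun _ _ => or_iff_not_imp_left)
theorem D0.and {P Q : ∀ M : PAM, (Fin k → M) → Prop} (hP : D0 P) (hQ : D0 Q) :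
    D0 (fun M v => P M v ∧ Q M v) :=
  D0.congr (hP.imp hQ.not).not (fun _ _ => by tauto)
theorem D0.iff {P Q : ∀ M : PAM, (Fin k → M) → Prop} (hP : D0 P) (hQ : D0 Q) :
    D0 (fun M v => P M v ↔ Q M v) :=
  D0.congr ((hP.imp hQ).and (hQ.imp hP)) (fun _ _ => by tauto)
theorem D0.lt {f g : ∀ M : PAM, (Fin k → M) → M} (hf : Tt f) (hg : Tt g) :
    D0 (fun M v => f M v < g M v) := D0.congr (D0.le hg hf).not (fun _ _ => not_le.symm)
theorem D0.ball {f : ∀ M : PAM, (Fin k → M) → M} (hf : Tt f) {Q : ∀ M : PAM, (Fin k → M) → M → Prop}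
    (hQ : D0 (fun M (w : Fin (k+1) → M) => Q M (fun i => w i.castSucc) (w (Fin.last k)))) :
    D0 (fun M v => ∀ x, x ≤ f M v → Q M v x) := by
  obtain ⟨t, ht⟩ := hf
  obtain ⟨u, hu', hu⟩ := hQ
  refine ⟨_, .ball t hu', fun M v => ?_⟩
  simp only [BoundedFormula.realize_all, BoundedFormula.realize_imp, realize_leF, realize_up, realize_vlast, ht, hu]
  simp only [Fin.snoc_castSucc, Fin.snoc_last]
  rfl
theorem D0.bex {f : ∀ M : PAM, (Fin k → M) → M} (hf : Tt f) {Q : ∀ M : PAM, (Fin k → M) → M → Prop}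
    (hQ : D0 (fun M (w : Fin (k+1) → M) => Q M (fun i => w i.castSucc) (w (Fin.last k)))) :
    D0 (fun M v => ∃ x, x ≤ f M v ∧ Q M v x) := by
  refine D0.congr (D0.ball (Q := fun M v x => ¬ Q M v x) hf hQ.not).not fun M v => ?_
  push Not; rfl
theorem D0.ballt {f : ∀ M : PAM, (Fin k → M) → M} (hf : Tt f) {Q : ∀ M : PAM, (Fin k → M) → M → Prop}
    (hQ : D0 (fun M (w : Fin (k+1) → M) => Q M (fun i => w i.castSucc) (w (Fin.last k)))) :
    D0 (fun M v => ∀ x, x < f M v → Q M v x) := by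
  refine D0.congr (D0.ball hf (Q := fun M v x => x < f M v → Q M v x) ?_) ?_
  · exact D0.imp (D0.lt (Tt.var _) hf.up) hQ
  · exact fun M v => ⟨fun h x _ => h x, fun h x hx => h x hx.le hx⟩
theorem D0.bext {f : ∀ M : PAM, (Fin k → M) → M} (hf : Tt f) {Q : ∀ M : PAM, (Fin k → M) → M → Prop}
    (hQ : D0 (fun M (w : Fin (k+1) → M) => Q M (fun i => w i.castSucc) (w (Fin.last k)))) :
    D0 (fun M v => ∃ x, x < f M v ∧ Q M v x) := by
  refine D0.congr (D0.ballt (Q := fun M v x => ¬ Q M v x) hf hQ.not).not fun M v => ?_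
  push Not; rfl
theorem D0.dvd {f g : ∀ M : PAM, (Fin k → M) → M} (hf : Tt f) (hg : Tt g) :
    D0 (fun M v => f M v ∣ g M v) := by
  refine D0.congr (D0.bex hg (Q := fun M v x => g M v = f M v * x) ?_) ?_
  · exact D0.eq hg.up (hf.up.mul (Tt.var _))
  · refine fun M v => ⟨fun ⟨c, hc⟩ => ?_, fun ⟨c, _, h⟩ => ⟨c, h⟩⟩
    rcases pos_or (f M v) with h | h
    · exact ⟨0, zero_le_ _, by rw [hc, h]; simp⟩
    · exact ⟨c, by rw [hc]; exact le_mul_of_one_le_left' h, hc⟩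

theorem snoc_vec {X : Type*} {m : ℕ} (v : Fin m → X) (x : X) {Y : (Fin (m+1) → X) → Prop} :
    Y (Fin.snoc v x) ↔ Y (fun i => (Fin.snoc v x : Fin (m+1) → X) i) := Iff.rfl

theorem Tt.snoc {m : ℕ} {f : Fin m → ∀ M : PAM, (Fin k → M) → M} (hf : ∀ i, Tt (f i))
    {g : ∀ M : PAM, (Fin k → M) → M} (hg : Tt g) (i : Fin (m+1)) :
    Tt (fun M v => (Fin.snoc (fun i => f i M v) (g M v) : Fin (m+1) → M) i) := by
  refine Fin.lastCases ?_ (fun i => ?_) i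
  · simpa using hg
  · simpa using hf i

theorem D0.realize {m : ℕ} {φ : LA.BoundedFormula Empty m} (hφ : IsDelta0 φ) {k : ℕ}
    {f : Fin m → ∀ M : PAM, (Fin k → M) → M}
    (hf : ∀ i, Tt (f i)) : D0 (fun M v => φ.Realize default (fun i => f i M v)) := by
  induction hφ generalizing k with
  | falsum => exact D0.false
  | equal t u =>
    refine D0.congr (D0.eq (Tt.realize t hf) (Tt.realize u hf)) ?_
    exact (fun M v => by rw [BoundedFormula.realize_bdEqual])
  | le t u =>
    refine D0.congr (D0.le (Tt.realize t hf) (Tt.realize u hf)) ?_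
    exact (fun M v => by rw [realize_leF]; rfl)
  | imp _ _ ih1 ih2 => exact D0.congr (D0.imp (ih1 hf) (ih2 hf)) (fun M v => by rw [BoundedFormula.realize_imp])
  | @ball m t φ _ ih =>
    refine D0.congr (D0.ball (Tt.realize t hf) (Q := fun M v x => φ.Realize default (Fin.snoc (fun i => f i M v) x)) ?_) ?_
    · exact ih (fun i => Tt.snoc (fun i => (hf i).up) (Tt.var _) i)
    · intro M v
      simp only [BoundedFormula.realize_all, BoundedFormula.realize_imp, realize_leF, realize_up, realize_vlast]
      rfl
  | @bex m t φ _ ih =>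
    refine D0.congr (D0.bex (Tt.realize t hf) (Q := fun M v x => φ.Realize default (Fin.snoc (fun i => f i M v) x)) ?_) ?_
    · exact ih (fun i => Tt.snoc (fun i => (hf i).up) (Tt.var _) i)
    · intro M v
      simp only [BoundedFormula.realize_ex, BoundedFormula.realize_inf, realize_leF, realize_up, realize_vlast]
      rfl

theorem D0.subst {m : ℕ} {R : ∀ M : PAM, (Fin m → M) → Prop} (hR : D0 R)
    {f : Fin m → ∀ M : PAM, (Fin k → M) → M} (hf : ∀ i, Tt (f i)) :
    D0 (fun M v => R M (fun i => f i M v)) := by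
  obtain ⟨φ, h1, h2⟩ := hR
  exact D0.congr (D0.realize h1 hf) (fun M v => (h2 _ _).symm)

end

/-- The semantic hierarchy: uniformly `Σ_n` relations. -/
def Sg : ℕ → ∀ {k : ℕ}, (∀ M : PAM, (Fin k → M) → Prop) → Prop
  | 0, _, R => D0 R
  | (n+1), k, R => ∃ Q : ∀ M : PAM, (Fin k → M) → M → Prop,
      Sg n (fun M (w : Fin (k+1) → M) => Q M (fun i => w i.castSucc) (w (Fin.last k))) ∧
      ∀ M v, R M v ↔ ∃ x, ¬ Q M v x

/-- Uniformly `Π_n` relations. -/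
def Pg (n : ℕ) {k : ℕ} (R : ∀ M : PAM, (Fin k → M) → Prop) : Prop := Sg n (fun M v => ¬ R M v)

theorem Sg.congr {n k : ℕ} {R S : ∀ M : PAM, (Fin k → M) → Prop} (h : Sg n R) (h' : ∀ M v, S M v ↔ R M v) : Sg n S := by
  have : S = R := by funext M v; exact propext (h' M v)
  rwa [this]
theorem Pg.congr {n k : ℕ} {R S : ∀ M : PAM, (Fin k → M) → Prop} (h : Pg n R) (h' : ∀ M v, S M v ↔ R M v) : Pg n S :=
  Sg.congr h (fun M v => not_congr (h' M v))
theorem Sg.not {n k : ℕ} {R : ∀ M : PAM, (Fin k → M) → Prop} (h : Sg n R) : Pg n (fun M v => ¬ R M v) :=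
  Sg.congr h (fun _ _ => not_not)
theorem Pg.not {n k : ℕ} {R : ∀ M : PAM, (Fin k → M) → Prop} (h : Pg n R) : Sg n (fun M v => ¬ R M v) := h
theorem Pg.ex {n k : ℕ} {Q : ∀ M : PAM, (Fin k → M) → M → Prop}
    (h : Pg n (fun M (w : Fin (k+1) → M) => Q M (fun i => w i.castSucc) (w (Fin.last k)))) :
    Sg (n+1) (fun M v => ∃ x, Q M v x) :=
  ⟨fun M v x => ¬ Q M v x, h, fun _ _ => by simp⟩
theorem Sg.elim {n k : ℕ} {R : ∀ M : PAM, (Fin k → M) → Prop} (h : Sg (n+1) R) :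
    ∃ Q : ∀ M : PAM, (Fin k → M) → M → Prop,
      Pg n (fun M (w : Fin (k+1) → M) => Q M (fun i => w i.castSucc) (w (Fin.last k))) ∧
      R = fun M v => ∃ x, Q M v x := by
  obtain ⟨Q, h1, h2⟩ := h
  refine ⟨fun M v x => ¬ Q M v x, h1.not, ?_⟩
  funext M v; exact propext (h2 M v)

/-- The bundle of closure properties. -/
structure Cl (n : ℕ) : Prop where
  subst : ∀ {k m : ℕ} {R : ∀ M : PAM, (Fin m → M) → Prop}, Sg n R →
    ∀ {f : Fin m → ∀ M : PAM, (Fin k → M) → M}, (∀ i, Tt (f i)) → Sg n (fun M v => R M (fun i => f i M v))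
  and : ∀ {k : ℕ} {R S : ∀ M : PAM, (Fin k → M) → Prop}, Sg n R → Sg n S → Sg n (fun M v => R M v ∧ S M v)
  or : ∀ {k : ℕ} {R S : ∀ M : PAM, (Fin k → M) → Prop}, Sg n R → Sg n S → Sg n (fun M v => R M v ∨ S M v)
  ball : ∀ {k : ℕ} {f : ∀ M : PAM, (Fin k → M) → M}, Tt f → ∀ {Q : ∀ M : PAM, (Fin k → M) → M → Prop},
    Sg n (fun M (w : Fin (k+1) → M) => Q M (fun i => w i.castSucc) (w (Fin.last k))) →
    Sg n (fun M v => ∀ x, x ≤ f M v → Q M v x)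
  bex : ∀ {k : ℕ} {f : ∀ M : PAM, (Fin k → M) → M}, Tt f → ∀ {Q : ∀ M : PAM, (Fin k → M) → M → Prop},
    Sg n (fun M (w : Fin (k+1) → M) => Q M (fun i => w i.castSucc) (w (Fin.last k))) →
    Sg n (fun M v => ∃ x, x ≤ f M v ∧ Q M v x)

theorem cl_zero : Cl 0 where
  subst h _ hf := D0.subst h hf
  and h h' := D0.and h h'
  or h h' := D0.or h h'
  ball h _ h' := D0.ball h h'
  bex h _ h' := D0.bex h h'

namespace Cl
theorem psubst {n : ℕ} (hc : Cl n) {k m : ℕ} {R : ∀ M : PAM, (Fin m → M) → Prop} (h : Pg n R)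
    {f : Fin m → ∀ M : PAM, (Fin k → M) → M} (hf : ∀ i, Tt (f i)) : Pg n (fun M v => R M (fun i => f i M v)) :=
  hc.subst h hf
theorem pand {n : ℕ} (hc : Cl n) {k : ℕ} {R S : ∀ M : PAM, (Fin k → M) → Prop} (h : Pg n R) (h' : Pg n S) :
    Pg n (fun M v => R M v ∧ S M v) :=
  Sg.congr (hc.or h h') (fun _ _ => by tauto)
theorem por {n : ℕ} (hc : Cl n) {k : ℕ} {R S : ∀ M : PAM, (Fin k → M) → Prop} (h : Pg n R) (h' : Pg n S) :
    Pg n (fun M v => R M v ∨ S M v) :=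
  Sg.congr (hc.and h h') (fun _ _ => by tauto)
theorem pball {n : ℕ} (hc : Cl n) {k : ℕ} {f : ∀ M : PAM, (Fin k → M) → M} (hf : Tt f) {Q : ∀ M : PAM, (Fin k → M) → M → Prop}
    (h : Pg n (fun M (w : Fin (k+1) → M) => Q M (fun i => w i.castSucc) (w (Fin.last k)))) :
    Pg n (fun M v => ∀ x, x ≤ f M v → Q M v x) :=
  Sg.congr (hc.bex (Q := fun M v x => ¬ Q M v x) hf h) (fun _ _ => by push Not; rfl)
theorem pbex {n : ℕ} (hc : Cl n) {k : ℕ} {f : ∀ M : PAM, (Fin k → M) → M} (hf : Tt f) {Q : ∀ M : PAM, (Fin k → M) → M → Prop}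
    (h : Pg n (fun M (w : Fin (k+1) → M) => Q M (fun i => w i.castSucc) (w (Fin.last k)))) :
    Pg n (fun M v => ∃ x, x ≤ f M v ∧ Q M v x) :=
  Sg.congr (hc.ball (Q := fun M v x => ¬ Q M v x) hf h) (fun _ _ => by push Not; rfl)
/-- substitution in curried form -/
theorem pcomp {n : ℕ} (hc : Cl n) {k m : ℕ} {Q : ∀ M : PAM, (Fin m → M) → M → Prop}
    (h : Pg n (fun M (w : Fin (m+1) → M) => Q M (fun i => w i.castSucc) (w (Fin.last m))))
    {f : Fin m → ∀ M : PAM, (Fin k → M) → M} (hf : ∀ i, Tt (f i)) {g : ∀ M : PAM, (Fin k → M) → M} (hg : Tt g) :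
    Pg n (fun M v => Q M (fun i => f i M v) (g M v)) :=
  Pg.congr (hc.psubst h (f := fun i M v => (Fin.snoc (fun i => f i M v) (g M v) : Fin (m+1) → M) i)
    (Tt.snoc hf hg)) (fun _ _ => by simp)
theorem pcomp2 {n : ℕ} (hc : Cl n) {k m : ℕ} {Q : ∀ M : PAM, (Fin m → M) → M → M → Prop}
    (h : Pg n (fun M (w : Fin (m+1+1) → M) => Q M (fun i => w i.castSucc.castSucc) (w (Fin.last m).castSucc) (w (Fin.last (m+1)))))
    {f : Fin m → ∀ M : PAM, (Fin k → M) → M} (hf : ∀ i, Tt (f i)) {g g' : ∀ M : PAM, (Fin k → M) → M}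
    (hg : Tt g) (hg' : Tt g') :
    Pg n (fun M v => Q M (fun i => f i M v) (g M v) (g' M v)) :=
  Pg.congr (hc.pcomp (Q := fun M (w : Fin (m+1) → M) y => Q M (fun i => w i.castSucc) (w (Fin.last m)) y) h
    (f := fun i M v => (Fin.snoc (fun i => f i M v) (g M v) : Fin (m+1) → M) i)
    (Tt.snoc hf hg) hg') (fun _ _ => by simp)

theorem sex {n : ℕ} (hc : Cl n) {k : ℕ} {Q : ∀ M : PAM, (Fin k → M) → M → Prop}
    (h : Sg (n+1) (fun M (w : Fin (k+1) → M) => Q M (fun i => w i.castSucc) (w (Fin.last k)))) :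
    Sg (n+1) (fun M v => ∃ x, Q M v x) := by
  obtain ⟨A, hA, e⟩ := h.elim
  have e' : ∀ M v x, Q M v x ↔ ∃ y, A M (Fin.snoc v x) y := by
    intro M v x
    have := congrFun (congrFun e M) (Fin.snoc v x)
    simp only [Fin.snoc_castSucc, Fin.snoc_last] at this
    rw [this]
  refine Sg.congr (Pg.ex (Q := fun M v z => ∃ x, x ≤ z ∧ ∃ y, y ≤ z ∧ A M (Fin.snoc v x) y) ?_) ?_
  · refine hc.pbex (Tt.var _) (hc.pbex (Tt.var _) ?_)
    exact hc.pcomp hA (fun i => Tt.snoc (fun i => Tt.var _) (Tt.var _) i) (Tt.var _)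
  · intro M v
    simp only [e']
    constructor
    · rintro ⟨x, y, h⟩
      exact ⟨max x y, x, le_max_left _ _, y, le_max_right _ _, h⟩
    · rintro ⟨z, x, _, y, _, h⟩
      exact ⟨x, y, h⟩
end Cl

theorem Sg.elim2 {n k : ℕ} {Q : ∀ M : PAM, (Fin k → M) → M → Prop}
    (h : Sg (n+1) (fun M (w : Fin (k+1) → M) => Q M (fun i => w i.castSucc) (w (Fin.last k)))) :
    ∃ A : ∀ M : PAM, (Fin k → M) → M → M → Prop,
      Pg n (fun M (w : Fin (k+1+1) → M) => A M (fun i => w i.castSucc.castSucc) (w (Fin.last k).castSucc) (w (Fin.last (k+1)))) ∧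
      ∀ M v x, Q M v x ↔ ∃ y, A M v x y := by
  obtain ⟨A, hA, e⟩ := h.elim
  refine ⟨fun M v x y => A M (Fin.snoc v x) y, ?_, ?_⟩
  · refine Pg.congr hA fun M w => ?_
    have : (Fin.snoc (fun i => w i.castSucc.castSucc) (w (Fin.last k).castSucc) : Fin (k+1) → M) = fun i => w i.castSucc := by
      funext i; refine Fin.lastCases ?_ (fun i => ?_) i <;> simp
    show A M (Fin.snoc _ _) _ ↔ _
    rw [this]
  · intro M v x
    have := congrFun (congrFun e M) (Fin.snoc v x)
    simp only [Fin.snoc_castSucc, Fin.snoc_last] at this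
    rw [this]

/-- Uniform relations are definable in each model. -/
theorem Sg.formula {n : ℕ} : ∀ {k : ℕ} {R : ∀ M : PAM, (Fin k → M) → Prop}, Sg n R →
    (∃ φ : LA.BoundedFormula Empty k, IsSigmaFml n φ ∧ ∀ (M : PAM) (v : Fin k → M), φ.Realize default v ↔ R M v) ∧
    (∃ φ : LA.BoundedFormula Empty k, IsPiFml n φ ∧ ∀ (M : PAM) (v : Fin k → M), φ.Realize default v ↔ ¬ R M v) := by
  induction n with
  | zero =>
    intro k R h
    obtain ⟨φ, h1, h2⟩ := h
    refine ⟨⟨φ, .ofDelta0 h1, h2⟩, ?_⟩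
    obtain ⟨φ, h1, h2⟩ := D0.not ⟨φ, h1, h2⟩
    exact ⟨φ, .ofDelta0 h1, h2⟩
  | succ n ih =>
    rintro k R ⟨Q, hQ, h⟩
    obtain ⟨⟨φ, h1, h2⟩, ⟨ψ, h3, h4⟩⟩ := ih hQ
    refine ⟨⟨∃' ψ, .ex (.ofPi h3), fun M v => ?_⟩, ⟨∀' φ, .all (.ofSigma h1), fun M v => ?_⟩⟩
    · rw [BoundedFormula.realize_ex, h]
      refine exists_congr fun x => ?_
      rw [h4]; simp
    · rw [BoundedFormula.realize_all, h]
      push Not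
      refine forall_congr' fun x => ?_
      rw [h2]; simp

theorem Sg.def {n k m : ℕ} {R : ∀ M : PAM, (Fin m → M) → Prop} (h : Sg n R) {M : PAM}
    {f : Fin m → (Fin k → M) → M} (hf : ∀ i, DT (f i)) : Def (fun v => R M (fun i => f i v)) := by
  obtain ⟨φ, _, h2⟩ := h.formula.1
  simp only [← h2]
  exact Def.realize _ φ hf
theorem Pg.def {n k m : ℕ} {R : ∀ M : PAM, (Fin m → M) → Prop} (h : Pg n R) {M : PAM}
    {f : Fin m → (Fin k → M) → M} (hf : ∀ i, DT (f i)) : Def (fun v => R M (fun i => f i v)) := by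
  have := (Sg.def h hf).not
  simpa only [not_not] using this

theorem cl_succ {n : ℕ} (hc : Cl n) : Cl (n+1) where
  subst {k m R} h f hf := by
    obtain ⟨Q, hQ, rfl⟩ := h.elim
    exact Pg.ex (hc.pcomp hQ (fun i => (hf i).up) (Tt.var _))
  and {k R S} h h' := by
    obtain ⟨Q, hQ, rfl⟩ := h.elim
    obtain ⟨Q', hQ', rfl⟩ := h'.elim
    refine Sg.congr (Pg.ex (Q := fun M v z => (∃ x, x ≤ z ∧ Q M v x) ∧ ∃ x, x ≤ z ∧ Q' M v x) ?_) ?_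
    · exact hc.pand (hc.pbex (Tt.var _) (hc.pcomp hQ (fun i => Tt.var _) (Tt.var _)))
        (hc.pbex (Tt.var _) (hc.pcomp hQ' (fun i => Tt.var _) (Tt.var _)))
    · intro M v
      constructor
      · rintro ⟨⟨x, hx⟩, ⟨y, hy⟩⟩
        exact ⟨max x y, ⟨x, le_max_left _ _, hx⟩, ⟨y, le_max_right _ _, hy⟩⟩
      · rintro ⟨z, ⟨x, _, hx⟩, ⟨y, _, hy⟩⟩
        exact ⟨⟨x, hx⟩, ⟨y, hy⟩⟩
  or {k R S} h h' := by
    obtain ⟨Q, hQ, rfl⟩ := h.elim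
    obtain ⟨Q', hQ', rfl⟩ := h'.elim
    exact Sg.congr (Pg.ex (hc.por hQ hQ')) (fun M v => exists_or.symm)
  bex {k f} hf Q h := by
    obtain ⟨A, hA, e⟩ := h.elim2
    refine Sg.congr (Pg.ex (Q := fun M v y => ∃ x, x ≤ f M v ∧ A M v x y) ?_) ?_
    · exact hc.pbex hf.up (hc.pcomp2 hA (fun i => Tt.var _) (Tt.var _) (Tt.var _))
    · intro M v
      simp only [e]
      constructor
      · rintro ⟨x, hx, y, hy⟩; exact ⟨y, x, hx, hy⟩
      · rintro ⟨y, x, hx, hy⟩; exact ⟨x, hx, y, hy⟩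
  ball {k f} hf Q h := by
    obtain ⟨A, hA, e⟩ := h.elim2
    refine Sg.congr (Pg.ex (Q := fun M v z => ∀ x, x ≤ f M v → ∃ y, y ≤ z ∧ A M v x y) ?_) ?_
    · exact hc.pball hf.up (hc.pbex (Tt.var _) (hc.pcomp2 hA (fun i => Tt.var _) (Tt.var _) (Tt.var _)))
    · intro M v
      simp only [e]
      constructor
      · intro h
        have hd : Def (fun u : Fin 2 → M => A M v (u 0) (u 1)) := by
          have := hA.def (M := M) (k := 2) (f := fun i => Fin.lastCases (fun u => u 1) (fun i => Fin.lastCases (fun u => u 0) (fun i _ => v i) i) i) ?_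
          · simpa using this
          · intro i
            refine Fin.lastCases ?_ (fun i => ?_) i
            · simpa using DT.var _
            · refine Fin.lastCases ?_ (fun i => ?_) i
              · simpa using DT.var _
              · simpa using DT.const _
        obtain ⟨b, hb⟩ := collect hd (f M v + 1) (fun x hx => h x (lt_succ.1 hx))
        exact ⟨b, fun x hx => hb x (lt_succ.2 hx)⟩
      · rintro ⟨b, hb⟩ x hx
        obtain ⟨y, _, hy⟩ := hb x hx
        exact ⟨y, hy⟩

theorem cl : ∀ n, Cl n
  | 0 => cl_zero
  | (n+1) => cl_succ (cl n)

theorem D0.sg {n : ℕ} : ∀ {k : ℕ} {R : ∀ M : PAM, (Fin k → M) → Prop}, D0 R → Sg n R := by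
  induction n with
  | zero => exact fun h => h
  | succ n ih =>
    intro k R h
    refine ⟨fun M v _ => ¬ R M v, ih (D0.subst h.not (fun i => Tt.var _)), fun M v => ?_⟩
    simp
theorem D0.pg {n k : ℕ} {R : ∀ M : PAM, (Fin k → M) → Prop} (h : D0 R) : Pg n R := h.not.sg
theorem Pg.sg_succ {n k : ℕ} {R : ∀ M : PAM, (Fin k → M) → Prop} (h : Pg n R) : Sg (n+1) R :=
  ⟨fun M v _ => ¬ R M v, (cl n).subst h (fun i => Tt.var _), fun M v => by simp⟩
theorem Sg.pg_succ {n k : ℕ} {R : ∀ M : PAM, (Fin k → M) → Prop} (h : Sg n R) : Pg (n+1) R :=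
  h.not.sg_succ
theorem Sg.succ {n : ℕ} : ∀ {k : ℕ} {R : ∀ M : PAM, (Fin k → M) → Prop}, Sg n R → Sg (n+1) R := by
  induction n with
  | zero => exact fun h => D0.sg h
  | succ n ih =>
    rintro k R ⟨Q, hQ, h⟩
    exact ⟨Q, ih hQ, h⟩
theorem Pg.succ {n k : ℕ} {R : ∀ M : PAM, (Fin k → M) → Prop} (h : Pg n R) : Pg (n+1) R := Sg.succ h
theorem Sg.ex {n k : ℕ} {Q : ∀ M : PAM, (Fin k → M) → M → Prop}
    (h : Sg (n+1) (fun M (w : Fin (k+1) → M) => Q M (fun i => w i.castSucc) (w (Fin.last k)))) :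
    Sg (n+1) (fun M v => ∃ x, Q M v x) := (cl n).sex h
theorem Pg.all {n k : ℕ} {Q : ∀ M : PAM, (Fin k → M) → M → Prop}
    (h : Pg (n+1) (fun M (w : Fin (k+1) → M) => Q M (fun i => w i.castSucc) (w (Fin.last k)))) :
    Pg (n+1) (fun M v => ∀ x, Q M v x) :=
  Sg.congr (Sg.ex (Q := fun M v x => ¬ Q M v x) h) (fun _ _ => by push Not; rfl)

theorem Sg.and {n k : ℕ} {R S : ∀ M : PAM, (Fin k → M) → Prop} (h : Sg n R) (h' : Sg n S) :
    Sg n (fun M v => R M v ∧ S M v) := (cl n).and h h'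
theorem Sg.or {n k : ℕ} {R S : ∀ M : PAM, (Fin k → M) → Prop} (h : Sg n R) (h' : Sg n S) :
    Sg n (fun M v => R M v ∨ S M v) := (cl n).or h h'
theorem Sg.subst {n k m : ℕ} {R : ∀ M : PAM, (Fin m → M) → Prop} (h : Sg n R)
    {f : Fin m → ∀ M : PAM, (Fin k → M) → M} (hf : ∀ i, Tt (f i)) : Sg n (fun M v => R M (fun i => f i M v)) :=
  (cl n).subst h hf
theorem Pg.and {n k : ℕ} {R S : ∀ M : PAM, (Fin k → M) → Prop} (h : Pg n R) (h' : Pg n S) :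
    Pg n (fun M v => R M v ∧ S M v) := (cl n).pand h h'
theorem Pg.or {n k : ℕ} {R S : ∀ M : PAM, (Fin k → M) → Prop} (h : Pg n R) (h' : Pg n S) :
    Pg n (fun M v => R M v ∨ S M v) := (cl n).por h h'
theorem Pg.subst {n k m : ℕ} {R : ∀ M : PAM, (Fin m → M) → Prop} (h : Pg n R)
    {f : Fin m → ∀ M : PAM, (Fin k → M) → M} (hf : ∀ i, Tt (f i)) : Pg n (fun M v => R M (fun i => f i M v)) :=
  (cl n).psubst h hf

mutual
theorem sg_of_fml : ∀ {n k : ℕ} {φ : LA.BoundedFormula Empty k}, IsSigmaFml n φ →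
    Sg n (fun M (v : Fin k → M) => φ.Realize default v)
  | _, _, _, .ofDelta0 h => (show D0 _ from ⟨_, h, fun _ _ => Iff.rfl⟩)
  | _, _, _, .ofPi h => (pg_of_fml h).sg_succ
  | _, _, _, .ex h => by
    refine Sg.congr (Sg.ex (Sg.congr (sg_of_fml h) (fun M w => ?_))) (fun M v => BoundedFormula.realize_ex)
    rw [← Fin.snoc_init_self w]
    simp only [Fin.snoc_castSucc, Fin.snoc_last]
theorem pg_of_fml : ∀ {n k : ℕ} {φ : LA.BoundedFormula Empty k}, IsPiFml n φ →
    Pg n (fun M (v : Fin k → M) => φ.Realize default v)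
  | _, _, _, .ofDelta0 h => D0.pg ⟨_, h, fun _ _ => Iff.rfl⟩
  | _, _, _, .ofSigma h => (sg_of_fml h).pg_succ
  | _, _, _, .all h => by
    refine Pg.congr (Pg.all (Pg.congr (pg_of_fml h) (fun M w => ?_))) (fun M v => BoundedFormula.realize_all)
    rw [← Fin.snoc_init_self w]
    simp only [Fin.snoc_castSucc, Fin.snoc_last]
end

end

section
open PAM

/-- truth of a sentence in a model of PA -/
def Sat (M : PAM) (φ : Snt) : Prop := Sentence.Realize M.car φ
/-- being a model of `T` -/
def MT (M : PAM) (T : Thy) : Prop := ∀ φ ∈ T, Sat M φ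

theorem sat_def {M : PAM} {φ : Snt} (v : Fin 0 → M) : Sat M φ ↔ BoundedFormula.Realize φ default v := by
  rw [Subsingleton.elim v default]; rfl
theorem sat_not {M : PAM} {φ : Snt} : Sat M (∼φ) ↔ ¬ Sat M φ := Iff.rfl
theorem sat_iff {M : PAM} {φ ψ : Snt} : Sat M (φ ⇔ ψ) ↔ (Sat M φ ↔ Sat M ψ) := by
  rw [sat_def default, sat_def default, sat_def default]; exact BoundedFormula.realize_iff
theorem sat_inf {M : PAM} {φ ψ : Snt} : Sat M (φ ⊓ ψ) ↔ (Sat M φ ∧ Sat M ψ) := by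
  rw [sat_def default, sat_def default, sat_def default]; exact BoundedFormula.realize_inf
theorem sat_imp {M : PAM} {φ ψ : Snt} : Sat M (φ ⟹ ψ) ↔ (Sat M φ → Sat M ψ) := Iff.rfl
theorem mt_pa (M : PAM) : MT M PAAx := fun φ h => M.mod.realize_of_mem φ h

theorem extPA_PA : ExtPA PAAx := fun _ h => Theory.models_sentence_of_mem h

theorem mk_pam {T : Thy} (hT : ExtPA T) (N : Theory.ModelType.{0,0,0} T) :
    ∃ M : PAM, MT M T ∧ ∀ φ, Sat M φ ↔ Sentence.Realize N φ := by
  refine ⟨⟨N, ⟨fun φ h => (Theory.models_sentence_iff.1 (hT φ h)) N⟩⟩, ?_, fun φ => Iff.rfl⟩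
  exact fun φ h => N.is_model.realize_of_mem φ h

theorem prv_of {T : Thy} {φ : Snt} (h : Prv T φ) {M : PAM} (hM : MT M T) : Sat M φ := by
  have : M.car ⊨ T := ⟨hM⟩
  exact Theory.models_sentence_iff.1 h ⟨M.car⟩
theorem prv_iff {T : Thy} (hT : ExtPA T) {φ : Snt} : Prv T φ ↔ ∀ M, MT M T → Sat M φ := by
  refine ⟨fun h M hM => prv_of h hM, fun h => Theory.models_sentence_iff.2 fun N => ?_⟩
  obtain ⟨M, h1, h2⟩ := mk_pam hT N
  exact (h2 φ).1 (h M h1)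
theorem con_iff {T : Thy} (hT : ExtPA T) : Con T ↔ ∃ M, MT M T := by
  rw [Con, prv_iff hT]
  push Not
  exact ⟨fun ⟨M, h, _⟩ => ⟨M, h⟩, fun ⟨M, h⟩ => ⟨M, h, fun h => h⟩⟩
theorem ExtPA.mono {T S : Thy} (hT : ExtPA T) (h : T ⊆ S) : ExtPA S := fun φ hφ => by
  refine Theory.models_sentence_iff.2 fun N => ?_
  have : N ⊨ T := ⟨fun φ hφ => N.is_model.realize_of_mem φ (h hφ)⟩
  exact Theory.models_sentence_iff.1 (hT φ hφ) ⟨N⟩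
theorem prv_mem {T : Thy} {φ : Snt} (h : φ ∈ T) : Prv T φ := Theory.models_sentence_of_mem h
theorem mt_add {M : PAM} {T : Thy} {φ : Snt} : MT M (add T φ) ↔ Sat M φ ∧ MT M T := by
  simp [MT, add]
theorem mt_th {M : PAM} {T : Thy} : MT M (Th T) ↔ MT M T :=
  ⟨fun h φ hφ => h φ (prv_mem hφ), fun h _ hφ => prv_of hφ h⟩
theorem prv_add {T : Thy} (hT : ExtPA T) {φ ψ : Snt} : Prv (add T φ) ψ ↔ ∀ M, MT M T → Sat M φ → Sat M ψ := by
  rw [prv_iff (T := add T φ) (hT.mono (Set.subset_insert _ _))]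
  simp only [mt_add]
  exact ⟨fun h M h1 h2 => h M ⟨h2, h1⟩, fun h M h1 => h M h1.2 h1.1⟩

theorem Sg.sentence {n : ℕ} {R : ∀ M : PAM, (Fin 0 → M) → Prop} (h : Sg n R) :
    ∃ s ∈ SigmaS n, ∀ M, Sat M s ↔ R M default := by
  obtain ⟨φ, h1, h2⟩ := h.formula.1
  exact ⟨φ, h1, fun M => h2 M _⟩
theorem Pg.sentence {n : ℕ} {R : ∀ M : PAM, (Fin 0 → M) → Prop} (h : Pg n R) :
    ∃ s ∈ PiS n, ∀ M, Sat M s ↔ R M default := by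
  obtain ⟨φ, h1, h2⟩ := h.formula.2
  exact ⟨φ, h1, fun M => (h2 M _).trans not_not⟩
theorem sg_sat {n : ℕ} {s : Snt} (h : s ∈ SigmaS n) : Sg n (fun M (_ : Fin 0 → M) => Sat M s) :=
  Sg.congr (sg_of_fml h) (fun _ v => sat_def v)
theorem pg_sat {n : ℕ} {s : Snt} (h : s ∈ PiS n) : Pg n (fun M (_ : Fin 0 → M) => Sat M s) :=
  Pg.congr (pg_of_fml h) (fun _ v => sat_def v)

theorem cmp_lt {n k : ℕ} {A B : ∀ M : PAM, (Fin k → M) → M → Prop}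
    (hA : Pg n (fun M (w : Fin (k+1) → M) => A M (fun i => w i.castSucc) (w (Fin.last k))))
    (hB : Pg n (fun M (w : Fin (k+1) → M) => B M (fun i => w i.castSucc) (w (Fin.last k)))) :
    Sg (n+1) (fun M v => ∃ x, A M v x ∧ ∀ y, y < x → ¬ B M v y) := by
  refine Sg.ex (Sg.and hA.sg_succ (Sg.succ ?_))
  refine Sg.congr ((cl n).ball (f := fun M w => w (Fin.last k)) (Tt.var _)
    (Q := fun M w y => w (Fin.last k) ≤ y ∨ ¬ B M (fun i => w i.castSucc) y) ?_) ?_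
  · refine Sg.or (D0.sg (D0.le (Tt.var _) (Tt.var _))) ?_
    exact Pg.not ((cl n).pcomp hB (fun i => Tt.var _) (Tt.var _))
  · intro M v
    constructor
    · intro h y _
      by_cases h' : v (Fin.last k) ≤ y
      · exact Or.inl h'
      · exact Or.inr (h y (not_le.1 h'))
    · intro h y hy
      exact (h y hy.le).resolve_left (not_le.2 hy)

theorem cmp_le {n k : ℕ} {A B : ∀ M : PAM, (Fin k → M) → M → Prop}
    (hA : Pg n (fun M (w : Fin (k+1) → M) => A M (fun i => w i.castSucc) (w (Fin.last k))))
    (hB : Pg n (fun M (w : Fin (k+1) → M) => B M (fun i => w i.castSucc) (w (Fin.last k)))) :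
    Sg (n+1) (fun M v => ∃ x, A M v x ∧ ∀ y, y ≤ x → ¬ B M v y) := by
  refine Sg.ex (Sg.and hA.sg_succ (Sg.succ ?_))
  refine ((cl n).ball (f := fun M w => w (Fin.last k)) (Tt.var _)
    (Q := fun M w y => ¬ B M (fun i => w i.castSucc) y) ?_)
  exact Pg.not ((cl n).pcomp hB (fun i => Tt.var _) (Tt.var _))

theorem cmp_not {M : PAM} {A B : M → Prop} (h1 : ∃ x, A x ∧ ∀ y, y < x → ¬ B y) :
    ¬ ∃ y, B y ∧ ∀ x, x ≤ y → ¬ A x := by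
  rintro ⟨y, hy, h⟩
  obtain ⟨x, hx, h'⟩ := h1
  rcases le_or_gt x y with h2 | h2
  · exact h x h2 hx
  · exact h' y h2 hy
theorem cmp_or {M : PAM} {A B : M → Prop} (hA : D1 A) (h : (∃ x, A x) ∨ ∃ x, B x) :
    (∃ x, A x ∧ ∀ y, y < x → ¬ B y) ∨ ∃ y, B y ∧ ∀ x, x ≤ y → ¬ A x := by
  by_contra! hh
  obtain ⟨h1, h2⟩ := hh
  have : ∃ x, A x := by
    rcases h with h | ⟨y, hy⟩
    · exact h
    · obtain ⟨x, _, hx⟩ := h2 y hy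
      exact ⟨x, hx⟩
  obtain ⟨x, hx⟩ := this
  obtain ⟨x, hx, hm⟩ := exists_least A hA hx
  obtain ⟨y, hy, hb⟩ := h1 x hx
  obtain ⟨x', h3, h4⟩ := h2 y hb
  exact hm x' (lt_of_le_of_lt h3 hy) h4

theorem Pg.d1 {n k : ℕ} {A : ∀ M : PAM, (Fin k → M) → M → Prop}
    (hA : Pg n (fun M (w : Fin (k+1) → M) => A M (fun i => w i.castSucc) (w (Fin.last k))))
    {M : PAM} (v : Fin k → M) : D1 (A M v) := by
  have := hA.def (M := M) (k := 1) (f := fun i => Fin.lastCases (fun u => u 0) (fun i _ => v i) i) ?_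
  · simpa [D1] using this
  · intro i
    refine Fin.lastCases ?_ (fun i => ?_) i
    · simpa using DT.var _
    · simpa using DT.const _

theorem conj_pi {n : ℕ} (S : Set Snt) (F : Finset Snt) (hF : ∀ ψ ∈ F, ψ ∈ S → ψ ∈ PiS n) :
    ∃ s ∈ PiS n, ∀ M, Sat M s ↔ ∀ ψ ∈ F, ψ ∈ S → Sat M ψ := by
  classical
  have : Pg n (fun M (_ : Fin 0 → M) => ∀ ψ ∈ F, ψ ∈ S → Sat M ψ) := by
    induction F using Finset.induction_on with
    | empty => exact Pg.congr (D0.pg D0.true) (by simp)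
    | insert a F ha ih =>
      have ih := ih (fun ψ h => hF ψ (Finset.mem_insert_of_mem h))
      by_cases h : a ∈ S
      · refine Pg.congr (Pg.and (pg_sat (hF a (Finset.mem_insert_self _ _) h)) ih) (fun M v => ?_)
        simp [h]
      · refine Pg.congr ih (fun M v => ?_)
        simp [h]
  obtain ⟨s, h1, h2⟩ := this.sentence
  exact ⟨s, h1, h2⟩

theorem part2_aux {T U : Thy} (hT : ExtPA T) (hU : ExtPA U) {n : ℕ} {φ : Snt}
    (hφ : HDeltaCons (n+1) T φ)
    (h2 : ∃ ψ ∈ PiS (n+1), Prv (add PAAx φ) ψ ∧ ¬ Prv T ψ ∧ ¬ Prv U ψ) :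
    Con (T ∪ ThIn (PiS (n+1)) U) := by
  intro hcon
  obtain ⟨F, hF, hb⟩ := Theory.models_iff_finset_models.1 hcon
  obtain ⟨p, hp, hpe⟩ := conj_pi (n := n+1) (ThIn (PiS (n+1)) U) F (fun ψ _ h => h.1)
  have hUp : ∀ M, MT M U → Sat M p := fun M hM => (hpe M).2 fun ψ _ h => prv_of h.2 hM
  have hTp : ∀ M, MT M T → ¬ Sat M p := by
    intro M hM h
    have : MT M F := by
      intro ψ hψ
      rcases hF hψ with h1 | h1
      · exact hM ψ h1
      · exact (hpe M).1 h ψ hψ h1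
    exact prv_of hb this
  obtain ⟨q, hq, hq1, hq2, hq3⟩ := h2
  obtain ⟨A, hA, eA⟩ := Sg.elim (pg_sat hp)
  obtain ⟨B, hB, eB⟩ := Sg.elim (pg_sat hq)
  have eA : ∀ M, ¬ Sat M p ↔ ∃ x, A M default x := fun M => by
    simpa using congrFun (congrFun eA M) default
  have eB : ∀ M, ¬ Sat M q ↔ ∃ x, B M default x := fun M => by
    simpa using congrFun (congrFun eB M) default
  obtain ⟨s, hs, es⟩ := (cmp_lt hA hB).sentence
  obtain ⟨r, hr, er⟩ := (cmp_le hB hA).not.sentence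
  -- the subtheory
  have hV : ExtPA (add PAAx (p ⟹ ∼q)) := extPA_PA.mono (Set.subset_insert _ _)
  have hsub : SubThy (add PAAx (p ⟹ ∼q)) T := by
    refine ⟨hV, fun θ hθ => (prv_iff hT).2 fun M hM => ?_⟩
    refine prv_of hθ (mt_add.2 ⟨?_, mt_pa M⟩)
    rw [sat_imp]
    exact fun h => absurd h (hTp M hM)
  have key : ∀ M, MT M (add PAAx (p ⟹ ∼q)) → (Sat M s ↔ Sat M r) := by
    intro M hM
    have hM := (mt_add.1 hM).1
    rw [sat_imp, sat_not, eB] at hM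
    rw [es, er]
    constructor
    · exact cmp_not
    · intro h
      refine (cmp_or (hA.d1 _) ?_).resolve_right h
      by_cases hx : Sat M p
      · exact Or.inr (hM hx)
      · exact Or.inl ((eA M).1 hx)
  have hThV : ExtPA (Th (add PAAx (p ⟹ ∼q))) := hV.mono (fun _ h => prv_mem h)
  have := hφ _ hsub s ⟨⟨s, hs, (prv_iff hThV).2 fun M _ => sat_iff.2 Iff.rfl⟩,
    ⟨r, hr, (prv_iff hThV).2 fun M hM => sat_iff.2 (key M (mt_th.1 hM))⟩⟩ ?_
  · apply hq3
    refine (prv_iff hU).2 fun M hM => ?_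
    by_contra hc
    have h1 : Sat M s := prv_of this (mt_add.2 ⟨sat_imp.2 fun _ => sat_not.2 hc, mt_pa M⟩)
    obtain ⟨x, hx, _⟩ := (es M).1 h1
    exact (eA M).2 ⟨x, hx⟩ (hUp M hM)
  · refine (prv_add hV).2 fun M hM hf => ?_
    rw [key M hM, er]
    rintro ⟨y, hy, _⟩
    exact (eB M).2 ⟨y, hy⟩ (prv_of hq1 (mt_add.2 ⟨hf, mt_pa M⟩))

theorem part2 {T U : Thy} (hT : ExtPA T) (hU : ExtPA U) {n : ℕ}
    (h : ∃ φ : Snt, SimExHDelta (n+1) T U φ) : Cpair (n+1) T U := by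
  obtain ⟨φ, h1, h2, _, h4⟩ := h
  refine ⟨part2_aux hT hU h1 h4, part2_aux hU hT h2 ?_⟩
  obtain ⟨ψ, a, b, c, d⟩ := h4
  exact ⟨ψ, a, b, d, c⟩

theorem cap_model {T U : Thy} (hT : ExtPA T) {n : ℕ} (h : Con (T ∪ ThIn (SigAndPiS n) U)) (hU : ExtPA U)
    {s : Snt} (hs : s ∈ SigmaS n) (hp : ∀ M, MT M U → Sat M s) : ∃ M, MT M T ∧ Sat M s := by
  obtain ⟨M, hM⟩ := (con_iff (hT.mono Set.subset_union_left)).1 h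
  refine ⟨M, fun ψ h => hM ψ (Or.inl h), ?_⟩
  obtain ⟨t, ht, ht'⟩ := (Pg.sentence (n := n) (D0.pg D0.true))
  have : Sat M (s ⊓ t) := hM _ (Or.inr ⟨⟨s, hs, t, ht, rfl⟩,
    (prv_iff hU).2 fun N hN => sat_inf.2 ⟨hp N hN, (ht' N).2 trivial⟩⟩)
  exact (sat_inf.1 this).1

end

section
open PAM

/-- Binary trees labelled with rule numbers. -/
inductive Nd : Type
  | leaf : Nd
  | node : ℕ → Nd → Nd → Nd

/-- code of a tree -/
def Nd.cd (M : PAM) : Nd → M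
  | .leaf => 0
  | .node t l r => pr (t : M) (pr (l.cd M) (r.cd M))

/-- Rules -/
abbrev RlT : Type 1 := ∀ M : PAM, M → M → M → M → M → M → Prop

/-- truth at a tree -/
def Nd.T (Rl : RlT) (M : PAM) : Nd → M → Prop
  | .leaf, _ => False
  | .node t l r, z => ∃ s w a b, Rl M t z s w a b ∧ (∀ u, s = u + 1 → l.T Rl M u) ∧
      ∀ x, x ≤ b → a ≤ x → r.T Rl M (pr w x)

/-- membership in a coded set -/
def Mem {M : PAM} (a c m p : M) : Prop := p < a ∧ (1 + (p + 1) * m) ∣ c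

/-- evidence sets -/
def Hint (Rl : RlT) (M : PAM) (a c m : M) : Prop :=
  ∀ t, t ≤ a → ∀ j, j ≤ a → ∀ k, k ≤ a → ∀ z, z ≤ a → Mem a c m (pr (pr t (pr j k)) z) →
    ∃ s, s ≤ a ∧ ∃ w, w ≤ a ∧ ∃ l, l ≤ a ∧ ∃ h, h ≤ a ∧ Rl M t z s w l h ∧
      (∀ u, u ≤ a → s = u + 1 → Mem a c m (pr j u)) ∧
      ∀ x, x ≤ h → l ≤ x → Mem a c m (pr k (pr w x))

/-- The universal predicate -/
def Un (Rl : RlT) (M : PAM) (e z : M) : Prop := ∃ a c m, Hint Rl M a c m ∧ Mem a c m (pr e z)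

/-- The rules are bounded-definable. -/
def RlD (Rl : RlT) : Prop :=
  D0 (fun M (v : Fin 6 → M) => Rl M (v 0) (v 1) (v 2) (v 3) (v 4) (v 5))

theorem RlD.d0 {Rl : RlT} (h : RlD Rl) {k : ℕ} {f0 f1 f2 f3 f4 f5 : ∀ M : PAM, (Fin k → M) → M}
    (h0 : Tt f0) (h1 : Tt f1) (h2 : Tt f2) (h3 : Tt f3) (h4 : Tt f4) (h5 : Tt f5) :
    D0 (fun M v => Rl M (f0 M v) (f1 M v) (f2 M v) (f3 M v) (f4 M v) (f5 M v)) := by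
  refine D0.subst (m := 6) h (f := ![f0, f1, f2, f3, f4, f5]) fun i => ?_
  fin_cases i <;> assumption
theorem RlD.def {Rl : RlT} (h : RlD Rl) {M : PAM} {k : ℕ} {f0 f1 f2 f3 f4 f5 : (Fin k → M) → M}
    (h0 : DT f0) (h1 : DT f1) (h2 : DT f2) (h3 : DT f3) (h4 : DT f4) (h5 : DT f5) :
    Def (fun v => Rl M (f0 v) (f1 v) (f2 v) (f3 v) (f4 v) (f5 v)) := by
  refine Sg.def (n := 0) (m := 6) h (f := ![f0, f1, f2, f3, f4, f5]) fun i => ?_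
  fin_cases i <;> assumption

theorem Mem.d0 {k : ℕ} {f0 f1 f2 f3 : ∀ M : PAM, (Fin k → M) → M}
    (h0 : Tt f0) (h1 : Tt f1) (h2 : Tt f2) (h3 : Tt f3) :
    D0 (fun M v => Mem (f0 M v) (f1 M v) (f2 M v) (f3 M v)) :=
  D0.and (D0.lt h3 h0) (D0.dvd (Tt.one.add ((h3.add Tt.one).mul h2)) h1)
theorem Mem.def {M : PAM} {k : ℕ} {f0 f1 f2 f3 : (Fin k → M) → M}
    (h0 : DT f0) (h1 : DT f1) (h2 : DT f2) (h3 : DT f3) :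
    Def (fun v => Mem (f0 v) (f1 v) (f2 v) (f3 v)) :=
  Def.and (Def.lt h3 h0) (Def.dvd ((DT.const _).add ((h3.add (DT.const _)).mul h2)) h1)

theorem Hint.d0 {Rl : RlT} (h : RlD Rl) :
    D0 (fun M (v : Fin 5 → M) => Hint Rl M (v 2) (v 3) (v 4)) := by
  unfold Hint
  refine D0.ball (Tt.var _) (D0.ball (Tt.var _) (D0.ball (Tt.var _) (D0.ball (Tt.var _) (D0.imp
    (Mem.d0 (Tt.var _) (Tt.var _) (Tt.var _)
      (Tt.pr (Tt.pr (Tt.var _) (Tt.pr (Tt.var _) (Tt.var _))) (Tt.var _))) ?_))))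
  refine D0.bex (Tt.var _) (D0.bex (Tt.var _) (D0.bex (Tt.var _) (D0.bex (Tt.var _) (D0.and
    (h.d0 (Tt.var _) (Tt.var _) (Tt.var _) (Tt.var _) (Tt.var _) (Tt.var _)) (D0.and ?_ ?_)))))
  · exact D0.ball (Tt.var _) (D0.imp (D0.eq (Tt.var _) (Tt.add (Tt.var _) Tt.one))
      (Mem.d0 (Tt.var _) (Tt.var _) (Tt.var _) (Tt.pr (Tt.var _) (Tt.var _))))
  · exact D0.ball (Tt.var _) (D0.imp (D0.le (Tt.var _) (Tt.var _))
      (Mem.d0 (Tt.var _) (Tt.var _) (Tt.var _) (Tt.pr (Tt.var _) (Tt.pr (Tt.var _) (Tt.var _)))))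

theorem Un.sg {Rl : RlT} (h : RlD Rl) : Sg 1 (fun M (v : Fin 2 → M) => Un Rl M (v 0) (v 1)) := by
  unfold Un
  refine Sg.ex (Sg.ex (Sg.ex (D0.sg (D0.and (Hint.d0 h) ?_))))
  exact Mem.d0 (Tt.var _) (Tt.var _) (Tt.var _) (Tt.pr (Tt.var _) (Tt.var _))

theorem Nd.T_def {Rl : RlT} (h : RlD Rl) {M : PAM} (N : Nd) : D1 (N.T Rl M) := by
  induction N with
  | leaf => exact Def.false
  | node t l r ihl ihr =>
    unfold D1
    simp only [Nd.T]
    refine Def.ex (Def.ex (Def.ex (Def.ex (Def.and (h.def ?_ ?_ ?_ ?_ ?_ ?_) (Def.and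
      (Def.all (Def.imp (Def.eq ?_ ?_) (ihl.comp ?_))) (Def.all (Def.imp (Def.le ?_ ?_) (Def.imp (Def.le ?_ ?_) (ihr.comp ?_)))))))))
    all_goals
      repeat' first | apply DT.pr | apply DT.var | apply DT.const | apply DT.add

theorem Nd.sound {Rl : RlT} {M : PAM} (h0 : ∀ z s w l b, ¬ Rl M 0 z s w l b) {a c m : M} (hH : Hint Rl M a c m) (N : Nd) :
    ∀ z, Mem a c m (pr (N.cd M) z) → N.T Rl M z := by
  induction N with
  | leaf =>
    intro z hz
    have e : (Nd.leaf).cd M = pr 0 (pr 0 0) := by simp [Nd.cd, pr]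
    rw [e] at hz
    have hz' : z ≤ a := (le_pr_right _ _).trans hz.1.le
    obtain ⟨s, _, w, _, l, _, b, _, hr, _⟩ := hH 0 (zero_le_ _) 0 (zero_le_ _) 0 (zero_le_ _) z hz' hz
    exact h0 _ _ _ _ _ hr
  | node t l r ihl ihr =>
    intro z hz
    rw [Nd.cd] at hz
    have h1 := le_pr_left (pr (t : M) (pr (l.cd M) (r.cd M))) z
    have h2 := le_pr_left (t : M) (pr (l.cd M) (r.cd M))
    have h3 := le_pr_right (t : M) (pr (l.cd M) (r.cd M))
    have h4 := le_pr_left (l.cd M) (r.cd M)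
    have h5 := le_pr_right (l.cd M) (r.cd M)
    have h6 := hz.1.le
    obtain ⟨s, hs, w, _, x, _, b, _, hr, hl, hrr⟩ := hH t (h2.trans (h1.trans h6)) _ (h4.trans (h3.trans (h1.trans h6)))
      _ (h5.trans (h3.trans (h1.trans h6))) z ((le_pr_right _ _).trans h6) hz
    refine ⟨s, w, x, b, hr, fun u hu => ihl _ (hl u ?_ hu), fun y h h' => ihr _ (hrr y h h')⟩
    exact le_trans (by rw [hu]; exact le_self_add) hs

theorem Nd.exists_ev {Rl : RlT} (hR : RlD Rl) {M : PAM} (N : Nd) :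
    ∀ B, ∃ a c m, Hint Rl M a c m ∧ ∀ z, z ≤ B → N.T Rl M z → Mem a c m (pr (N.cd M) z) := by
  induction N with
  | leaf =>
    intro B
    refine ⟨0, 0, 0, fun t _ j _ k _ z _ h => ?_, fun z _ h => h.elim⟩
    exact absurd h.1 (not_lt.2 (zero_le_ _))
  | node t l r ihl ihr =>
    intro B
    have hT := Nd.T_def hR (M := M) (.node t l r)
    have hTl := Nd.T_def hR (M := M) l
    have hTr := Nd.T_def hR (M := M) r
    have hcol : Def (fun v : Fin 2 → M => (Nd.node t l r).T Rl M (v 0) →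
        ∃ s w a b, s ≤ v 1 ∧ w ≤ v 1 ∧ a ≤ v 1 ∧ b ≤ v 1 ∧ Rl M t (v 0) s w a b ∧ (∀ u, s = u + 1 → l.T Rl M u) ∧
      ∀ x, x ≤ b → a ≤ x → r.T Rl M (pr w x)) := by
      refine Def.imp (hT.comp (DT.var _)) (Def.ex (Def.ex (Def.ex (Def.ex (Def.and (Def.le ?_ ?_) (Def.and (Def.le ?_ ?_)
        (Def.and (Def.le ?_ ?_) (Def.and (Def.le ?_ ?_) (Def.and (hR.def ?_ ?_ ?_ ?_ ?_ ?_) (Def.and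
        (Def.all (Def.imp (Def.eq ?_ ?_) (hTl.comp ?_))) (Def.all (Def.imp (Def.le ?_ ?_) (Def.imp (Def.le ?_ ?_) (hTr.comp ?_))))))))))))))
      all_goals
        repeat' first | apply DT.pr | apply DT.var | apply DT.const | apply DT.add
    obtain ⟨b, hb⟩ := collect (R := fun z y => (Nd.node t l r).T Rl M z →
        ∃ s w a b, s ≤ y ∧ w ≤ y ∧ a ≤ y ∧ b ≤ y ∧ Rl M t z s w a b ∧ (∀ u, s = u + 1 → l.T Rl M u) ∧
      ∀ x, x ≤ b → a ≤ x → r.T Rl M (pr w x)) hcol (B + 1) (by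
        intro z _
        by_cases h : (Nd.node t l r).T Rl M z
        · obtain ⟨s, w, x, y, h'⟩ := h
          exact ⟨max (max s w) (max x y), fun _ => ⟨s, w, x, y, by simp, by simp, by simp, by simp, h'⟩⟩
        · exact ⟨0, fun h' => absurd h' h⟩)
    obtain ⟨a1, c1, m1, H1, E1⟩ := ihl b
    obtain ⟨a2, c2, m2, H2, E2⟩ := ihr (pr b b)
    set n : M := (Nd.node t l r).cd M with hn
    set a : M := max (max a1 a2) (max b (pr n B + 1)) with ha
    have la1 : a1 ≤ a := by simp [ha]
    have la2 : a2 ≤ a := by simp [ha]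
    have lb : b ≤ a := by simp [ha]
    have ln : pr n B + 1 ≤ a := by simp [ha]
    obtain ⟨c, m, hc⟩ := comprehension (fun p => Mem a1 c1 m1 p ∨ Mem a2 c2 m2 p ∨
      ∃ z, z ≤ B ∧ p = pr n z ∧ (Nd.node t l r).T Rl M z) (by
        refine Def.or (Mem.def ?_ ?_ ?_ ?_) (Def.or (Mem.def ?_ ?_ ?_ ?_) (Def.ex (Def.and (Def.le ?_ ?_) (Def.and (Def.eq ?_ ?_) (hT.comp ?_)))))
        all_goals
          repeat' first | apply DT.pr | apply DT.var | apply DT.const | apply DT.add) a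
    have mem1 : ∀ p, Mem a1 c1 m1 p → Mem a c m p := fun p hp =>
      ⟨hp.1.trans_le la1, (hc p (hp.1.trans_le la1)).2 (Or.inl hp)⟩
    have mem2 : ∀ p, Mem a2 c2 m2 p → Mem a c m p := fun p hp =>
      ⟨hp.1.trans_le la2, (hc p (hp.1.trans_le la2)).2 (Or.inr (Or.inl hp))⟩
    have mem3 : ∀ z, z ≤ B → (Nd.node t l r).T Rl M z → Mem a c m (pr n z) := fun z hz h => by
      have : pr n z < a := lt_of_le_of_lt (pr_mono le_rfl hz) (succ_le.1 ln)
      exact ⟨this, (hc _ this).2 (Or.inr (Or.inr ⟨z, hz, rfl, h⟩))⟩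
    have sub : ∀ a1 c1 m1 : M, Hint Rl M a1 c1 m1 → a1 ≤ a → (∀ p, Mem a1 c1 m1 p → Mem a c m p) →
        ∀ t j k z, Mem a1 c1 m1 (pr (pr t (pr j k)) z) →
        ∃ s, s ≤ a ∧ ∃ w, w ≤ a ∧ ∃ l, l ≤ a ∧ ∃ h, h ≤ a ∧ Rl M t z s w l h ∧
        (∀ u, u ≤ a → s = u + 1 → Mem a c m (pr j u)) ∧
        ∀ x, x ≤ h → l ≤ x → Mem a c m (pr k (pr w x)) := by
      intro a1 c1 m1 H1 la1 mem1 t j k z hz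
      have h1 := le_pr_left (pr t (pr j k)) z
      have h2 := le_pr_left t (pr j k)
      have h3 := le_pr_right t (pr j k)
      have h4 := le_pr_left j k
      have h5 := le_pr_right j k
      have h6 := hz.1.le
      obtain ⟨s, hs, w, hw, x, hx, y, hy, hr, hl, hrr⟩ := H1 t (h2.trans (h1.trans h6)) _ (h4.trans (h3.trans (h1.trans h6)))
        _ (h5.trans (h3.trans (h1.trans h6))) z ((le_pr_right _ _).trans h6) hz
      refine ⟨s, hs.trans la1, w, hw.trans la1, x, hx.trans la1, y, hy.trans la1, hr,
        fun u _ hu => mem1 _ (hl u ?_ hu), fun x h h' => mem1 _ (hrr x h h')⟩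
      exact le_trans (by rw [hu]; exact le_self_add) hs
    refine ⟨a, c, m, ?_, mem3⟩
    intro t' _ j _ k _ z _ hz
    rcases (hc _ hz.1).1 hz.2 with h | h | ⟨z', hz', e, h⟩
    · exact sub _ _ _ H1 la1 mem1 _ _ _ _ h
    · exact sub _ _ _ H2 la2 mem2 _ _ _ _ h
    · rw [hn, Nd.cd] at e
      simp only [pr_inj_iff] at e
      obtain ⟨⟨rfl, rfl, rfl⟩, rfl⟩ := e
      obtain ⟨y, hy, hh⟩ := hb z (lt_succ.2 hz')
      obtain ⟨s, w, x, q, hs, hw, hx, hq, hr, hl, hrr⟩ := hh h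
      have hyb := hy.trans lb
      refine ⟨s, hs.trans hyb, w, hw.trans hyb, x, hx.trans hyb, q, hq.trans hyb, hr, ?_, ?_⟩
      · intro u _ hu
        refine mem1 _ (E1 u ?_ (hl u hu))
        exact le_trans (by rw [hu]; exact le_self_add) (hs.trans hy)
      · intro v hv hv'
        refine mem2 _ (E2 _ ?_ (hrr v hv hv'))
        exact pr_mono (hw.trans hy) (hv.trans (hq.trans hy))

theorem Nd.un_iff {Rl : RlT} (hR : RlD Rl) (h0 : ∀ M z s w l b, ¬ Rl M 0 z s w l b) (N : Nd) {M : PAM} (z : M) :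
    Un Rl M (N.cd M) z ↔ N.T Rl M z := by
  constructor
  · rintro ⟨a, c, m, hH, h⟩
    exact Nd.sound (h0 M) hH N z h
  · intro h
    obtain ⟨a, c, m, hH, h'⟩ := Nd.exists_ev hR N z
    exact ⟨a, c, m, hH, h' z le_rfl h⟩

end

section
open PAM

/-- The concrete rules. -/
def Bd : ℕ → ∀ M : PAM, M → M → M → M → M → Prop
  | 1, _, z, s, _, l, h => ∃ a, a ≤ z ∧ ∃ b, b ≤ z ∧ z = pr (pr a b) b ∧ s = 0 ∧ l = 1 ∧ h = 0
  | 2, _, z, s, _, l, h => ∃ a, a ≤ z ∧ ∃ b, b ≤ z ∧ ∃ c, c ≤ z ∧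
      z = pr (pr a b) c ∧ s = pr a c + 1 ∧ l = 1 ∧ h = 0
  | 3, _, z, s, _, l, h => ∃ a, a ≤ z ∧ z = pr a 0 ∧ s = 0 ∧ l = 1 ∧ h = 0
  | 4, _, z, s, _, l, h => ∃ a, a ≤ z ∧ ∃ b, b ≤ s ∧ z = pr a (b + 1) ∧ s = pr a b + 1 ∧ l = 1 ∧ h = 0
  | 5, _, z, s, w, l, h => ∃ b, b ≤ s ∧ z = pr w (b + l) ∧ s = pr w b + 1 ∧ h = l
  | 6, _, z, s, w, l, h => ∃ b, b ≤ s ∧ z = pr w (b * l) ∧ s = pr w b + 1 ∧ h = l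
  | 7, _, z, s, w, l, h => ∃ a, a ≤ s ∧ s = pr z a + 1 ∧ w = z ∧ h = l ∧ a ≤ l
  | 8, _, z, s, w, l, h => ∃ a, a ≤ s ∧ s = pr z a + 1 ∧ w = z ∧ h = l ∧ a < l
  | 9, _, z, s, w, l, h => s = z + 1 ∧ z = pr w l ∧ h = l
  | 10, _, z, s, w, l, h => (s = z + 1 ∧ l = 1 ∧ h = 0) ∨ (s = 0 ∧ z = pr w l ∧ h = l)
  | 11, _, z, s, w, l, h => s = pr z h + 1 ∧ w = z ∧ l = 0
  | 12, _, z, s, w, l, h => ∃ a, a ≤ s ∧ s = pr z a + 1 ∧ w = z ∧ h = l ∧ l ≤ a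
  | 13, _, z, s, w, l, h => s = 0 ∧ w = z ∧ h = l
  | _, _, _, _, _, _, _ => False

theorem Bd_d0 (i : ℕ) : D0 (fun M (v : Fin 6 → M) => Bd i M (v 1) (v 2) (v 3) (v 4) (v 5)) := by
  by_cases hi : i < 14
  · interval_cases i <;> unfold Bd <;>
    repeat' first | apply D0.false | apply D0.bex | apply D0.lt | apply D0.and | apply D0.or | apply D0.eq | apply D0.le
                  | apply Tt.pr | apply Tt.zero | apply Tt.one | apply Tt.var | apply Tt.add | apply Tt.mul
  · refine D0.congr D0.false fun M v => ?_
    unfold Bd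
    split <;> simp_all

/-- The combined rule. -/
def RL : RlT := fun M t z s w l h => ∃ i : ℕ, i < 14 ∧ t = (i : M) ∧ Bd i M z s w l h

theorem D0.exLt {k : ℕ} {R : ℕ → ∀ M : PAM, (Fin k → M) → Prop} (hR : ∀ i, D0 (R i)) (n : ℕ) :
    D0 (fun M v => ∃ i, i < n ∧ R i M v) := by
  induction n with
  | zero => exact D0.congr D0.false (by simp)
  | succ n ih =>
    refine D0.congr (D0.or (hR n) ih) fun M v => ?_
    constructor
    · rintro ⟨i, hi, h⟩
      rcases Nat.lt_succ_iff_lt_or_eq.1 hi with h' | rfl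
      · exact Or.inr ⟨i, h', h⟩
      · exact Or.inl h
    · rintro (h | ⟨i, hi, h⟩)
      · exact ⟨n, by omega, h⟩
      · exact ⟨i, by omega, h⟩

theorem RL_d0 : RlD RL := D0.exLt (fun i => D0.and (D0.eq (Tt.var _) (Tt.num i)) (Bd_d0 i)) 14
theorem RL_zero (M : PAM) (z s w l b : M) : ¬ RL M 0 z s w l b := by
  rintro ⟨i, hi, h, h'⟩
  have : i = 0 := by
    have := h.symm; exact_mod_cast this
  subst this
  exact h'

section
variable {M : PAM} {N N' : Nd}

/-- truth for the concrete rules -/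
abbrev Nd.R (M : PAM) (N : Nd) (z : M) : Prop := N.T RL M z

theorem R_node {i : ℕ} (hi : i < 14) (z : M) : (Nd.node i N N').R M z ↔
    ∃ s w a b, Bd i M z s w a b ∧ (∀ u, s = u + 1 → N.R M u) ∧
      ∀ x, x ≤ b → a ≤ x → N'.R M (pr w x) := by
  unfold Nd.R
  rw [Nd.T]
  have : ∀ s w a b, RL M (i : M) z s w a b ↔ Bd i M z s w a b := by
    intro s w a b
    constructor
    · rintro ⟨j, hj, e, h⟩
      rwa [Nat.cast_injective e]
    · exact fun h => ⟨i, hi, rfl, h⟩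
  simp only [this]

theorem add_one_ne (x : M) : x + 1 ≠ 0 := by
  have : 0 < x + 1 := lt_of_le_of_lt (zero_le_ x) (lt_succ.2 le_rfl)
  exact this.ne'
theorem ft0 {P : M → Prop} : (∀ u, (0 : M) = u + 1 → P u) ↔ True :=
  iff_true_intro fun u h => absurd h.symm (add_one_ne u)
theorem ft1 {P : M → Prop} (y : M) : (∀ u, y + 1 = u + 1 → P u) ↔ P y := by
  constructor
  · exact fun h => h y rfl
  · intro h u hu
    rwa [← add_right_cancel hu]
theorem fr0 {P : M → Prop} : (∀ x, x ≤ (0 : M) → 1 ≤ x → P x) ↔ True :=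
  iff_true_intro fun x h h' => absurd (h'.trans h) (not_le.2 zero_lt_one)
theorem fr1 {P : M → Prop} (y : M) : (∀ x, x ≤ y → y ≤ x → P x) ↔ P y :=
  ⟨fun h => h y le_rfl le_rfl, fun h x h1 h2 => by rwa [le_antisymm h1 h2]⟩
theorem le_pr1 (x y : M) : y ≤ pr x y + 1 := (le_pr_right x y).trans le_self_add

theorem R1 (a b c : M) : (Nd.node 1 N N').R M (pr (pr a b) c) ↔ c = b := by
  rw [R_node (by norm_num)]
  constructor
  · rintro ⟨s, w, l, h, ⟨a', _, b', _, e, _⟩, _⟩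
    simp only [pr_inj_iff] at e
    rw [e.2, e.1.2]
  · rintro rfl
    refine ⟨0, 0, 1, 0, ⟨a, ?_, c, le_pr_right _ _, rfl, rfl, rfl, rfl⟩, ft0.2 trivial, fr0.2 trivial⟩
    exact (le_pr_left a c).trans (le_pr_left _ _)
theorem R2 (a b c : M) : (Nd.node 2 N N').R M (pr (pr a b) c) ↔ N.R M (pr a c) := by
  rw [R_node (by norm_num)]
  constructor
  · rintro ⟨s, w, l, h, ⟨a', _, b', _, c', _, e, rfl, rfl, rfl⟩, h1, _⟩
    simp only [pr_inj_iff] at e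
    rw [ft1] at h1
    rwa [e.1.1, e.2]
  · intro h
    refine ⟨_, 0, 1, 0, ⟨a, ?_, b, ?_, c, le_pr_right _ _, rfl, rfl, rfl, rfl⟩, (ft1 _).2 h, fr0.2 trivial⟩
    · exact (le_pr_left a b).trans (le_pr_left _ _)
    · exact (le_pr_right a b).trans (le_pr_left _ _)
theorem R3 (a c : M) : (Nd.node 3 N N').R M (pr a c) ↔ c = 0 := by
  rw [R_node (by norm_num)]
  constructor
  · rintro ⟨s, w, l, h, ⟨a', _, e, _⟩, _⟩
    simp only [pr_inj_iff] at e
    exact e.2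
  · rintro rfl
    exact ⟨0, 0, 1, 0, ⟨a, le_pr_left _ _, rfl, rfl, rfl, rfl⟩, ft0.2 trivial, fr0.2 trivial⟩
theorem R4 (a c : M) : (Nd.node 4 N N').R M (pr a c) ↔ ∃ b, c = b + 1 ∧ N.R M (pr a b) := by
  rw [R_node (by norm_num)]
  constructor
  · rintro ⟨s, w, l, h, ⟨a', _, b, _, e, rfl, rfl, rfl⟩, h1, _⟩
    simp only [pr_inj_iff] at e
    rw [ft1] at h1
    exact ⟨b, e.2, by rwa [e.1]⟩
  · rintro ⟨b, rfl, h⟩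
    exact ⟨_, 0, 1, 0, ⟨a, le_pr_left _ _, b, le_pr1 _ _, rfl, rfl, rfl, rfl⟩, (ft1 _).2 h, fr0.2 trivial⟩
theorem R5 (a c : M) : (Nd.node 5 N N').R M (pr a c) ↔ ∃ x y, c = x + y ∧ N.R M (pr a x) ∧ N'.R M (pr a y) := by
  rw [R_node (by norm_num)]
  constructor
  · rintro ⟨s, w, l, h, ⟨b, _, e, rfl, rfl⟩, h1, h2⟩
    simp only [pr_inj_iff] at e
    rw [ft1] at h1
    rw [fr1] at h2
    obtain ⟨rfl, rfl⟩ := e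
    exact ⟨b, _, rfl, h1, h2⟩
  · rintro ⟨x, y, rfl, h, h'⟩
    exact ⟨_, a, y, y, ⟨x, le_pr1 _ _, rfl, rfl, rfl⟩, (ft1 _).2 h, (fr1 _).2 h'⟩
theorem R6 (a c : M) : (Nd.node 6 N N').R M (pr a c) ↔ ∃ x y, c = x * y ∧ N.R M (pr a x) ∧ N'.R M (pr a y) := by
  rw [R_node (by norm_num)]
  constructor
  · rintro ⟨s, w, l, h, ⟨b, _, e, rfl, rfl⟩, h1, h2⟩
    simp only [pr_inj_iff] at e
    rw [ft1] at h1
    rw [fr1] at h2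
    obtain ⟨rfl, rfl⟩ := e
    exact ⟨b, _, rfl, h1, h2⟩
  · rintro ⟨x, y, rfl, h, h'⟩
    exact ⟨_, a, y, y, ⟨x, le_pr1 _ _, rfl, rfl, rfl⟩, (ft1 _).2 h, (fr1 _).2 h'⟩
theorem R7 (z : M) : (Nd.node 7 N N').R M z ↔ ∃ x y, x ≤ y ∧ N.R M (pr z x) ∧ N'.R M (pr z y) := by
  rw [R_node (by norm_num)]
  constructor
  · rintro ⟨s, w, l, h, ⟨b, _, rfl, rfl, rfl, h3⟩, h1, h2⟩
    rw [ft1] at h1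
    rw [fr1] at h2
    exact ⟨b, _, h3, h1, h2⟩
  · rintro ⟨x, y, hh, h, h'⟩
    exact ⟨_, z, y, y, ⟨x, le_pr1 _ _, rfl, rfl, rfl, hh⟩, (ft1 _).2 h, (fr1 _).2 h'⟩
theorem R8 (z : M) : (Nd.node 8 N N').R M z ↔ ∃ x y, x < y ∧ N.R M (pr z x) ∧ N'.R M (pr z y) := by
  rw [R_node (by norm_num)]
  constructor
  · rintro ⟨s, w, l, h, ⟨b, _, rfl, rfl, rfl, h3⟩, h1, h2⟩
    rw [ft1] at h1
    rw [fr1] at h2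
    exact ⟨b, _, h3, h1, h2⟩
  · rintro ⟨x, y, hh, h, h'⟩
    exact ⟨_, z, y, y, ⟨x, le_pr1 _ _, rfl, rfl, rfl, hh⟩, (ft1 _).2 h, (fr1 _).2 h'⟩
theorem R9 (a b : M) : (Nd.node 9 N N').R M (pr a b) ↔ N.R M (pr a b) ∧ N'.R M (pr a b) := by
  rw [R_node (by norm_num)]
  constructor
  · rintro ⟨s, w, l, h, ⟨rfl, e, rfl⟩, h1, h2⟩
    rw [ft1] at h1
    rw [fr1, ← e] at h2
    exact ⟨h1, h2⟩
  · rintro ⟨h, h'⟩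
    exact ⟨_, a, b, b, ⟨rfl, rfl, rfl⟩, (ft1 _).2 h, (fr1 _).2 h'⟩
theorem R10 (a b : M) : (Nd.node 10 N N').R M (pr a b) ↔ N.R M (pr a b) ∨ N'.R M (pr a b) := by
  rw [R_node (by norm_num)]
  constructor
  · rintro ⟨s, w, l, h, (⟨rfl, _⟩ | ⟨_, e, rfl⟩), h1, h2⟩
    · rw [ft1] at h1
      exact Or.inl h1
    · rw [fr1, ← e] at h2
      exact Or.inr h2
  · rintro (h | h')
    · exact ⟨_, 0, 1, 0, Or.inl ⟨rfl, rfl, rfl⟩, (ft1 _).2 h, fr0.2 trivial⟩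
    · exact ⟨0, a, b, b, Or.inr ⟨rfl, rfl, rfl⟩, ft0.2 trivial, (fr1 _).2 h'⟩
theorem R11 (z : M) : (Nd.node 11 N N').R M z ↔ ∃ y, N.R M (pr z y) ∧ ∀ x, x ≤ y → N'.R M (pr z x) := by
  rw [R_node (by norm_num)]
  constructor
  · rintro ⟨s, w, l, h, ⟨rfl, rfl, rfl⟩, h1, h2⟩
    rw [ft1] at h1
    exact ⟨h, h1, fun x hx => h2 x hx (zero_le_ _)⟩
  · rintro ⟨y, h, h'⟩
    exact ⟨_, z, 0, y, ⟨rfl, rfl, rfl⟩, (ft1 _).2 h, fun x hx _ => h' x hx⟩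
theorem R12 (z : M) : (Nd.node 12 N N').R M z ↔ ∃ y, N.R M (pr z y) ∧ ∃ x, x ≤ y ∧ N'.R M (pr z x) := by
  rw [R_node (by norm_num)]
  constructor
  · rintro ⟨s, w, l, h, ⟨a, _, rfl, rfl, rfl, h3⟩, h1, h2⟩
    rw [ft1] at h1
    rw [fr1] at h2
    exact ⟨a, h1, _, h3, h2⟩
  · rintro ⟨y, h, x, hx, h'⟩
    exact ⟨_, z, x, x, ⟨y, le_pr1 _ _, rfl, rfl, rfl, hx⟩, (ft1 _).2 h, (fr1 _).2 h'⟩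
theorem R13 (z : M) : (Nd.node 13 N N').R M z ↔ ∃ x, N'.R M (pr z x) := by
  rw [R_node (by norm_num)]
  constructor
  · rintro ⟨s, w, l, h, ⟨rfl, rfl, rfl⟩, h1, h2⟩
    rw [fr1] at h2
    exact ⟨_, h2⟩
  · rintro ⟨x, h'⟩
    exact ⟨_, z, x, x, ⟨rfl, rfl, rfl⟩, ft0.2 trivial, (fr1 _).2 h'⟩
end

/-- tuples -/
def tup {M : PAM} : ∀ {k : ℕ}, (Fin k → M) → M
  | 0, _ => pr 0 0
  | (k+1), v => pr (tup (fun i : Fin k => v i.castSucc)) (v (Fin.last k))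
theorem tup_snoc {M : PAM} {k : ℕ} (v : Fin k → M) (x : M) : tup (Fin.snoc v x : Fin (k+1) → M) = pr (tup v) x := by
  simp [tup]
theorem tup_pair {M : PAM} {k : ℕ} (v : Fin k → M) : ∃ a b, tup v = pr a b := by
  cases k <;> exact ⟨_, _, rfl⟩

theorem var_nd {k : ℕ} (i : Fin k) : ∃ N : Nd, ∀ (M : PAM) (v : Fin k → M) x, N.R M (pr (tup v) x) ↔ x = v i := by
  induction k with
  | zero => exact i.elim0
  | succ k ih =>
    refine Fin.lastCases ?_ (fun i => ?_) i
    · exact ⟨.node 1 .leaf .leaf, fun M v x => by rw [tup, R1]⟩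
    · obtain ⟨N, hN⟩ := ih i
      exact ⟨.node 2 N .leaf, fun M v x => by rw [tup, R2, hN]⟩

theorem term_nd {k : ℕ} (t : LA.Term (Empty ⊕ Fin k)) :
    ∃ N : Nd, ∀ (M : PAM) (v : Fin k → M) x, N.R M (pr (tup v) x) ↔ x = t.realize (Sum.elim default v) := by
  induction t using term_ind with
  | hl a => exact a.elim
  | hv i => exact var_nd i
  | h0 => exact ⟨.node 3 .leaf .leaf, fun M v x => by rw [R3, realize_zeroT]; rfl⟩
  | hs t ih =>
    obtain ⟨N, hN⟩ := ih
    refine ⟨.node 4 N .leaf, fun M v x => ?_⟩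
    rw [R4, realize_succT, opS_eq]
    simp only [hN, exists_eq_right]
  | ha t u ih1 ih2 =>
    obtain ⟨N, hN⟩ := ih1
    obtain ⟨N', hN'⟩ := ih2
    refine ⟨.node 5 N N', fun M v x => ?_⟩
    rw [R5, realize_addT]
    simp only [hN, hN']
    exact ⟨fun ⟨_, _, h, h1, h2⟩ => by rw [h, h1, h2]; rfl, fun h => ⟨_, _, h, rfl, rfl⟩⟩
  | hm t u ih1 ih2 =>
    obtain ⟨N, hN⟩ := ih1
    obtain ⟨N', hN'⟩ := ih2
    refine ⟨.node 6 N N', fun M v x => ?_⟩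
    rw [R6, realize_mulT]
    simp only [hN, hN']
    exact ⟨fun ⟨_, _, h, h1, h2⟩ => by rw [h, h1, h2]; rfl, fun h => ⟨_, _, h, rfl, rfl⟩⟩

theorem delta_nd {k : ℕ} {φ : LA.BoundedFormula Empty k} (hφ : IsDelta0 φ) :
    (∃ N : Nd, ∀ (M : PAM) (v : Fin k → M), N.R M (tup v) ↔ φ.Realize default v) ∧
    ∃ N : Nd, ∀ (M : PAM) (v : Fin k → M), N.R M (tup v) ↔ ¬ φ.Realize default v := by
  have nle : ∀ {k : ℕ} (t u : LA.Term (Empty ⊕ Fin k)), ∃ N : Nd, ∀ (M : PAM) (v : Fin k → M),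
      N.R M (tup v) ↔ t.realize (Sum.elim default v) ≤ u.realize (Sum.elim default v) := by
    intro k t u
    obtain ⟨N, hN⟩ := term_nd t
    obtain ⟨N', hN'⟩ := term_nd u
    refine ⟨.node 7 N N', fun M v => ?_⟩
    rw [R7]
    simp only [hN, hN']
    exact ⟨fun ⟨_, _, h, h1, h2⟩ => by rw [← h1, ← h2]; exact h, fun h => ⟨_, _, h, rfl, rfl⟩⟩
  have nlt : ∀ {k : ℕ} (t u : LA.Term (Empty ⊕ Fin k)), ∃ N : Nd, ∀ (M : PAM) (v : Fin k → M),
      N.R M (tup v) ↔ t.realize (Sum.elim default v) < u.realize (Sum.elim default v) := by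
    intro k t u
    obtain ⟨N, hN⟩ := term_nd t
    obtain ⟨N', hN'⟩ := term_nd u
    refine ⟨.node 8 N N', fun M v => ?_⟩
    rw [R8]
    simp only [hN, hN']
    exact ⟨fun ⟨_, _, h, h1, h2⟩ => by rw [← h1, ← h2]; exact h, fun h => ⟨_, _, h, rfl, rfl⟩⟩
  have nand : ∀ {k : ℕ} (N N' : Nd) (M : PAM) (v : Fin k → M), (Nd.node 9 N N').R M (tup v) ↔ N.R M (tup v) ∧ N'.R M (tup v) := by
    intro k N N' M v
    obtain ⟨a, b, e⟩ := tup_pair v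
    rw [e, R9]
  have nor : ∀ {k : ℕ} (N N' : Nd) (M : PAM) (v : Fin k → M), (Nd.node 10 N N').R M (tup v) ↔ N.R M (tup v) ∨ N'.R M (tup v) := by
    intro k N N' M v
    obtain ⟨a, b, e⟩ := tup_pair v
    rw [e, R10]
  induction hφ with
  | falsum =>
    refine ⟨⟨.leaf, fun M v => Iff.rfl⟩, ?_⟩
    obtain ⟨N, hN⟩ := nle (zeroT : LA.Term (Empty ⊕ Fin _)) zeroT
    exact ⟨N, fun M v => by rw [hN]; simp⟩
  | equal t u =>
    obtain ⟨N1, h1⟩ := nle t u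
    obtain ⟨N2, h2⟩ := nle u t
    obtain ⟨N3, h3⟩ := nlt t u
    obtain ⟨N4, h4⟩ := nlt u t
    refine ⟨⟨.node 9 N1 N2, fun M v => ?_⟩, ⟨.node 10 N3 N4, fun M v => ?_⟩⟩
    · rw [nand, h1, h2, BoundedFormula.realize_bdEqual]
      exact le_antisymm_iff.symm
    · rw [nor, h3, h4, BoundedFormula.realize_bdEqual]
      exact lt_or_lt_iff_ne
  | le t u =>
    obtain ⟨N1, h1⟩ := nle t u
    obtain ⟨N4, h4⟩ := nlt u t
    refine ⟨⟨N1, fun M v => ?_⟩, ⟨N4, fun M v => ?_⟩⟩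
    · rw [h1, realize_leF]; rfl
    · rw [h4, realize_leF]; exact not_le.symm
  | imp _ _ ih1 ih2 =>
    obtain ⟨⟨N1, h1⟩, ⟨N1', h1'⟩⟩ := ih1
    obtain ⟨⟨N2, h2⟩, ⟨N2', h2'⟩⟩ := ih2
    refine ⟨⟨.node 10 N1' N2, fun M v => ?_⟩, ⟨.node 9 N1 N2', fun M v => ?_⟩⟩
    · rw [nor, h1', h2, BoundedFormula.realize_imp]; tauto
    · rw [nand, h1, h2', BoundedFormula.realize_imp]; tauto
  | ball t _ ih =>
    obtain ⟨⟨N1, h1⟩, ⟨N1', h1'⟩⟩ := ih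
    obtain ⟨N, hN⟩ := term_nd t
    refine ⟨⟨.node 11 N N1, fun M v => ?_⟩, ⟨.node 12 N N1', fun M v => ?_⟩⟩
    · rw [R11]
      simp only [hN, exists_eq_left]
      simp only [← tup_snoc, h1, BoundedFormula.realize_all, BoundedFormula.realize_imp,
        realize_leF, realize_up, realize_vlast]
      rfl
    · rw [R12]
      simp only [hN, exists_eq_left]
      simp only [← tup_snoc, h1', BoundedFormula.realize_all, BoundedFormula.realize_imp,
        realize_leF, realize_up, realize_vlast]
      push Not
      rfl
  | bex t _ ih =>
    obtain ⟨⟨N1, h1⟩, ⟨N1', h1'⟩⟩ := ih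
    obtain ⟨N, hN⟩ := term_nd t
    refine ⟨⟨.node 12 N N1, fun M v => ?_⟩, ⟨.node 11 N N1', fun M v => ?_⟩⟩
    · rw [R12]
      simp only [hN, exists_eq_left]
      simp only [← tup_snoc, h1, BoundedFormula.realize_ex, BoundedFormula.realize_inf,
        realize_leF, realize_up, realize_vlast]
      rfl
    · rw [R11]
      simp only [hN, exists_eq_left]
      simp only [← tup_snoc, h1', BoundedFormula.realize_ex, BoundedFormula.realize_inf,
        realize_leF, realize_up, realize_vlast]
      push Not
      rfl

theorem cast_pr {M : PAM} (x y : ℕ) : pr (x : M) (y : M) = (((x + y) * (x + y) + x : ℕ) : M) := by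
  unfold pr; push_cast; ring
theorem Nd.cd_cast (N : Nd) : ∃ e : ℕ, ∀ M : PAM, N.cd M = (e : M) := by
  induction N with
  | leaf => exact ⟨0, fun M => by simp [Nd.cd]⟩
  | node t l r ihl ihr =>
    obtain ⟨a, ha⟩ := ihl
    obtain ⟨b, hb⟩ := ihr
    exact ⟨_, fun M => by rw [Nd.cd, ha, hb, cast_pr, cast_pr]⟩

/-- The universal `Σ_{n+1}` predicate. -/
def UN : ℕ → ∀ M : PAM, M → M → Prop
  | 0, M, e, z => Un RL M e (pr (pr 0 0) z)
  | (n+1), M, e, z => ∃ x, ¬ UN n M e (pr z x)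

theorem UN_sg (n : ℕ) : Sg (n+1) (fun M (v : Fin 2 → M) => UN n M (v 0) (v 1)) := by
  induction n with
  | zero =>
    refine Sg.subst (m := 2) (Un.sg RL_d0) (f := ![fun M v => v 0, fun M v => pr (pr 0 0) (v 1)]) fun i => ?_
    fin_cases i
    · exact Tt.var _
    · exact Tt.pr (Tt.pr Tt.zero Tt.zero) (Tt.var _)
  | succ n ih =>
    refine ⟨fun M v x => UN n M (v 0) (pr (v 1) x), ?_, fun M v => Iff.rfl⟩
    refine Sg.subst (m := 2) ih (f := ![fun M v => v 0, fun M v => pr (v 1) (v 2)]) fun i => ?_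
    fin_cases i
    · exact Tt.var _
    · exact Tt.pr (Tt.var _) (Tt.var _)

theorem UN_univ (n : ℕ) {R : ∀ M : PAM, (Fin 1 → M) → Prop} (h : Sg (n+1) R) :
    ∃ e : ℕ, ∀ (M : PAM) (z : M), UN n M (e : M) z ↔ R M (fun _ => z) := by
  induction n generalizing R with
  | zero =>
    obtain ⟨Q, ⟨φ, h1, h2⟩, h⟩ := h
    obtain ⟨N, hN⟩ := (delta_nd h1).2
    obtain ⟨e, he⟩ := Nd.cd_cast (.node 13 .leaf N)
    refine ⟨e, fun M z => ?_⟩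
    rw [UN, ← he, Nd.un_iff RL_d0 RL_zero, h]
    refine (R13 _).trans (exists_congr fun x => ?_)
    have : pr (pr (pr 0 0) z) x = tup (Fin.snoc (fun _ => z) x : Fin 2 → M) := by
      rw [tup_snoc]; rfl
    rw [this, hN, h2]
    show ¬ Q M (fun i => (Fin.snoc (fun _ => z) x : Fin 2 → M) i.castSucc) ((Fin.snoc (fun _ => z) x : Fin 2 → M) (Fin.last 1)) ↔ _
    simp only [Fin.snoc_castSucc, Fin.snoc_last]
  | succ n ih =>
    obtain ⟨Q, hQ, h⟩ := h
    have : Sg (n+1) (fun M (v : Fin 1 → M) => ∃ z, z ≤ v 0 ∧ ∃ x, x ≤ v 0 ∧ (v 0 = pr z x ∧ Q M (fun _ => z) x)) := by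
      refine (cl _).bex (Tt.var _) ((cl _).bex (Tt.var _) (Sg.and (D0.sg (D0.eq (Tt.var _) (Tt.pr (Tt.var _) (Tt.var _)))) ?_))
      refine Sg.congr (Sg.subst (m := 2) hQ (f := ![fun M v => v 1, fun M v => v 2]) fun i => ?_) ?_
      · fin_cases i <;> exact Tt.var _
      · intro M v
        have : (fun i : Fin 1 => (![v 1, v 2] : Fin 2 → M) i.castSucc) = fun _ => v 1 := by
          funext i; fin_cases i; rfl
        have h2 : (fun i : Fin 1 => (![fun M v => v 1, fun M v => v 2] : Fin 2 → ∀ M : PAM, (Fin 3 → M) → M) i.castSucc M v) = fun _ => v 1 := by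
          funext i; fin_cases i; rfl
        show _ ↔ Q M (fun i : Fin 1 => (![fun M v => v 1, fun M v => v 2] : Fin 2 → ∀ M : PAM, (Fin 3 → M) → M) i.castSucc M v) (v 2)
        rw [h2]; rfl
    obtain ⟨e, he⟩ := ih this
    refine ⟨e, fun M z => ?_⟩
    rw [UN, h]
    refine exists_congr fun x => not_congr ?_
    rw [he]
    constructor
    · rintro ⟨z', _, x', _, e, hq⟩
      obtain ⟨rfl, rfl⟩ := pr_inj e
      exact hq
    · intro hq
      exact ⟨z, le_pr_left _ _, x, le_pr_right _ _, rfl, hq⟩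

/-- The key universal lemma. -/
theorem universal (n : ℕ) : ∃ A : ∀ M : PAM, (Fin 1 → M) → M → Prop,
    Pg n (fun M (w : Fin 2 → M) => A M (fun i => w i.castSucc) (w (Fin.last 1))) ∧
    ∀ s ∈ SigmaS (n+1), ∃ e : ℕ, ∀ M : PAM, Sat M s ↔ ∃ x, A M (fun _ => (e : M)) x := by
  have : Sg (n+1) (fun M (v : Fin 1 → M) => UN n M (v 0) 0) := by
    refine Sg.subst (m := 2) (UN_sg n) (f := ![fun M v => v 0, fun M v => 0]) fun i => ?_
    fin_cases i
    · exact Tt.var _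
    · exact Tt.zero
  obtain ⟨A, hA, e⟩ := this.elim
  refine ⟨A, hA, fun s hs => ?_⟩
  obtain ⟨c, hc⟩ := UN_univ n (Sg.subst (k := 1) (m := 0) (sg_sat hs) (f := fun i => i.elim0) (fun i => i.elim0))
  refine ⟨c, fun M => ?_⟩
  rw [← hc M 0]
  exact iff_of_eq (congrFun (congrFun e M) (fun _ => (c : M)))

end

section
open PAM

/-- coded nodes -/
def nd (r n q : ℕ) : ℕ := 5 * Nat.pair n q + r
/-- argument of a coded node -/
def ar (c : ℕ) : ℕ := (c / 5).unpair.2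
/-- label of a coded node -/
def lb (c : ℕ) : ℕ := (c / 5).unpair.1

theorem nd_mod {r n q : ℕ} (h : r < 5) : nd r n q % 5 = r := by unfold nd; omega
theorem nd_div {r n q : ℕ} (h : r < 5) : nd r n q / 5 = Nat.pair n q := by unfold nd; omega
theorem ar_nd {r n q : ℕ} (h : r < 5) : ar (nd r n q) = q := by simp [ar, nd_div h]
theorem lb_nd {r n q : ℕ} (h : r < 5) : lb (nd r n q) = n := by simp [lb, nd_div h]
theorem nd_eta (c : ℕ) : c = nd (c % 5) (lb c) (ar c) := by
  simp only [nd, lb, ar, Nat.pair_unpair]; omega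

theorem ar_lt {c : ℕ} (h : ¬ c % 5 = 0) : ar c < c := by
  have : ar c ≤ c / 5 := Nat.unpair_right_le _
  omega
theorem ar1_lt {c : ℕ} (h : ¬ c % 5 = 0) : (ar c).unpair.1 < c :=
  lt_of_le_of_lt (Nat.unpair_left_le _) (ar_lt h)
theorem ar2_lt {c : ℕ} (h : ¬ c % 5 = 0) : (ar c).unpair.2 < c :=
  lt_of_le_of_lt (Nat.unpair_right_le _) (ar_lt h)

/-- recursion on coded trees -/
def Tr {σ : Type*} (h0 : ℕ → σ) (h : ℕ → σ → σ → σ → σ) (c : ℕ) : σ :=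
  if hc : c % 5 = 0 then h0 c else
    h c (Tr h0 h (ar c)) (Tr h0 h (ar c).unpair.1) (Tr h0 h (ar c).unpair.2)
termination_by c
decreasing_by
  · exact ar_lt hc
  · exact ar1_lt hc
  · exact ar2_lt hc

theorem Tr_zero {σ : Type*} (h0 : ℕ → σ) (h : ℕ → σ → σ → σ → σ) (n q : ℕ) :
    Tr h0 h (nd 0 n q) = h0 (nd 0 n q) := by
  rw [Tr, dif_pos (nd_mod (by norm_num))]
theorem Tr_node {σ : Type*} (h0 : ℕ → σ) (h : ℕ → σ → σ → σ → σ) {r : ℕ} (hr : r < 5) (hr' : r ≠ 0) (n q : ℕ) :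
    Tr h0 h (nd r n q) = h (nd r n q) (Tr h0 h q) (Tr h0 h q.unpair.1) (Tr h0 h q.unpair.2) := by
  rw [Tr, dif_neg (by rw [nd_mod hr]; exact hr'), ar_nd hr]

theorem Tr_pos {σ : Type*} (h0 : ℕ → σ) (h : ℕ → σ → σ → σ → σ) {c : ℕ} (hc : c % 5 = 0) :
    Tr h0 h c = h0 c := by rw [Tr, dif_pos hc]
theorem Tr_neg {σ : Type*} (h0 : ℕ → σ) (h : ℕ → σ → σ → σ → σ) {c : ℕ} (hc : ¬ c % 5 = 0) :
    Tr h0 h c = h c (Tr h0 h (ar c)) (Tr h0 h (ar c).unpair.1) (Tr h0 h (ar c).unpair.2) := by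
  rw [Tr, dif_neg hc]

/-- environment lookup -/
def look (j a : ℕ) : ℕ := ((fun z : ℕ => z.unpair.1)^[j] a).unpair.2
theorem look_zero (a x : ℕ) : look 0 (Nat.pair a x) = x := by simp [look]
theorem look_succ (j a x : ℕ) : look (j+1) (Nat.pair a x) = look j a := by simp [look]
theorem look_le (j a : ℕ) : look j a ≤ a := by
  refine (Nat.unpair_right_le _).trans ?_
  induction j generalizing a with
  | zero => exact le_rfl
  | succ j ih =>
    rw [Function.iterate_succ_apply]
    exact (ih _).trans (Nat.unpair_left_le _)

/-- names -/
def sN (x : ℕ) : ℕ := 5 * x + 1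
/-- names -/
def aN (x y : ℕ) : ℕ := 5 * Nat.pair x y + 2
/-- names -/
def mN (x y : ℕ) : ℕ := 5 * Nat.pair x y + 3
/-- names -/
def wN (c a : ℕ) : ℕ := 5 * Nat.pair c a + 4

/-- term values -/
def tv (a t : ℕ) : ℕ := Tr (fun c => look (lb c) a)
  (fun c x y z => if c % 5 = 1 then 0 else if c % 5 = 2 then sN x else if c % 5 = 3 then aN y z else mN y z) t

theorem tv_var (a n q : ℕ) : tv a (nd 0 n q) = look n a := by
  rw [tv, Tr_zero, lb_nd (by norm_num)]
theorem tv_zero (a n q : ℕ) : tv a (nd 1 n q) = 0 := by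
  rw [tv, Tr_node _ _ (by norm_num) (by norm_num), nd_mod (by norm_num)]; rfl
theorem tv_succ (a n q : ℕ) : tv a (nd 2 n q) = sN (tv a q) := by
  rw [tv, Tr_node _ _ (by norm_num) (by norm_num), nd_mod (by norm_num)]; rfl
theorem tv_add (a n q : ℕ) : tv a (nd 3 n q) = aN (tv a q.unpair.1) (tv a q.unpair.2) := by
  rw [tv, Tr_node _ _ (by norm_num) (by norm_num), nd_mod (by norm_num)]; rfl
theorem tv_mul (a n q : ℕ) : tv a (nd 4 n q) = mN (tv a q.unpair.1) (tv a q.unpair.2) := by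
  rw [tv, Tr_node _ _ (by norm_num) (by norm_num), nd_mod (by norm_num)]; rfl

/-- propositional variables -/
def Vv (c a : ℕ) : ℕ := 3 * Nat.pair c a
/-- propositional variables -/
def EQ (x y : ℕ) : ℕ := 3 * Nat.pair x y + 1
/-- propositional variables -/
def LEv (x y : ℕ) : ℕ := 3 * Nat.pair x y + 2

/-- the logical clauses -/
def CL (n q a x : ℕ) : List (List (ℕ × Bool)) :=
  [ [(Vv (nd 0 n q) a, false)],
    [(Vv (nd 1 n q) a, false), (EQ (tv a q.unpair.1) (tv a q.unpair.2), true)],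
    [(Vv (nd 1 n q) a, true), (EQ (tv a q.unpair.1) (tv a q.unpair.2), false)],
    [(Vv (nd 2 n q) a, false), (LEv (tv a q.unpair.1) (tv a q.unpair.2), true)],
    [(Vv (nd 2 n q) a, true), (LEv (tv a q.unpair.1) (tv a q.unpair.2), false)],
    [(Vv (nd 3 n q) a, false), (Vv q.unpair.1 a, false), (Vv q.unpair.2 a, true)],
    [(Vv (nd 3 n q) a, true), (Vv q.unpair.1 a, true)],
    [(Vv (nd 3 n q) a, true), (Vv q.unpair.2 a, false)],
    [(Vv (nd 4 n q) a, false), (Vv q (Nat.pair a x), true)],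
    [(Vv (nd 4 n q) a, true), (Vv q (Nat.pair a (wN q a)), false)],
    [(EQ n n, true)],
    [(EQ n q, false), (EQ q n, true)],
    [(EQ n q, false), (EQ q a, false), (EQ n a, true)],
    [(EQ n q, false), (EQ (sN n) (sN q), true)],
    [(EQ n q, false), (EQ a x, false), (EQ (aN n a) (aN q x), true)],
    [(EQ n q, false), (EQ a x, false), (EQ (mN n a) (mN q x), true)],
    [(EQ n q, false), (EQ a x, false), (LEv n a, false), (LEv q x, true)] ]

/-- a clause holds -/
def Hl (w : ℕ → Bool) (C : List (ℕ × Bool)) : Prop := ∃ l ∈ C, w l.1 = l.2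

section sound
variable (M : PAM)

/-- push on an environment -/
def push {X : Type} (x : X) (e : ℕ → X) : ℕ → X
  | 0 => x
  | (j+1) => e j

/-- raw term value -/
def tval (e : ℕ → M) (t : ℕ) : M := Tr (fun c => e (lb c))
  (fun c x y z => if c % 5 = 1 then opZ M else if c % 5 = 2 then opS x else if c % 5 = 3 then opA y z else opM y z) t

/-- raw satisfaction -/
def SC (c : ℕ) : (ℕ → M) → Prop := Tr (fun _ _ => False)
  (fun c x y z e => if c % 5 = 1 then tval M e (ar c).unpair.1 = tval M e (ar c).unpair.2 else
    if c % 5 = 2 then opL (tval M e (ar c).unpair.1) (tval M e (ar c).unpair.2) else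
    if c % 5 = 3 then (y e → z e) else ∀ u, x (push u e)) c

theorem SC0 (n q e) : SC M (nd 0 n q) e ↔ False := by
  rw [SC, Tr_zero]
theorem SC1 (n q e) : SC M (nd 1 n q) e ↔ tval M e q.unpair.1 = tval M e q.unpair.2 := by
  rw [SC, Tr_node _ _ (by norm_num) (by norm_num), nd_mod (by norm_num), ar_nd (by norm_num)]; rfl
theorem SC2 (n q e) : SC M (nd 2 n q) e ↔ opL (tval M e q.unpair.1) (tval M e q.unpair.2) := by
  rw [SC, Tr_node _ _ (by norm_num) (by norm_num), nd_mod (by norm_num), ar_nd (by norm_num)]; rfl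
theorem SC3 (n q e) : SC M (nd 3 n q) e ↔ (SC M q.unpair.1 e → SC M q.unpair.2 e) := by
  rw [SC, Tr_node _ _ (by norm_num) (by norm_num), nd_mod (by norm_num), ar_nd (by norm_num)]; rfl
theorem SC4 (n q e) : SC M (nd 4 n q) e ↔ ∀ u, SC M q (push u e) := by
  rw [SC, Tr_node _ _ (by norm_num) (by norm_num), nd_mod (by norm_num), ar_nd (by norm_num)]; rfl

/-- interpretation of names -/
noncomputable def val (x : ℕ) : M :=
  if _ : x % 5 = 1 then opS (val (x / 5))
  else if _ : x % 5 = 2 then opA (val (x / 5).unpair.1) (val (x / 5).unpair.2)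
  else if _ : x % 5 = 3 then opM (val (x / 5).unpair.1) (val (x / 5).unpair.2)
  else if _ : x % 5 = 4 then
    Classical.epsilon (fun u => ¬ SC M (x / 5).unpair.1 (push u (fun j => val (look j (x / 5).unpair.2))))
  else opZ M
termination_by x
decreasing_by
  · omega
  · have := Nat.unpair_left_le (x / 5); omega
  · have := Nat.unpair_right_le (x / 5); omega
  · have := Nat.unpair_left_le (x / 5); omega
  · have := Nat.unpair_right_le (x / 5); omega
  · have := Nat.unpair_right_le (x / 5)
    have := look_le j (x / 5).unpair.2
    omega

theorem val_zero : val M 0 = opZ M := by rw [val]; simp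
theorem val_s (x : ℕ) : val M (sN x) = opS (val M x) := by
  rw [val, dif_pos (by unfold sN; omega)]; congr 2; unfold sN; omega
theorem val_a (x y : ℕ) : val M (aN x y) = opA (val M x) (val M y) := by
  have : aN x y / 5 = Nat.pair x y := by unfold aN; omega
  rw [val, dif_neg (by unfold aN; omega), dif_pos (by unfold aN; omega), this, Nat.unpair_pair]
theorem val_m (x y : ℕ) : val M (mN x y) = opM (val M x) (val M y) := by
  have : mN x y / 5 = Nat.pair x y := by unfold mN; omega
  rw [val, dif_neg (by unfold mN; omega), dif_neg (by unfold mN; omega), dif_pos (by unfold mN; omega), this, Nat.unpair_pair]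
theorem val_w (q a : ℕ) (h : SC M q (push (val M (wN q a)) (fun j => val M (look j a)))) (u : M) :
    SC M q (push u (fun j => val M (look j a))) := by
  have e : wN q a / 5 = Nat.pair q a := by unfold wN; omega
  rw [val, dif_neg (by unfold wN; omega), dif_neg (by unfold wN; omega), dif_neg (by unfold wN; omega),
    dif_pos (by unfold wN; omega), e, Nat.unpair_pair] at h
  by_contra hu
  exact Classical.epsilon_spec (p := fun u => ¬ SC M q (push u (fun j => val M (look j a)))) ⟨u, hu⟩ h

theorem tval_tv (a t : ℕ) : tval M (fun j => val M (look j a)) t = val M (tv a t) := by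
  induction t using Nat.strong_induction_on with
  | _ t ih =>
    by_cases h0 : t % 5 = 0
    · rw [tval, Tr_pos _ _ h0, tv, Tr_pos _ _ h0]
    · have h1 := ih _ (ar_lt h0)
      have h2 := ih _ (ar1_lt h0)
      have h3 := ih _ (ar2_lt h0)
      rw [tval, Tr_neg _ _ h0, tv, Tr_neg _ _ h0]
      rw [tval, tv] at h1 h2 h3
      rw [h1, h2, h3]
      split_ifs
      · rw [val_zero]
      · rw [val_s]
      · rw [val_a]
      · rw [val_m]

open Classical in
/-- the valuation of a model -/
noncomputable def wv (v : ℕ) : Bool :=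
  if v % 3 = 0 then decide (SC M (v / 3).unpair.1 (fun j => val M (look j (v / 3).unpair.2)))
  else if v % 3 = 1 then decide (val M (v / 3).unpair.1 = val M (v / 3).unpair.2)
  else decide (opL (val M (v / 3).unpair.1) (val M (v / 3).unpair.2))

theorem wv_V (c a : ℕ) : wv M (Vv c a) = true ↔ SC M c (fun j => val M (look j a)) := by
  have : Vv c a / 3 = Nat.pair c a := by unfold Vv; omega
  rw [wv, if_pos (by unfold Vv; omega), this, Nat.unpair_pair]; simp
theorem wv_E (x y : ℕ) : wv M (EQ x y) = true ↔ val M x = val M y := by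
  have : EQ x y / 3 = Nat.pair x y := by unfold EQ; omega
  rw [wv, if_neg (by unfold EQ; omega), if_pos (by unfold EQ; omega), this, Nat.unpair_pair]; simp
theorem wv_L (x y : ℕ) : wv M (LEv x y) = true ↔ opL (val M x) (val M y) := by
  have : LEv x y / 3 = Nat.pair x y := by unfold LEv; omega
  rw [wv, if_neg (by unfold LEv; omega), if_neg (by unfold LEv; omega), this, Nat.unpair_pair]; simp

theorem push_val (a : ℕ) (x : ℕ) : (fun j => val M (look j (Nat.pair a x))) = push (val M x) (fun j => val M (look j a)) := by
  funext j
  cases j with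
  | zero => rw [look_zero]; rfl
  | succ j => rw [look_succ]; rfl

theorem wv_sound (n q a x : ℕ) : ∀ C ∈ CL n q a x, Hl (wv M) C := by
  unfold CL Hl
  simp only [List.forall_mem_cons, List.not_mem_nil, false_implies, implies_true, and_true,
    List.exists_mem_cons_iff, false_and, exists_false, or_false,
    ← Bool.not_eq_true, wv_V, wv_E, wv_L, SC0, SC1, SC2, SC3, SC4, tval_tv, push_val, val_s, val_a, val_m]
  refine ⟨by tauto, by tauto, by tauto, by tauto, by tauto, by tauto, by tauto, by tauto, ?_, ?_, ?_⟩
  · by_contra h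
    push Not at h
    exact h.2 (h.1 _)
  · by_contra h
    push Not at h
    obtain ⟨⟨u, hu⟩, h⟩ := h
    exact hu (val_w M q a h u)
  · refine ⟨trivial, ?_, ?_, ?_, ?_, ?_, ?_⟩
    · by_contra h; push Not at h; exact h.2 h.1.symm
    · by_contra h; push Not at h; exact h.2.2 (h.1.trans h.2.1)
    · by_contra h; push Not at h; exact h.2 (by rw [h.1])
    · by_contra h; push Not at h; exact h.2.2 (by rw [h.1, h.2.1])
    · by_contra h; push Not at h; exact h.2.2 (by rw [h.1, h.2.1])
    · by_contra h; push Not at h; exact h.2.2.2 (by rw [← h.1, ← h.2.1]; exact h.2.2.1)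

end sound

/-- term codes -/
def tcF : ∀ {l : ℕ}, LA.Functions l → (Fin l → ℕ) → ℕ
  | 0, _, _ => nd 1 0 0
  | 1, _, f => nd 2 0 (f 0)
  | 2, b, f => nd (if (show Bool from b) then 4 else 3) 0 (Nat.pair (f 0) (f 1))
  | (_ + 3), _, _ => 0
/-- term codes -/
def tc {n : ℕ} : LA.Term (Empty ⊕ Fin n) → ℕ
  | .var (Sum.inl e) => e.elim
  | .var (Sum.inr i) => nd 0 (n - 1 - i) i
  | .func f ts => tcF f (fun i => tc (ts i))
/-- relation codes -/
def rcF : ∀ {l : ℕ}, (Fin l → ℕ) → ℕ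
  | 2, f => Nat.pair (f 0) (f 1)
  | _, _ => 0
/-- formula codes -/
def cd : ∀ {n : ℕ}, LA.BoundedFormula Empty n → ℕ
  | n, .falsum => nd 0 n 0
  | n, .equal t u => nd 1 n (Nat.pair (tc t) (tc u))
  | n, .rel _ ts => nd 2 n (rcF (fun i => tc (ts i)))
  | n, .imp φ ψ => nd 3 n (Nat.pair (cd φ) (cd ψ))
  | n, .all φ => nd 4 n (cd φ)

theorem bf_ind {P : ∀ {n : ℕ}, LA.BoundedFormula Empty n → Prop}
    (h0 : ∀ n, P (⊥ : LA.BoundedFormula Empty n))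
    (h1 : ∀ {n} (t u : LA.Term (Empty ⊕ Fin n)), P (t =' u))
    (h2 : ∀ {n} (t u : LA.Term (Empty ⊕ Fin n)), P (leF t u))
    (h3 : ∀ {n} (φ ψ : LA.BoundedFormula Empty n), P φ → P ψ → P (φ ⟹ ψ))
    (h4 : ∀ {n} (φ : LA.BoundedFormula Empty (n+1)), P φ → P (∀' φ)) {n : ℕ} (φ : LA.BoundedFormula Empty n) : P φ := by
  induction φ with
  | falsum => exact h0 _
  | equal t u => exact h1 t u
  | @rel n l R ts =>
    match l, R, ts with
    | 0, R, ts => exact (show Empty from R).elim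
    | 1, R, ts => exact (show Empty from R).elim
    | 2, R, ts =>
      have : BoundedFormula.rel R ts = leF (ts 0) (ts 1) := by
        have e : ts = ![ts 0, ts 1] := by funext i; fin_cases i <;> rfl
        rw [leF, Relations.boundedFormula₂, Relations.boundedFormula, ← e]; rfl
      rw [this]; exact h2 _ _
    | (l+3), R, ts => exact (show Empty from R).elim
  | imp φ ψ ih1 ih2 => exact h3 _ _ ih1 ih2
  | all φ ih => exact h4 _ ih

theorem tc_zero {n} : tc (zeroT : LA.Term (Empty ⊕ Fin n)) = nd 1 0 0 := rfl
theorem tc_succ {n} (t : LA.Term (Empty ⊕ Fin n)) : tc (succT t) = nd 2 0 (tc t) := rfl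
theorem tc_add {n} (t u : LA.Term (Empty ⊕ Fin n)) : tc (addT t u) = nd 3 0 (Nat.pair (tc t) (tc u)) := rfl
theorem tc_mul {n} (t u : LA.Term (Empty ⊕ Fin n)) : tc (mulT t u) = nd 4 0 (Nat.pair (tc t) (tc u)) := rfl
theorem tc_var {n} (i : Fin n) : tc (.var (Sum.inr i) : LA.Term (Empty ⊕ Fin n)) = nd 0 (n - 1 - i) i := rfl
theorem cd_bot {n} : cd (⊥ : LA.BoundedFormula Empty n) = nd 0 n 0 := rfl
theorem cd_eq {n} (t u : LA.Term (Empty ⊕ Fin n)) : cd (t =' u) = nd 1 n (Nat.pair (tc t) (tc u)) := rfl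
theorem cd_le {n} (t u : LA.Term (Empty ⊕ Fin n)) : cd (leF t u) = nd 2 n (Nat.pair (tc t) (tc u)) := rfl
theorem cd_imp {n} (φ ψ : LA.BoundedFormula Empty n) : cd (φ ⟹ ψ) = nd 3 n (Nat.pair (cd φ) (cd ψ)) := rfl
theorem cd_all {n} (φ : LA.BoundedFormula Empty (n+1)) : cd (∀' φ) = nd 4 n (cd φ) := rfl

theorem tval_tc (M : PAM) {n : ℕ} (t : LA.Term (Empty ⊕ Fin n)) (e : ℕ → M) :
    tval M e (tc t) = t.realize (Sum.elim default (fun i : Fin n => e (n - 1 - i))) := by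
  induction t using term_ind with
  | hl a => exact a.elim
  | hv i => rw [tc_var, tval, Tr_zero, lb_nd (by norm_num)]; rfl
  | h0 =>
    rw [realize_zeroT, tc_zero, tval, Tr_node _ _ (by norm_num) (by norm_num), nd_mod (by norm_num)]; rfl
  | hs t ih =>
    rw [realize_succT, ← ih, tc_succ, tval, Tr_node _ _ (by norm_num) (by norm_num), nd_mod (by norm_num)]; rfl
  | ha t u ih1 ih2 =>
    rw [realize_addT, ← ih1, ← ih2, tc_add, tval, Tr_node _ _ (by norm_num) (by norm_num), nd_mod (by norm_num), Nat.unpair_pair]; rfl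
  | hm t u ih1 ih2 =>
    rw [realize_mulT, ← ih1, ← ih2, tc_mul, tval, Tr_node _ _ (by norm_num) (by norm_num), nd_mod (by norm_num), Nat.unpair_pair]; rfl

theorem push_snoc {X : Type} {n : ℕ} (u : X) (e : ℕ → X) :
    (fun i : Fin (n+1) => push u e (n + 1 - 1 - i)) = (Fin.snoc (fun i : Fin n => e (n - 1 - i)) u : Fin (n+1) → X) := by
  funext i
  refine Fin.lastCases ?_ (fun i => ?_) i
  · simp [push]
  · have := i.2
    have h : n + 1 - 1 - (i.castSucc : Fin (n+1)).1 = (n - 1 - i) + 1 := by simp; omega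
    rw [h, Fin.snoc_castSucc]; rfl

theorem SC_cd (M : PAM) {n : ℕ} (φ : LA.BoundedFormula Empty n) (e : ℕ → M) :
    SC M (cd φ) e ↔ φ.Realize default (fun i : Fin n => e (n - 1 - i)) := by
  induction φ using bf_ind generalizing e with
  | h0 n => rw [cd_bot, SC0]; rfl
  | h1 t u => rw [cd_eq, SC1, Nat.unpair_pair, tval_tc, tval_tc]; rfl
  | h2 t u => rw [cd_le, SC2, Nat.unpair_pair, tval_tc, tval_tc, realize_leF]
  | h3 φ ψ ih1 ih2 => rw [cd_imp, SC3, Nat.unpair_pair, ih1, ih2]; rfl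
  | h4 φ ih =>
    rw [cd_all, SC4]
    simp only [ih, push_snoc]
    rfl

end

section
open PAM

section complete
variable {w : ℕ → Bool} (hw : ∀ n q a x, ∀ C ∈ CL n q a x, Hl w C)

theorem CL_unfold {w : ℕ → Bool} (hw : ∀ n q a x, ∀ C ∈ CL n q a x, Hl w C) (n q a x : ℕ) :
    (¬ w (Vv (nd 0 n q) a) = true) ∧
    (w (Vv (nd 1 n q) a) = true ↔ w (EQ (tv a q.unpair.1) (tv a q.unpair.2)) = true) ∧
    (w (Vv (nd 2 n q) a) = true ↔ w (LEv (tv a q.unpair.1) (tv a q.unpair.2)) = true) ∧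
    (w (Vv (nd 3 n q) a) = true ↔ (w (Vv q.unpair.1 a) = true → w (Vv q.unpair.2 a) = true)) ∧
    (w (Vv (nd 4 n q) a) = true → w (Vv q (Nat.pair a x)) = true) ∧
    (w (Vv q (Nat.pair a (wN q a))) = true → w (Vv (nd 4 n q) a) = true) ∧
    w (EQ n n) = true ∧ (w (EQ n q) = true → w (EQ q n) = true) ∧
    (w (EQ n q) = true → w (EQ q a) = true → w (EQ n a) = true) ∧
    (w (EQ n q) = true → w (EQ (sN n) (sN q)) = true) ∧
    (w (EQ n q) = true → w (EQ a x) = true → w (EQ (aN n a) (aN q x)) = true) ∧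
    (w (EQ n q) = true → w (EQ a x) = true → w (EQ (mN n a) (mN q x)) = true) ∧
    (w (EQ n q) = true → w (EQ a x) = true → w (LEv n a) = true → w (LEv q x) = true) := by
  have h := hw n q a x
  unfold CL Hl at h
  simp only [List.forall_mem_cons, List.not_mem_nil, false_implies, implies_true, and_true,
    List.exists_mem_cons_iff, false_and, exists_false, or_false, ← Bool.not_eq_true] at h
  obtain ⟨h0, h1, h2, h3, h4, h5, h6, h7, h8, h9, h10, h11, h12, h13, h14, h15, h16⟩ := h
  refine ⟨h0, ?_, ?_, ?_, ?_, ?_, h10, ?_, ?_, ?_, ?_, ?_, ?_⟩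
  · clear h0 h3 h4 h5 h6 h7 h8 h9 h10 h11 h12 h13 h14 h15 h16; tauto
  · clear h0 h1 h2 h5 h6 h7 h8 h9 h10 h11 h12 h13 h14 h15 h16; tauto
  · clear h0 h1 h2 h3 h4 h8 h9 h10 h11 h12 h13 h14 h15 h16; tauto
  · clear h0 h1 h2 h3 h4 h5 h6 h7 h9 h10 h11 h12 h13 h14 h15 h16; tauto
  · clear h0 h1 h2 h3 h4 h5 h6 h7 h8 h10 h11 h12 h13 h14 h15 h16; tauto
  · clear h0 h1 h2 h3 h4 h5 h6 h7 h8 h9 h10 h12 h13 h14 h15 h16; tauto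
  · clear h0 h1 h2 h3 h4 h5 h6 h7 h8 h9 h10 h11 h13 h14 h15 h16; tauto
  · clear h0 h1 h2 h3 h4 h5 h6 h7 h8 h9 h10 h11 h12 h14 h15 h16; tauto
  · clear h0 h1 h2 h3 h4 h5 h6 h7 h8 h9 h10 h11 h12 h13 h15 h16; tauto
  · clear h0 h1 h2 h3 h4 h5 h6 h7 h8 h9 h10 h11 h12 h13 h14 h16; tauto
  · clear h0 h1 h2 h3 h4 h5 h6 h7 h8 h9 h10 h11 h12 h13 h14 h15; tauto

/-- the setoid of names -/
def nSet {w : ℕ → Bool} (hw : ∀ n q a x, ∀ C ∈ CL n q a x, Hl w C) : Setoid ℕ where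
  r x y := w (EQ x y) = true
  iseqv := by
    refine ⟨fun x => (CL_unfold hw x 0 0 0).2.2.2.2.2.2.1, fun {x y} => (CL_unfold hw x y 0 0).2.2.2.2.2.2.2.1,
      fun {x y z} => (CL_unfold hw x y z 0).2.2.2.2.2.2.2.2.1⟩

/-- the term model -/
def Qm {w : ℕ → Bool} (hw : ∀ n q a x, ∀ C ∈ CL n q a x, Hl w C) : Type := Quotient (nSet hw)

/-- the class of a name -/
def mkQ {w : ℕ → Bool} (hw : ∀ n q a x, ∀ C ∈ CL n q a x, Hl w C) (x : ℕ) : Qm hw := Quotient.mk (nSet hw) x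

theorem mkQ_eq (x y : ℕ) : mkQ hw x = mkQ hw y ↔ w (EQ x y) = true :=
  Quotient.eq (r := nSet hw)

/-- structure on the term model -/
def QmS {w : ℕ → Bool} (hw : ∀ n q a x, ∀ C ∈ CL n q a x, Hl w C) : LA.Structure (Qm hw) where
  funMap {n} := match n with
    | 0 => fun _ _ => mkQ hw 0
    | 1 => fun _ v => Quotient.map (sa := nSet hw) (sb := nSet hw) sN
        (fun x y h => (CL_unfold hw x y 0 0).2.2.2.2.2.2.2.2.2.1 h) (v 0)
    | 2 => fun b v => match (show Bool from b) with
      | false => Quotient.map₂ (sa := nSet hw) (sb := nSet hw) (sc := nSet hw) aN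
        (fun x y h x' y' h' => (CL_unfold hw x y x' y').2.2.2.2.2.2.2.2.2.2.1 h h') (v 0) (v 1)
      | true => Quotient.map₂ (sa := nSet hw) (sb := nSet hw) (sc := nSet hw) mN
        (fun x y h x' y' h' => (CL_unfold hw x y x' y').2.2.2.2.2.2.2.2.2.2.2.1 h h') (v 0) (v 1)
    | (_ + 3) => fun f _ => (show Empty from f).elim
  RelMap {n} := match n with
    | 0 => fun f _ => (show Empty from f).elim
    | 1 => fun f _ => (show Empty from f).elim
    | 2 => fun _ v => ∃ x y, mkQ hw x = v 0 ∧ mkQ hw y = v 1 ∧ w (LEv x y) = true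
    | (_ + 3) => fun f _ => (show Empty from f).elim

theorem qm_S (x : ℕ) : @opS _ (QmS hw) (mkQ hw x) = mkQ hw (sN x) := rfl
theorem qm_A (x y : ℕ) : @opA _ (QmS hw) (mkQ hw x) (mkQ hw y) = mkQ hw (aN x y) := rfl
theorem qm_M (x y : ℕ) : @opM _ (QmS hw) (mkQ hw x) (mkQ hw y) = mkQ hw (mN x y) := rfl
theorem qm_Z : @opZ (Qm hw) (QmS hw) = mkQ hw 0 := rfl
theorem qm_L (x y : ℕ) : @opL _ (QmS hw) (mkQ hw x) (mkQ hw y) ↔ w (LEv x y) = true := by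
  constructor
  · rintro ⟨x', y', h1, h2, h3⟩
    have h1 := (mkQ_eq hw _ _).1 h1
    have h2 := (mkQ_eq hw _ _).1 h2
    exact (CL_unfold hw x' x y' y).2.2.2.2.2.2.2.2.2.2.2.2 h1 h2 h3
  · exact fun h => ⟨x, y, rfl, rfl, h⟩

theorem qm_term {n : ℕ} (t : LA.Term (Empty ⊕ Fin n)) (a : ℕ) :
    @Term.realize _ _ (QmS hw) _ (Sum.elim default (fun i : Fin n => mkQ hw (look (n - 1 - i) a))) t = mkQ hw (tv a (tc t)) := by
  letI := QmS hw
  induction t using term_ind with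
  | hl a => exact a.elim
  | hv i => rw [tc_var, tv_var]; rfl
  | h0 => rw [realize_zeroT, tc_zero, tv_zero]; rfl
  | hs t ih => rw [realize_succT, ih, tc_succ, tv_succ]; rfl
  | ha t u ih1 ih2 => rw [realize_addT, ih1, ih2, tc_add, tv_add, Nat.unpair_pair]; rfl
  | hm t u ih1 ih2 => rw [realize_mulT, ih1, ih2, tc_mul, tv_mul, Nat.unpair_pair]; rfl

theorem push_look {X : Type} (f : ℕ → X) (a x : ℕ) : (fun j => f (look j (Nat.pair a x))) = push (f x) (fun j => f (look j a)) := by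
  funext j
  cases j with
  | zero => rw [look_zero]; rfl
  | succ j => rw [look_succ]; rfl

theorem qm_real {n : ℕ} (φ : LA.BoundedFormula Empty n) (a : ℕ) :
    w (Vv (cd φ) a) = true ↔ @BoundedFormula.Realize _ _ (QmS hw) _ _ φ default (fun i : Fin n => mkQ hw (look (n - 1 - i) a)) := by
  letI := QmS hw
  induction φ using bf_ind generalizing a with
  | h0 n => rw [cd_bot]; exact iff_of_false (CL_unfold hw _ _ _ 0).1 (fun h => h)
  | h1 t u =>
    rw [cd_eq, (CL_unfold hw _ _ _ 0).2.1, Nat.unpair_pair, BoundedFormula.realize_bdEqual, qm_term hw, qm_term hw, mkQ_eq]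
  | h2 t u =>
    rw [cd_le, (CL_unfold hw _ _ _ 0).2.2.1, Nat.unpair_pair, realize_leF, qm_term hw, qm_term hw, qm_L]
  | h3 φ ψ ih1 ih2 =>
    rw [cd_imp, (CL_unfold hw _ _ _ 0).2.2.2.1, Nat.unpair_pair]
    exact imp_congr (ih1 a) (ih2 a)
  | @h4 n φ ih =>
    rw [cd_all, BoundedFormula.realize_all]
    have key : ∀ x : ℕ, w (Vv (cd φ) (Nat.pair a x)) = true ↔
        φ.Realize default (Fin.snoc (fun i : Fin n => mkQ hw (look (n - 1 - i) a)) (mkQ hw x)) := by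
      intro x
      refine Iff.trans (ih _) ?_
      have := push_snoc (n := n) (mkQ hw x) (fun j => mkQ hw (look j a))
      rw [← push_look (mkQ hw)] at this
      rw [← this]
    constructor
    · intro h y
      obtain ⟨x, rfl⟩ : ∃ x, mkQ hw x = y := Quotient.exists_rep (s := nSet hw) y
      exact (key x).1 ((CL_unfold hw _ _ _ x).2.2.2.2.1 h)
    · intro h
      exact (CL_unfold hw _ _ _ 0).2.2.2.2.2.1 ((key _).2 (h _))

end complete

/-- names of numerals -/
def nm : ℕ → ℕ
  | 0 => 0
  | (k+1) => sN (nm k)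

theorem opS_cast {M : PAM} (k : ℕ) : opS (k : M) = ((k + 1 : ℕ) : M) := by
  rw [opS_eq]; push_cast; rfl
theorem opZ_cast {M : PAM} : opZ M = ((0 : ℕ) : M) := by
  rw [Nat.cast_zero]; rfl
theorem val_nm (M : PAM) (k : ℕ) : val M (nm k) = (k : M) := by
  induction k with
  | zero => rw [nm, val_zero, opZ_cast]
  | succ k ih => rw [nm, val_s, ih, opS_cast]

/-- finite inconsistency test -/
def Bad (G : ℕ → List (List (ℕ × Bool))) (B : ℕ) : Prop :=
  ∀ v < 2 ^ B, ∃ i < B, ∃ C ∈ G i, ∀ l ∈ C, l.1 < B ∧ v.testBit l.1 ≠ l.2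

theorem bad_sound {G : ℕ → List (List (ℕ × Bool))} {B : ℕ} (h : Bad G B) (w : ℕ → Bool)
    (hw : ∀ i, ∀ C ∈ G i, Hl w C) : False := by
  obtain ⟨v, hv, hb⟩ : ∃ v < 2 ^ B, ∀ j < B, v.testBit j = w j := by
    refine ⟨Nat.ofBits (fun j : Fin B => w j), Nat.ofBits_lt_two_pow _, fun j hj => ?_⟩
    rw [Nat.testBit_ofBits_lt _ _ hj]
  obtain ⟨i, _, C, hC, hl⟩ := h v hv
  obtain ⟨l, h1, h2⟩ := hw i C hC
  have := hl l h1
  exact this.2 ((hb _ this.1).trans h2)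

theorem bad_complete {G : ℕ → List (List (ℕ × Bool))} (h : ∀ B, ¬ Bad G B) :
    ∃ w : ℕ → Bool, ∀ i, ∀ C ∈ G i, Hl w C := by
  simp only [Bad] at h
  push Not at h
  choose v hv1 hv2 using h
  let U : Ultrafilter ℕ := Filter.hyperfilter ℕ
  have hU : ∀ n : ℕ, ∀ᶠ B in (U : Filter ℕ), n < B := fun n => by
    have : (U : Filter ℕ) ≤ Filter.atTop := by
      rw [← Nat.cofinite_eq_atTop]; exact Filter.hyperfilter_le_cofinite
    exact this (Filter.eventually_gt_atTop n)
  classical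
  let w : ℕ → Bool := fun x => decide (∀ᶠ B in (U : Filter ℕ), (v B).testBit x = true)
  have hwx : ∀ x b, w x ≠ b → ∀ᶠ B in (U : Filter ℕ), (v B).testBit x ≠ b := by
    intro x b hb
    cases b with
    | true =>
      have : ¬ ∀ᶠ B in (U : Filter ℕ), (v B).testBit x = true := by simpa [w] using hb
      rwa [← Ultrafilter.eventually_not] at this
    | false =>
      have : ∀ᶠ B in (U : Filter ℕ), (v B).testBit x = true := by simpa [w] using hb
      exact this.mono fun B h => by simp [h]
  refine ⟨w, fun i C hC => ?_⟩
  by_contra hn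
  simp only [Hl] at hn
  push Not at hn
  have : ∀ᶠ B in (U : Filter ℕ), ∀ l ∈ C, l.1 < B ∧ (v B).testBit l.1 ≠ l.2 := by
    have := (Filter.eventually_all_finset (l := (U : Filter ℕ)) C.toFinset
      (p := fun l B => l.1 < B ∧ (v B).testBit l.1 ≠ l.2)).2 (fun l hl => (hU l.1).and (hwx l.1 l.2 (hn l (by simpa using hl))))
    simpa using this
  obtain ⟨B, hB1, hB2⟩ := ((hU i).and this).exists
  obtain ⟨l, hl, h3⟩ := hv2 B i hB1 C hC
  exact h3 (hB2 l hl).1 |> (hB2 l hl).2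

end

section
open PAM

section prim
variable {α : Type} [Primcodable α]

theorem P_add {f g : α → ℕ} (hf : Primrec f) (hg : Primrec g) : Primrec fun a => f a + g a :=
  Primrec.nat_add.comp hf hg
theorem P_mul {f g : α → ℕ} (hf : Primrec f) (hg : Primrec g) : Primrec fun a => f a * g a :=
  Primrec.nat_mul.comp hf hg
theorem P_div {f g : α → ℕ} (hf : Primrec f) (hg : Primrec g) : Primrec fun a => f a / g a :=
  Primrec.nat_div.comp hf hg
theorem P_mod {f g : α → ℕ} (hf : Primrec f) (hg : Primrec g) : Primrec fun a => f a % g a :=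
  Primrec.nat_mod.comp hf hg
theorem P_pair {f g : α → ℕ} (hf : Primrec f) (hg : Primrec g) : Primrec fun a => Nat.pair (f a) (g a) :=
  Primrec₂.natPair.comp hf hg
theorem P_u1 {f : α → ℕ} (hf : Primrec f) : Primrec fun a => (f a).unpair.1 :=
  Primrec.fst.comp (Primrec.unpair.comp hf)
theorem P_u2 {f : α → ℕ} (hf : Primrec f) : Primrec fun a => (f a).unpair.2 :=
  Primrec.snd.comp (Primrec.unpair.comp hf)
theorem P_nd {f g : α → ℕ} (r : ℕ) (hf : Primrec f) (hg : Primrec g) : Primrec fun a => nd r (f a) (g a) :=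
  P_add (P_mul (Primrec.const 5) (P_pair hf hg)) (Primrec.const r)
theorem P_ar {f : α → ℕ} (hf : Primrec f) : Primrec fun a => ar (f a) :=
  P_u2 (P_div hf (Primrec.const 5))
theorem P_lb {f : α → ℕ} (hf : Primrec f) : Primrec fun a => lb (f a) :=
  P_u1 (P_div hf (Primrec.const 5))
theorem P_look {f g : α → ℕ} (hf : Primrec f) (hg : Primrec g) : Primrec fun a => look (f a) (g a) :=
  P_u2 (Primrec.nat_iterate hf hg (h := fun (_ : α) (z : ℕ) => z.unpair.1) (show Primrec fun p : α × ℕ => p.2.unpair.1 from P_u1 Primrec.snd))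
theorem P_sN {f : α → ℕ} (hf : Primrec f) : Primrec fun a => sN (f a) :=
  P_add (P_mul (Primrec.const 5) hf) (Primrec.const 1)
theorem P_aN {f g : α → ℕ} (hf : Primrec f) (hg : Primrec g) : Primrec fun a => aN (f a) (g a) :=
  P_add (P_mul (Primrec.const 5) (P_pair hf hg)) (Primrec.const 2)
theorem P_mN {f g : α → ℕ} (hf : Primrec f) (hg : Primrec g) : Primrec fun a => mN (f a) (g a) :=
  P_add (P_mul (Primrec.const 5) (P_pair hf hg)) (Primrec.const 3)
theorem P_wN {f g : α → ℕ} (hf : Primrec f) (hg : Primrec g) : Primrec fun a => wN (f a) (g a) :=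
  P_add (P_mul (Primrec.const 5) (P_pair hf hg)) (Primrec.const 4)
theorem P_Vv {f g : α → ℕ} (hf : Primrec f) (hg : Primrec g) : Primrec fun a => Vv (f a) (g a) :=
  P_mul (Primrec.const 3) (P_pair hf hg)
theorem P_EQ {f g : α → ℕ} (hf : Primrec f) (hg : Primrec g) : Primrec fun a => EQ (f a) (g a) :=
  P_add (P_mul (Primrec.const 3) (P_pair hf hg)) (Primrec.const 1)
theorem P_LEv {f g : α → ℕ} (hf : Primrec f) (hg : Primrec g) : Primrec fun a => LEv (f a) (g a) :=
  P_add (P_mul (Primrec.const 3) (P_pair hf hg)) (Primrec.const 2)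
theorem P_cons {β : Type} [Primcodable β] {f : α → β} {g : α → List β} (hf : Primrec f) (hg : Primrec g) :
    Primrec fun a => f a :: g a := Primrec.list_cons.comp hf hg
theorem P_app {β : Type} [Primcodable β] {f : α → List β} {g : α → List β} (hf : Primrec f) (hg : Primrec g) :
    Primrec fun a => f a ++ g a := Primrec.list_append.comp hf hg
theorem P_pow2 {f : α → ℕ} (hf : Primrec f) : Primrec fun a => 2 ^ f a := by
  refine (Primrec.nat_iterate hf (Primrec.const 1) (h := fun _ z => 2 * z) (P_mul (Primrec.const 2) Primrec.snd)).of_eq fun a => ?_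
  generalize f a = k
  induction k with
  | zero => rfl
  | succ k ih => rw [Function.iterate_succ_apply', ih, pow_succ, mul_comm]
theorem P_nm {f : α → ℕ} (hf : Primrec f) : Primrec fun a => nm (f a) := by
  refine (Primrec.nat_iterate hf (Primrec.const 0) (h := fun _ z => sN z) (P_sN Primrec.snd)).of_eq fun a => ?_
  generalize f a = k
  induction k with
  | zero => rfl
  | succ k ih => rw [Function.iterate_succ_apply', ih]; rfl
theorem P_ifm {β : Type} [Primcodable β] {f : α → ℕ} {g h : α → β} (k : ℕ) (hf : Primrec f) (hg : Primrec g) (hh : Primrec h) :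
    Primrec fun a => if f a % 5 = k then g a else h a :=
  Primrec.ite (Primrec.eq.comp (P_mod hf (Primrec.const 5)) (Primrec.const k)) hg hh
theorem P_ifb {β : Type} [Primcodable β] {f : α → Bool} {g h : α → β} (hf : Primrec f) (hg : Primrec g) (hh : Primrec h) :
    Primrec fun a => if f a = true then g a else h a :=
  Primrec.ite (Primrec.eq.comp hf (Primrec.const true)) hg hh
theorem P_eqb {f g : α → ℕ} (hf : Primrec f) (hg : Primrec g) :
    Primrec fun a => decide (f a = g a) :=
  (Primrec.eq.comp hf hg).decide
theorem P_and {f g : α → Bool} (hf : Primrec f) (hg : Primrec g) :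
    Primrec fun a => f a && g a := Primrec.and.comp hf hg

theorem Tr_prim {σ : Type} [Primcodable σ] [Inhabited σ] {h0 : α → ℕ → σ} {h : α → ℕ → σ → σ → σ → σ}
    (H0 : Primrec₂ h0)
    (H : Primrec fun p : α × ℕ × σ × σ × σ => h p.1 p.2.1 p.2.2.1 p.2.2.2.1 p.2.2.2.2) :
    Primrec₂ fun a c => Tr (h0 a) (h a) c := by
  have hl : Primrec fun p : α × List σ => p.2.length := Primrec.list_length.comp Primrec.snd
  have hg : ∀ {k : α × List σ → ℕ}, Primrec k → Primrec fun p : α × List σ => p.2.getI (k p) :=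
    fun hk => Primrec.list_getI.comp Primrec.snd hk
  refine Primrec.nat_strong_rec _ (g := fun a l => some (if l.length % 5 = 0 then h0 a l.length else
    h a l.length (l.getI (ar l.length)) (l.getI (ar l.length).unpair.1) (l.getI (ar l.length).unpair.2))) ?_ ?_
  · refine Primrec.option_some.comp (P_ifm 0 hl (H0.comp Primrec.fst hl) ?_)
    refine H.comp (g := fun p : α × List σ => (p.1, p.2.length, p.2.getI (ar p.2.length), p.2.getI (ar p.2.length).unpair.1, p.2.getI (ar p.2.length).unpair.2)) ?_
    exact Primrec.fst.pair (hl.pair ((hg (P_ar hl)).pair ((hg (P_u1 (P_ar hl))).pair (hg (P_u2 (P_ar hl))))))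
  · intro a n
    have key : ∀ m < n, (List.map (Tr (h0 a) (h a)) (List.range n)).getI m = Tr (h0 a) (h a) m := by
      intro m hm
      rw [List.getI_eq_getElem _ (by simpa using hm)]
      simp
    simp only [List.length_map, List.length_range, Option.some.injEq]
    by_cases hc : n % 5 = 0
    · rw [if_pos hc, Tr_pos _ _ hc]
    · rw [if_neg hc, Tr_neg _ _ hc, key _ (ar_lt hc), key _ (ar1_lt hc), key _ (ar2_lt hc)]

theorem P_tv {f g : α → ℕ} (hf : Primrec f) (hg : Primrec g) : Primrec fun a => tv (f a) (g a) := by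
  have : Primrec₂ fun a c : ℕ => tv a c := by
    unfold tv
    refine Tr_prim (h0 := fun a c => look (lb c) a) (h := fun a c x y z => if c % 5 = 1 then 0 else if c % 5 = 2 then sN x else if c % 5 = 3 then aN y z else mN y z) ?_ ?_
    · exact P_look (P_lb Primrec.snd) Primrec.fst
    · have h1 : Primrec fun p : ℕ × ℕ × ℕ × ℕ × ℕ => p.2.1 := Primrec.fst.comp Primrec.snd
      have h2 : Primrec fun p : ℕ × ℕ × ℕ × ℕ × ℕ => p.2.2.1 := Primrec.fst.comp (Primrec.snd.comp Primrec.snd)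
      have h3 : Primrec fun p : ℕ × ℕ × ℕ × ℕ × ℕ => p.2.2.2.1 := Primrec.fst.comp (Primrec.snd.comp (Primrec.snd.comp Primrec.snd))
      have h4 : Primrec fun p : ℕ × ℕ × ℕ × ℕ × ℕ => p.2.2.2.2 := Primrec.snd.comp (Primrec.snd.comp (Primrec.snd.comp Primrec.snd))
      exact P_ifm 1 h1 (Primrec.const 0) (P_ifm 2 h1 (P_sN h2) (P_ifm 3 h1 (P_aN h3 h4) (P_mN h3 h4)))
  exact this.comp hf hg

theorem P_CL {n q a x : α → ℕ} (hn : Primrec n) (hq : Primrec q) (ha : Primrec a) (hx : Primrec x) :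
    Primrec fun t => CL (n t) (q t) (a t) (x t) := by
  unfold CL
  repeat' first
    | exact hn | exact hq | exact ha | exact hx
    | apply P_cons | exact Primrec.const [] | exact Primrec.const _
    | apply Primrec.pair | apply P_Vv | apply P_EQ | apply P_LEv | apply P_tv | apply P_u1 | apply P_u2
    | apply P_nd | apply P_pair | apply P_wN | apply P_sN

end prim
end

section
open PAM

/-- encodings of terms -/
def tenc (c : ℕ) : List ℕ := Tr (fun c => [2*(2*ar c+1)])
  (fun c x y z => if c % 5 = 1 then [2*Nat.pair 0 0+1] else if c % 5 = 2 then (2*Nat.pair 1 0+1)::x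
    else if c % 5 = 3 then (2*Nat.pair 2 0+1)::(y++z) else (2*Nat.pair 2 1+1)::(y++z)) c
/-- encodings of formulas -/
def fenc (c : ℕ) : List ℕ := Tr (fun c => [2*(2*(lb c+2)+1)+1])
  (fun c x y z => if c % 5 = 1 then [2*Nat.pair (lb c) (Encodable.encode (tenc (ar c).unpair.1)), 2*Nat.pair (lb c) (Encodable.encode (tenc (ar c).unpair.2))]
    else if c % 5 = 2 then [2*(2*Nat.pair 2 0)+1, 2*(2*lb c+1)+1, 2*Nat.pair (lb c) (Encodable.encode (tenc (ar c).unpair.1)), 2*Nat.pair (lb c) (Encodable.encode (tenc (ar c).unpair.2))]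
    else if c % 5 = 3 then (2*(2*0+1)+1)::(y++z) else (2*(2*1+1)+1)::x) c

theorem encode_listmap {β : Type} [Encodable β] (l : List β) : Encodable.encode l = Encodable.encode (l.map Encodable.encode) := by
  induction l with
  | nil => rfl
  | cons a l ih => rw [List.map_cons, Encodable.encode_list_cons, Encodable.encode_list_cons, ih]; rfl

theorem tenc_tc {n : ℕ} (t : LA.Term (Empty ⊕ Fin n)) :
    (Term.listEncode t).map Encodable.encode = tenc (tc t) := by
  refine term_ind (P := fun t => (Term.listEncode t).map Encodable.encode = tenc (tc t)) ?_ ?_ ?_ ?_ ?_ ?_ t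
  · intro a; exact a.elim
  · intro i; rw [tc_var, tenc, Tr_zero, ar_nd (by norm_num)]; rfl
  · rw [tc_zero, tenc, Tr_node _ _ (by norm_num) (by norm_num), nd_mod (by norm_num), if_pos rfl]; rfl
  · intro t h
    rw [tc_succ, tenc, Tr_node _ _ (by norm_num) (by norm_num), nd_mod (by norm_num), if_neg (by norm_num), if_pos rfl]
    change _ = _ :: (tenc _)
    rw [← h]
    change _ :: List.map _ (_ ++ []) = _
    rw [List.append_nil]; rfl
  · intro t u h1 h2
    rw [tc_add, tenc, Tr_node _ _ (by norm_num) (by norm_num), nd_mod (by norm_num), if_neg (by norm_num), if_neg (by norm_num), if_pos rfl, Nat.unpair_pair]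
    change _ = _ :: (tenc _ ++ tenc _)
    rw [← h1, ← h2, ← List.map_append]
    change _ :: List.map _ (_ ++ (_ ++ [])) = _
    rw [List.append_nil]; rfl
  · intro t u h1 h2
    rw [tc_mul, tenc, Tr_node _ _ (by norm_num) (by norm_num), nd_mod (by norm_num), if_neg (by norm_num), if_neg (by norm_num), if_neg (by norm_num), Nat.unpair_pair]
    change _ = _ :: (tenc _ ++ tenc _)
    rw [← h1, ← h2, ← List.map_append]
    change _ :: List.map _ (_ ++ (_ ++ [])) = _
    rw [List.append_nil]; rfl

theorem fenc_cd {n : ℕ} (φ : LA.BoundedFormula Empty n) :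
    (BoundedFormula.listEncode φ).map Encodable.encode = fenc (cd φ) := by
  have ht : ∀ {n : ℕ} (t : LA.Term (Empty ⊕ Fin n)), Encodable.encode t = Encodable.encode (tenc (tc t)) := by
    intro n t
    rw [← tenc_tc, ← encode_listmap]; rfl
  refine bf_ind (P := fun φ => (BoundedFormula.listEncode φ).map Encodable.encode = fenc (cd φ)) ?_ ?_ ?_ ?_ ?_ φ
  · intro n; rw [cd_bot, fenc, Tr_zero, lb_nd (by norm_num)]; rfl
  · intro n t u
    rw [cd_eq, fenc, Tr_node _ _ (by norm_num) (by norm_num), nd_mod (by norm_num), lb_nd (by norm_num), ar_nd (by norm_num), if_pos rfl, Nat.unpair_pair, ← ht, ← ht]; rfl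
  · intro n t u
    rw [cd_le, fenc, Tr_node _ _ (by norm_num) (by norm_num), nd_mod (by norm_num), lb_nd (by norm_num), ar_nd (by norm_num), if_neg (by norm_num), if_pos rfl, Nat.unpair_pair, ← ht, ← ht]; rfl
  · intro n φ ψ h1 h2
    rw [cd_imp, fenc, Tr_node _ _ (by norm_num) (by norm_num), nd_mod (by norm_num), if_neg (by norm_num), if_neg (by norm_num), if_pos rfl, Nat.unpair_pair]
    change _ = _ :: (fenc _ ++ fenc _)
    rw [← h1, ← h2, ← List.map_append]; rfl
  · intro n φ h1
    rw [cd_all, fenc, Tr_node _ _ (by norm_num) (by norm_num), nd_mod (by norm_num), if_neg (by norm_num), if_neg (by norm_num), if_neg (by norm_num)]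
    change _ = _ :: (fenc _)
    rw [← h1]; rfl

theorem gnum_eq (φ : Snt) : gnum φ = Encodable.encode (fenc (cd φ)) := by
  rw [← fenc_cd, ← encode_listmap]; rfl

/-- well-formed term codes -/
def wft (n c : ℕ) : Bool := Tr (fun c => decide (lb c + ar c + 1 = n))
  (fun c x y z => if c % 5 = 1 then decide (c = nd 1 0 0) else if c % 5 = 2 then (x && decide (lb c = 0))
    else (y && (z && decide (lb c = 0)))) c
/-- well-formed formula codes -/
def wff (c : ℕ) : Bool := Tr (fun c => decide (ar c = 0))
  (fun c x y z => if c % 5 = 1 then (wft (lb c) (ar c).unpair.1 && wft (lb c) (ar c).unpair.2)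
    else if c % 5 = 2 then (wft (lb c) (ar c).unpair.1 && wft (lb c) (ar c).unpair.2)
    else if c % 5 = 3 then (y && (z && (decide (lb (ar c).unpair.1 = lb c) && decide (lb (ar c).unpair.2 = lb c))))
    else (x && decide (lb (ar c) = lb c + 1))) c

theorem wft_tc {n : ℕ} (t : LA.Term (Empty ⊕ Fin n)) : wft n (tc t) = true := by
  refine term_ind (P := fun t => wft n (tc t) = true) ?_ ?_ ?_ ?_ ?_ ?_ t
  · intro a; exact a.elim
  · intro i; rw [tc_var, wft, Tr_zero, ar_nd (by norm_num), lb_nd (by norm_num), decide_eq_true_iff]; omega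
  · rw [tc_zero, wft, Tr_node _ _ (by norm_num) (by norm_num), nd_mod (by norm_num), if_pos rfl]; simp
  · intro t h
    rw [tc_succ, wft, Tr_node _ _ (by norm_num) (by norm_num), nd_mod (by norm_num), if_neg (by norm_num), if_pos rfl, lb_nd (by norm_num)]
    change (wft _ _ && _) = true
    rw [h]; rfl
  · intro t u h1 h2
    rw [tc_add, wft, Tr_node _ _ (by norm_num) (by norm_num), nd_mod (by norm_num), if_neg (by norm_num), if_neg (by norm_num), lb_nd (by norm_num), Nat.unpair_pair]
    change (wft _ _ && (wft _ _ && _)) = true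
    rw [h1, h2]; rfl
  · intro t u h1 h2
    rw [tc_mul, wft, Tr_node _ _ (by norm_num) (by norm_num), nd_mod (by norm_num), if_neg (by norm_num), if_neg (by norm_num), lb_nd (by norm_num), Nat.unpair_pair]
    change (wft _ _ && (wft _ _ && _)) = true
    rw [h1, h2]; rfl

theorem lb_cd {n : ℕ} (φ : LA.BoundedFormula Empty n) : lb (cd φ) = n := by
  refine bf_ind (P := fun {n} φ => lb (cd φ) = n) ?_ ?_ ?_ ?_ ?_ φ
  · intro n; rw [cd_bot, lb_nd (by norm_num)]
  · intro n t u; rw [cd_eq, lb_nd (by norm_num)]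
  · intro n t u; rw [cd_le, lb_nd (by norm_num)]
  · intro n t u _ _; rw [cd_imp, lb_nd (by norm_num)]
  · intro n t _; rw [cd_all, lb_nd (by norm_num)]

theorem wff_cd {n : ℕ} (φ : LA.BoundedFormula Empty n) : wff (cd φ) = true := by
  refine bf_ind (P := fun φ => wff (cd φ) = true) ?_ ?_ ?_ ?_ ?_ φ
  · intro n; rw [cd_bot, wff, Tr_zero, ar_nd (by norm_num)]; rfl
  · intro n t u
    rw [cd_eq, wff, Tr_node _ _ (by norm_num) (by norm_num), nd_mod (by norm_num), lb_nd (by norm_num), ar_nd (by norm_num), if_pos rfl, Nat.unpair_pair, wft_tc, wft_tc]; rfl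
  · intro n t u
    rw [cd_le, wff, Tr_node _ _ (by norm_num) (by norm_num), nd_mod (by norm_num), lb_nd (by norm_num), ar_nd (by norm_num), if_neg (by norm_num), if_pos rfl, Nat.unpair_pair, wft_tc, wft_tc]; rfl
  · intro n φ ψ h1 h2
    rw [cd_imp, wff, Tr_node _ _ (by norm_num) (by norm_num), nd_mod (by norm_num), if_neg (by norm_num), if_neg (by norm_num), if_pos rfl, ar_nd (by norm_num), lb_nd (by norm_num), Nat.unpair_pair, lb_cd, lb_cd]
    change (wff _ && (wff _ && _)) = true
    rw [h1, h2]; simp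
  · intro n φ h1
    rw [cd_all, wff, Tr_node _ _ (by norm_num) (by norm_num), nd_mod (by norm_num), if_neg (by norm_num), if_neg (by norm_num), if_neg (by norm_num), ar_nd (by norm_num), lb_nd (by norm_num), lb_cd]
    change (wff _ && _) = true
    rw [h1]; simp

theorem wft_inv (n : ℕ) : ∀ c, wft n c = true → ∃ t : LA.Term (Empty ⊕ Fin n), tc t = c := by
  intro c
  induction c using Nat.strong_induction_on with
  | _ c ih =>
  intro h
  have e := nd_eta c
  have hlt : c % 5 < 5 := Nat.mod_lt _ (by norm_num)
  by_cases h0 : c % 5 = 0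
  · rw [wft, Tr_pos _ _ h0, decide_eq_true_iff] at h
    refine ⟨.var (Sum.inr ⟨ar c, by omega⟩), ?_⟩
    rw [tc_var]
    have e2 : n - 1 - ar c = lb c := by omega
    simp only [e2]
    rw [h0] at e; exact e.symm
  · rw [wft, Tr_neg _ _ h0] at h
    change (if c % 5 = 1 then decide (c = nd 1 0 0) else if c % 5 = 2 then (wft n _ && decide (lb c = 0))
    else (wft n _ && (wft n _ && decide (lb c = 0)))) = true at h
    split_ifs at h with h1 h2
    · exact ⟨zeroT, by rw [tc_zero]; exact (decide_eq_true_iff.1 h).symm⟩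
    · rw [Bool.and_eq_true, decide_eq_true_iff] at h
      obtain ⟨t, ht⟩ := ih _ (ar_lt h0) h.1
      exact ⟨succT t, by rw [tc_succ, ht, e, h2, h.2, ar_nd (by norm_num)]⟩
    · rw [Bool.and_eq_true, Bool.and_eq_true, decide_eq_true_iff] at h
      obtain ⟨t, ht⟩ := ih _ (ar1_lt h0) h.1
      obtain ⟨u, hu⟩ := ih _ (ar2_lt h0) h.2.1
      by_cases h3 : c % 5 = 3
      · exact ⟨addT t u, by rw [tc_add, ht, hu, Nat.pair_unpair, e, h3, h.2.2, ar_nd (by norm_num)]⟩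
      · have h4 : c % 5 = 4 := by omega
        exact ⟨mulT t u, by rw [tc_mul, ht, hu, Nat.pair_unpair, e, h4, h.2.2, ar_nd (by norm_num)]⟩

theorem wff_inv : ∀ c n, lb c = n → wff c = true → ∃ φ : LA.BoundedFormula Empty n, cd φ = c := by
  intro c
  induction c using Nat.strong_induction_on with
  | _ c ih =>
  intro n hn h
  have e := nd_eta c
  have hlt : c % 5 < 5 := Nat.mod_lt _ (by norm_num)
  by_cases h0 : c % 5 = 0
  · rw [wff, Tr_pos _ _ h0, decide_eq_true_iff] at h
    exact ⟨⊥, by rw [cd_bot, e, h0, h, hn]⟩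
  · rw [wff, Tr_neg _ _ h0] at h
    change (if c % 5 = 1 then (wft (lb c) (ar c).unpair.1 && wft (lb c) (ar c).unpair.2)
    else if c % 5 = 2 then (wft (lb c) (ar c).unpair.1 && wft (lb c) (ar c).unpair.2)
    else if c % 5 = 3 then (wff _ && (wff _ && (decide (lb (ar c).unpair.1 = lb c) && decide (lb (ar c).unpair.2 = lb c))))
    else (wff _ && decide (lb (ar c) = lb c + 1))) = true at h
    rw [hn] at h e
    split_ifs at h with h1 h2 h3
    · rw [Bool.and_eq_true] at h
      obtain ⟨t, ht⟩ := wft_inv _ _ h.1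
      obtain ⟨u, hu⟩ := wft_inv _ _ h.2
      exact ⟨t =' u, by rw [cd_eq, ht, hu, Nat.pair_unpair, ← h1, ← e]⟩
    · rw [Bool.and_eq_true] at h
      obtain ⟨t, ht⟩ := wft_inv _ _ h.1
      obtain ⟨u, hu⟩ := wft_inv _ _ h.2
      exact ⟨leF t u, by rw [cd_le, ht, hu, Nat.pair_unpair, ← h2, ← e]⟩
    · simp only [Bool.and_eq_true, decide_eq_true_iff] at h
      obtain ⟨t, ht⟩ := ih _ (ar1_lt h0) n h.2.2.1 h.1
      obtain ⟨u, hu⟩ := ih _ (ar2_lt h0) n h.2.2.2 h.2.1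
      exact ⟨t ⟹ u, by rw [cd_imp, ht, hu, Nat.pair_unpair, ← h3, ← e]⟩
    · simp only [Bool.and_eq_true, decide_eq_true_iff] at h
      obtain ⟨t, ht⟩ := ih _ (ar_lt h0) (n+1) h.2 h.1
      have h4 : c % 5 = 4 := by omega
      exact ⟨∀' t, by rw [cd_all, ht, ← h4, ← e]⟩

section prim
variable {α : Type} [Primcodable α]

theorem P_tenc {f : α → ℕ} (hf : Primrec f) : Primrec fun a => tenc (f a) := by
  have : Primrec₂ fun (_ : Unit) (c : ℕ) => tenc c := by
    unfold tenc
    refine Tr_prim (α := Unit) (h0 := fun _ c => [2*(2*ar c+1)]) (h := fun _ c x y z => if c % 5 = 1 then [2*Nat.pair 0 0+1] else if c % 5 = 2 then (2*Nat.pair 1 0+1)::x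
    else if c % 5 = 3 then (2*Nat.pair 2 0+1)::(y++z) else (2*Nat.pair 2 1+1)::(y++z)) ?_ ?_
    · exact P_cons (P_mul (Primrec.const 2) (P_add (P_mul (Primrec.const 2) (P_ar Primrec.snd)) (Primrec.const 1))) (Primrec.const [])
    · have h1 : Primrec fun p : Unit × ℕ × List ℕ × List ℕ × List ℕ => p.2.1 := Primrec.fst.comp Primrec.snd
      have h2 : Primrec fun p : Unit × ℕ × List ℕ × List ℕ × List ℕ => p.2.2.1 := Primrec.fst.comp (Primrec.snd.comp Primrec.snd)
      have h3 : Primrec fun p : Unit × ℕ × List ℕ × List ℕ × List ℕ => p.2.2.2.1 := Primrec.fst.comp (Primrec.snd.comp (Primrec.snd.comp Primrec.snd))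
      have h4 : Primrec fun p : Unit × ℕ × List ℕ × List ℕ × List ℕ => p.2.2.2.2 := Primrec.snd.comp (Primrec.snd.comp (Primrec.snd.comp Primrec.snd))
      exact P_ifm 1 h1 (Primrec.const _) (P_ifm 2 h1 (P_cons (Primrec.const _) h2) (P_ifm 3 h1 (P_cons (Primrec.const _) (P_app h3 h4)) (P_cons (Primrec.const _) (P_app h3 h4))))
  exact this.comp (Primrec.const ()) hf

theorem P_fenc {f : α → ℕ} (hf : Primrec f) : Primrec fun a => fenc (f a) := by
  have : Primrec₂ fun (_ : Unit) (c : ℕ) => fenc c := by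
    unfold fenc
    refine Tr_prim (α := Unit) (h0 := fun _ c => [2*(2*(lb c+2)+1)+1]) (h := fun _ c x y z => if c % 5 = 1 then [2*Nat.pair (lb c) (Encodable.encode (tenc (ar c).unpair.1)), 2*Nat.pair (lb c) (Encodable.encode (tenc (ar c).unpair.2))]
    else if c % 5 = 2 then [2*(2*Nat.pair 2 0)+1, 2*(2*lb c+1)+1, 2*Nat.pair (lb c) (Encodable.encode (tenc (ar c).unpair.1)), 2*Nat.pair (lb c) (Encodable.encode (tenc (ar c).unpair.2))]
    else if c % 5 = 3 then (2*(2*0+1)+1)::(y++z) else (2*(2*1+1)+1)::x) ?_ ?_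
    · exact P_cons (P_add (P_mul (Primrec.const 2) (P_add (P_mul (Primrec.const 2) (P_add (P_lb Primrec.snd) (Primrec.const 2))) (Primrec.const 1))) (Primrec.const 1)) (Primrec.const [])
    · have h1 : Primrec fun p : Unit × ℕ × List ℕ × List ℕ × List ℕ => p.2.1 := Primrec.fst.comp Primrec.snd
      have h2 : Primrec fun p : Unit × ℕ × List ℕ × List ℕ × List ℕ => p.2.2.1 := Primrec.fst.comp (Primrec.snd.comp Primrec.snd)
      have h3 : Primrec fun p : Unit × ℕ × List ℕ × List ℕ × List ℕ => p.2.2.2.1 := Primrec.fst.comp (Primrec.snd.comp (Primrec.snd.comp Primrec.snd))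
      have h4 : Primrec fun p : Unit × ℕ × List ℕ × List ℕ × List ℕ => p.2.2.2.2 := Primrec.snd.comp (Primrec.snd.comp (Primrec.snd.comp Primrec.snd))
      have a1 : Primrec fun p : Unit × ℕ × List ℕ × List ℕ × List ℕ => 2*Nat.pair (lb p.2.1) (Encodable.encode (tenc (ar p.2.1).unpair.1)) :=
        P_mul (Primrec.const 2) (P_pair (P_lb h1) (Primrec.encode.comp (P_tenc (P_u1 (P_ar h1)))))
      have a2 : Primrec fun p : Unit × ℕ × List ℕ × List ℕ × List ℕ => 2*Nat.pair (lb p.2.1) (Encodable.encode (tenc (ar p.2.1).unpair.2)) :=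
        P_mul (Primrec.const 2) (P_pair (P_lb h1) (Primrec.encode.comp (P_tenc (P_u2 (P_ar h1)))))
      exact P_ifm 1 h1 (P_cons a1 (P_cons a2 (Primrec.const []))) (P_ifm 2 h1 (P_cons (Primrec.const _) (P_cons
        (P_add (P_mul (Primrec.const 2) (P_add (P_mul (Primrec.const 2) (P_lb h1)) (Primrec.const 1))) (Primrec.const 1))
        (P_cons a1 (P_cons a2 (Primrec.const []))))) (P_ifm 3 h1 (P_cons (Primrec.const _) (P_app h3 h4)) (P_cons (Primrec.const _) h2)))
  exact this.comp (Primrec.const ()) hf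

theorem P_wft {f g : α → ℕ} (hf : Primrec f) (hg : Primrec g) : Primrec fun a => wft (f a) (g a) := by
  have : Primrec₂ fun (n : ℕ) (c : ℕ) => wft n c := by
    unfold wft
    refine Tr_prim (α := ℕ) (h0 := fun n c => decide (lb c + ar c + 1 = n)) (h := fun n c x y z => if c % 5 = 1 then decide (c = nd 1 0 0) else if c % 5 = 2 then (x && decide (lb c = 0))
    else (y && (z && decide (lb c = 0)))) ?_ ?_
    · exact P_eqb (P_add (P_add (P_lb Primrec.snd) (P_ar Primrec.snd)) (Primrec.const 1)) Primrec.fst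
    · have h1 : Primrec fun p : ℕ × ℕ × Bool × Bool × Bool => p.2.1 := Primrec.fst.comp Primrec.snd
      have h2 : Primrec fun p : ℕ × ℕ × Bool × Bool × Bool => p.2.2.1 := Primrec.fst.comp (Primrec.snd.comp Primrec.snd)
      have h3 : Primrec fun p : ℕ × ℕ × Bool × Bool × Bool => p.2.2.2.1 := Primrec.fst.comp (Primrec.snd.comp (Primrec.snd.comp Primrec.snd))
      have h4 : Primrec fun p : ℕ × ℕ × Bool × Bool × Bool => p.2.2.2.2 := Primrec.snd.comp (Primrec.snd.comp (Primrec.snd.comp Primrec.snd))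
      have h5 := P_eqb (P_lb h1) (Primrec.const 0)
      exact P_ifm 1 h1 (P_eqb h1 (Primrec.const _)) (P_ifm 2 h1 (P_and h2 h5) (P_and h3 (P_and h4 h5)))
  exact this.comp hf hg

theorem P_wff {f : α → ℕ} (hf : Primrec f) : Primrec fun a => wff (f a) := by
  have : Primrec₂ fun (_ : Unit) (c : ℕ) => wff c := by
    unfold wff
    refine Tr_prim (α := Unit) (h0 := fun _ c => decide (ar c = 0)) (h := fun _ c x y z => if c % 5 = 1 then (wft (lb c) (ar c).unpair.1 && wft (lb c) (ar c).unpair.2)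
    else if c % 5 = 2 then (wft (lb c) (ar c).unpair.1 && wft (lb c) (ar c).unpair.2)
    else if c % 5 = 3 then (y && (z && (decide (lb (ar c).unpair.1 = lb c) && decide (lb (ar c).unpair.2 = lb c))))
    else (x && decide (lb (ar c) = lb c + 1))) ?_ ?_
    · exact P_eqb (P_ar Primrec.snd) (Primrec.const 0)
    · have h1 : Primrec fun p : Unit × ℕ × Bool × Bool × Bool => p.2.1 := Primrec.fst.comp Primrec.snd
      have h2 : Primrec fun p : Unit × ℕ × Bool × Bool × Bool => p.2.2.1 := Primrec.fst.comp (Primrec.snd.comp Primrec.snd)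
      have h3 : Primrec fun p : Unit × ℕ × Bool × Bool × Bool => p.2.2.2.1 := Primrec.fst.comp (Primrec.snd.comp (Primrec.snd.comp Primrec.snd))
      have h4 : Primrec fun p : Unit × ℕ × Bool × Bool × Bool => p.2.2.2.2 := Primrec.snd.comp (Primrec.snd.comp (Primrec.snd.comp Primrec.snd))
      have hl := P_lb h1
      have a1 := P_u1 (P_ar h1)
      have a2 := P_u2 (P_ar h1)
      have hw := P_and (P_wft hl a1) (P_wft hl a2)
      exact P_ifm 1 h1 hw (P_ifm 2 h1 hw (P_ifm 3 h1 (P_and h3 (P_and h4 (P_and (P_eqb (P_lb a1) hl) (P_eqb (P_lb a2) hl))))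
        (P_and h2 (P_eqb (P_lb (P_ar h1)) (P_add hl (Primrec.const 1))))))
  exact this.comp (Primrec.const ()) hf

end prim
end

section
open PAM

theorem thy_enum {T : Thy} (h : CompThy T) : ∃ s : ℕ → ℕ → Bool, Primrec₂ s ∧
    ∀ m, (∃ φ ∈ T, gnum φ = m) ↔ ∃ k, s k m = true := by
  obtain ⟨hd, hc⟩ := h
  have h1 : Computable fun m : ℕ => (decide (∃ φ ∈ T, gnum φ = m)).toNat :=
    (Primrec.dom_bool Bool.toNat).to_comp.comp hc
  have h2 := Partrec.nat_iff.1 h1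
  obtain ⟨c, hcode⟩ := Nat.Partrec.Code.exists_code.1 h2
  refine ⟨fun k m => decide (Nat.Partrec.Code.evaln k c m = some 1), ?_, fun m => ?_⟩
  · refine (Primrec.eq.comp (g := fun _ : ℕ × ℕ => some 1) ?_ (Primrec.const _)).decide
    exact Nat.Partrec.Code.primrec_evaln.comp (g := fun p : ℕ × ℕ => ((p.1, c), p.2))
      ((Primrec.fst.pair (Primrec.const c)).pair Primrec.snd)
  · have : (1 ∈ Nat.Partrec.Code.eval c m) ↔ ∃ k, 1 ∈ Nat.Partrec.Code.evaln k c m := Nat.Partrec.Code.evaln_complete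
    simp only [Option.mem_def] at this
    simp only [decide_eq_true_iff]
    rw [← this, hcode]
    by_cases hp : ∃ φ ∈ T, gnum φ = m
    · simp only [hp, true_iff]
      refine Part.mem_some_iff.2 ?_
      show 1 = (decide (∃ φ ∈ T, gnum φ = m)).toNat
      rw [decide_eq_true hp]; rfl
    · simp only [hp, false_iff]
      intro hh
      have : 1 = (decide (∃ φ ∈ T, gnum φ = m)).toNat := Part.mem_some_iff.1 hh
      rw [decide_eq_false hp] at this
      simp at this

theorem gnum_inj {φ ψ : Snt} (h : gnum φ = gnum ψ) : φ = ψ := by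
  have h1 := BoundedFormula.encoding.encode_injective (Encodable.encode_injective h)
  simpa using h1

/-- clause sets -/
def GT (s : ℕ → ℕ → Bool) (c0 a0 i : ℕ) : List (List (ℕ × Bool)) :=
  CL i.unpair.1.unpair.1 i.unpair.1.unpair.2 i.unpair.2.unpair.1 i.unpair.2.unpair.2 ++
  ((if (wff i.unpair.1.unpair.1 && (decide (lb i.unpair.1.unpair.1 = 0) &&
      s i.unpair.1.unpair.2 (Encodable.encode (fenc i.unpair.1.unpair.1)))) = true then
      [ [(Vv i.unpair.1.unpair.1 0, true)] ] else []) ++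
  [ [(Vv c0 a0, false)] ])

theorem GT_mem {s : ℕ → ℕ → Bool} {c0 a0 : ℕ} {w : ℕ → Bool} :
    (∀ i, ∀ C ∈ GT s c0 a0 i, Hl w C) ↔ (∀ n q a x, ∀ C ∈ CL n q a x, Hl w C) ∧
      (∀ φ : Snt, (∃ k, s k (gnum φ) = true) → w (Vv (cd φ) 0) = true) ∧ ¬ w (Vv c0 a0) = true := by
  have one : ∀ v b, (∀ C ∈ [ [((v : ℕ), (b : Bool))] ], Hl w C) ↔ w v = b := by
    intro v b; simp [Hl]
  have split : ∀ i, (∀ C ∈ GT s c0 a0 i, Hl w C) ↔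
      (∀ C ∈ CL i.unpair.1.unpair.1 i.unpair.1.unpair.2 i.unpair.2.unpair.1 i.unpair.2.unpair.2, Hl w C) ∧
      ((wff i.unpair.1.unpair.1 && (decide (lb i.unpair.1.unpair.1 = 0) &&
      s i.unpair.1.unpair.2 (Encodable.encode (fenc i.unpair.1.unpair.1)))) = true → w (Vv i.unpair.1.unpair.1 0) = true) ∧
      ¬ w (Vv c0 a0) = true := by
    intro i
    rw [GT, List.forall_mem_append, List.forall_mem_append, one, Bool.not_eq_true]
    split_ifs with hc
    · rw [one]; simp [hc]
    · simp [hc]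
  simp only [split]
  constructor
  · intro h
    refine ⟨fun n q a x => ?_, fun φ ⟨k, hk⟩ => ?_, (h 0).2.2⟩
    · have := (h (Nat.pair (Nat.pair n q) (Nat.pair a x))).1
      simpa only [Nat.unpair_pair] using this
    · have := (h (Nat.pair (Nat.pair (cd φ) k) 0)).2.1
      simp only [Nat.unpair_pair] at this
      apply this
      rw [wff_cd, lb_cd, ← gnum_eq, hk]; rfl
  · rintro ⟨h1, h2, h3⟩ i
    refine ⟨h1 _ _ _ _, fun h => ?_, h3⟩
    simp only [Bool.and_eq_true, decide_eq_true_iff] at h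
    obtain ⟨φ, hφ⟩ := wff_inv _ _ h.2.1 h.1
    rw [← hφ]
    apply h2 φ
    rw [← hφ, ← gnum_eq] at h
    exact ⟨_, h.2.2⟩

/-- the term model as a model of `PA` -/
def QP {T : Thy} (hT : ExtPA T) {w : ℕ → Bool} (hw : ∀ n q a x, ∀ C ∈ CL n q a x, Hl w C)
    (hmod : @Theory.Model _ (Qm hw) (QmS hw) T) : PAM :=
  letI := QmS hw
  haveI : Nonempty (Qm hw) := ⟨mkQ hw 0⟩
  haveI := hmod
  ⟨Qm hw, ⟨fun φ h => (Theory.models_sentence_iff.1 (hT φ h)) ⟨Qm hw⟩⟩⟩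

theorem qp_spec {T : Thy} (hT : ExtPA T) {w : ℕ → Bool} (hw : ∀ n q a x, ∀ C ∈ CL n q a x, Hl w C)
    (hmod : @Theory.Model _ (Qm hw) (QmS hw) T) : ∃ M : PAM, MT M T ∧ ∃ F : M → Qm hw, (∀ k : ℕ, F (k : M) = mkQ hw (nm k)) ∧
      ∀ {n : ℕ} {χ : LA.BoundedFormula Empty n} (v : Fin n → M), χ.Realize default v ↔
        @BoundedFormula.Realize _ _ (QmS hw) _ _ χ default (fun i => F (v i)) := by
  refine ⟨QP hT hw hmod, fun φ h => hmod.realize_of_mem φ h, fun x => x, fun k => ?_, fun v => Iff.rfl⟩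
  induction k with
  | zero => exact (opZ_cast (M := QP hT hw hmod)).symm
  | succ k ih =>
    have h1 := opS_cast (M := QP hT hw hmod) k
    rw [← h1]
    exact congrArg (fun x : (QP hT hw hmod).car => opS x) ih

theorem bad_iff {T : Thy} {s : ℕ → ℕ → Bool} (hs : ∀ m, (∃ φ ∈ T, gnum φ = m) ↔ ∃ k, s k m = true)
    (hT : ExtPA T) (χ : LA.BoundedFormula Empty 3) (e e' f : ℕ) :
    (∃ B, Bad (GT s (cd χ) (Nat.pair (Nat.pair (Nat.pair 0 (nm e)) (nm e')) (nm f))) B) ↔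
    ∀ M : PAM, MT M T → χ.Realize default ![(e : M), (e' : M), (f : M)] := by
  set a0 := (Nat.pair (Nat.pair (Nat.pair 0 (nm e)) (nm e')) (nm f)) with ha0
  have hT' : ∀ φ : Snt, (∃ k, s k (gnum φ) = true) ↔ φ ∈ T := by
    intro φ; rw [← hs]
    exact ⟨fun ⟨ψ, h1, h2⟩ => gnum_inj h2 ▸ h1, fun h => ⟨φ, h, rfl⟩⟩
  have l0 : look 0 a0 = nm f := look_zero _ _
  have l1 : look 1 a0 = nm e' := by rw [ha0, look_succ, look_zero]
  have l2 : look 2 a0 = nm e := by rw [ha0, look_succ, look_succ, look_zero]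
  constructor
  · rintro ⟨B, hB⟩ M hM
    by_contra hn
    refine bad_sound hB (wv M) (GT_mem.2 ⟨wv_sound M, fun φ hφ => ?_, fun hh => hn ?_⟩)
    · rw [wv_V, SC_cd]
      exact (sat_def _).1 (hM φ ((hT' φ).1 hφ))
    · rw [wv_V, SC_cd] at hh
      convert hh using 1
      funext i
      fin_cases i
      · exact (congrArg (val M) l2).trans (val_nm M e) |>.symm
      · exact (congrArg (val M) l1).trans (val_nm M e') |>.symm
      · exact (congrArg (val M) l0).trans (val_nm M f) |>.symm
  · intro h
    by_contra hn
    push Not at hn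
    obtain ⟨w, hw0⟩ := bad_complete hn
    obtain ⟨hw, hw1, hw2⟩ := GT_mem.1 hw0
    have hmod : @Theory.Model _ (Qm hw) (QmS hw) T := letI := QmS hw; ⟨fun φ hφ => by
      have := (qm_real hw φ 0).1 (hw1 φ ((hT' φ).2 hφ))
      rw [Subsingleton.elim (fun i : Fin 0 => mkQ hw (look (0 - 1 - i) 0)) default] at this
      exact this⟩
    obtain ⟨M, hM, F, hnm, hχ⟩ := qp_spec hT hw hmod
    refine hw2 ((qm_real hw χ a0).2 ?_)
    have := (hχ _).1 (h M hM)
    convert this using 1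
    funext i
    fin_cases i
    · exact (congrArg (mkQ hw) l2).trans (hnm e).symm
    · exact (congrArg (mkQ hw) l1).trans (hnm e').symm
    · exact (congrArg (mkQ hw) l0).trans (hnm f).symm

theorem bad_prim {s : ℕ → ℕ → Bool} (hs : Primrec₂ s) (c0 : ℕ) :
    PrimrecRel fun a0 B : ℕ => Bad (GT s c0 a0) B := by
  have r1 : PrimrecRel fun (l : ℕ × Bool) (p : ℕ × ℕ) => l.1 < p.1 ∧ p.2.testBit l.1 ≠ l.2 := by
    have t1 : Primrec fun q : (ℕ × Bool) × (ℕ × ℕ) => q.1.1 := Primrec.fst.comp Primrec.fst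
    have t2 : Primrec fun q : (ℕ × Bool) × (ℕ × ℕ) => q.1.2 := Primrec.snd.comp Primrec.fst
    have t3 : Primrec fun q : (ℕ × Bool) × (ℕ × ℕ) => q.2.1 := Primrec.fst.comp Primrec.snd
    have t4 : Primrec fun q : (ℕ × Bool) × (ℕ × ℕ) => q.2.2 := Primrec.snd.comp Primrec.snd
    have tb : Primrec fun q : (ℕ × Bool) × (ℕ × ℕ) => q.2.2.testBit q.1.1 := by
      refine (P_eqb (P_mod (P_div t4 (P_pow2 t1)) (Primrec.const 2)) (Primrec.const 1)).of_eq fun q => ?_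
      rw [Nat.testBit_eq_decide_div_mod_eq]
    exact (Primrec.nat_lt.comp t1 t3).and (Primrec.eq.comp tb t2).not
  have r3 := r1.forall_mem_list.exists_mem_list
  have hG : Primrec fun q : ℕ × ((ℕ × ℕ) × ℕ) => GT s c0 q.2.1.1 q.1 := by
    have t1 : Primrec fun q : ℕ × ((ℕ × ℕ) × ℕ) => q.1 := Primrec.fst
    have t2 : Primrec fun q : ℕ × ((ℕ × ℕ) × ℕ) => q.2.1.1 := Primrec.fst.comp (Primrec.fst.comp Primrec.snd)
    have a1 := P_u1 (P_u1 t1)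
    have a2 := P_u2 (P_u1 t1)
    refine P_app (P_CL a1 a2 (P_u1 (P_u2 t1)) (P_u2 (P_u2 t1))) (P_app (P_ifb ?_ ?_ (Primrec.const [])) ?_)
    · exact P_and (P_wff a1) (P_and (P_eqb (P_lb a1) (Primrec.const 0)) (hs.comp a2 (Primrec.encode.comp (P_fenc a1))))
    · exact P_cons (P_cons ((P_Vv a1 (Primrec.const 0)).pair (Primrec.const true)) (Primrec.const [])) (Primrec.const [])
    · exact P_cons (P_cons ((P_Vv (Primrec.const c0) t2).pair (Primrec.const false)) (Primrec.const [])) (Primrec.const [])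
  have r4 : PrimrecRel fun (i : ℕ) (q : (ℕ × ℕ) × ℕ) => ∃ C ∈ GT s c0 q.1.1 i, ∀ l ∈ C, l.1 < q.1.2 ∧ q.2.testBit l.1 ≠ l.2 :=
    r3.comp hG (g := fun q : ℕ × ((ℕ × ℕ) × ℕ) => (q.2.1.2, q.2.2))
      ((Primrec.snd.comp (Primrec.fst.comp Primrec.snd)).pair (Primrec.snd.comp Primrec.snd))
  have r5 : PrimrecRel fun (v : ℕ) (q : ℕ × ℕ) => ∃ i ∈ List.range q.2, ∃ C ∈ GT s c0 q.1 i, ∀ l ∈ C, l.1 < q.2 ∧ v.testBit l.1 ≠ l.2 :=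
    r4.exists_mem_list.comp (f := fun q : ℕ × (ℕ × ℕ) => List.range q.2.2) (Primrec.list_range.comp (Primrec.snd.comp Primrec.snd))
      (g := fun q : ℕ × (ℕ × ℕ) => (q.2, q.1)) (Primrec.snd.pair Primrec.fst)
  have r6 : PrimrecRel fun (a0 B : ℕ) => ∀ v ∈ List.range (2 ^ B), ∃ i ∈ List.range B, ∃ C ∈ GT s c0 a0 i, ∀ l ∈ C, l.1 < B ∧ v.testBit l.1 ≠ l.2 :=
    r5.forall_mem_list.comp (f := fun q : ℕ × ℕ => List.range (2 ^ q.2)) (Primrec.list_range.comp (P_pow2 Primrec.snd))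
      (g := fun q : ℕ × ℕ => q) Primrec.id
  refine r6.of_eq fun a0 B => ?_
  simp only [List.mem_range, Bad]

theorem prov_re {T : Thy} (hc : CompThy T) (hT : ExtPA T) (χ : LA.BoundedFormula Empty 3) :
    ∃ g : ℕ → ℕ, Nat.Primrec g ∧ ∀ e e' f : ℕ, (∃ B, g (Nat.pair (Nat.pair e (Nat.pair e' f)) B) = 1) ↔
      ∀ M : PAM, MT M T → χ.Realize default ![(e : M), (e' : M), (f : M)] := by
  classical
  obtain ⟨s, hs, hs2⟩ := thy_enum hc
  have hb := (bad_prim hs (cd χ)).decide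
  refine ⟨fun x => (decide (Bad (GT s (cd χ) (Nat.pair (Nat.pair (Nat.pair 0 (nm x.unpair.1.unpair.1))
    (nm x.unpair.1.unpair.2.unpair.1)) (nm x.unpair.1.unpair.2.unpair.2))) x.unpair.2)).toNat, ?_, ?_⟩
  · rw [← Primrec.nat_iff]
    have t : Primrec fun x : ℕ => x := Primrec.id
    refine (Primrec.dom_bool Bool.toNat).comp (hb.comp ?_ (P_u2 t))
    exact P_pair (P_pair (P_pair (Primrec.const 0) (P_nm (P_u1 (P_u1 t)))) (P_nm (P_u1 (P_u2 (P_u1 t))))) (P_nm (P_u2 (P_u2 (P_u1 t))))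
  · intro e e' f
    rw [← bad_iff hs2 hT χ e e' f]
    simp

end

section
open PAM

/-- Relations on the naturals which are uniformly `Σ_1` definable over the standard model. -/
def S1 {k : ℕ} (P : (Fin k → ℕ) → Prop) : Prop :=
  ∃ R : ∀ M : PAM, (Fin k → M) → Prop, Sg 1 R ∧ ∀ v : Fin k → ℕ, R NN (fun i => (v i : NN)) ↔ P v

theorem S1.congr {k : ℕ} {P Q : (Fin k → ℕ) → Prop} (h : S1 P) (h' : ∀ v, Q v ↔ P v) : S1 Q := by
  obtain ⟨R, h1, h2⟩ := h
  exact ⟨R, h1, fun v => (h2 v).trans (h' v).symm⟩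
theorem S1.d0 {k : ℕ} {P : (Fin k → ℕ) → Prop} {R : ∀ M : PAM, (Fin k → M) → Prop} (h : D0 R)
    (h' : ∀ v : Fin k → ℕ, R NN (fun i => (v i : NN)) ↔ P v) : S1 P := ⟨R, h.sg, h'⟩
theorem S1.and {k : ℕ} {P Q : (Fin k → ℕ) → Prop} (h : S1 P) (h' : S1 Q) : S1 fun v => P v ∧ Q v := by
  obtain ⟨R, h1, h2⟩ := h
  obtain ⟨R', h1', h2'⟩ := h'
  exact ⟨_, h1.and h1', fun v => and_congr (h2 v) (h2' v)⟩
theorem S1.or {k : ℕ} {P Q : (Fin k → ℕ) → Prop} (h : S1 P) (h' : S1 Q) : S1 fun v => P v ∨ Q v := by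
  obtain ⟨R, h1, h2⟩ := h
  obtain ⟨R', h1', h2'⟩ := h'
  exact ⟨_, h1.or h1', fun v => or_congr (h2 v) (h2' v)⟩
theorem S1.comp {k m : ℕ} {P : (Fin m → ℕ) → Prop} (h : S1 P) (f : Fin m → Fin k) :
    S1 fun v : Fin k → ℕ => P (fun i => v (f i)) := by
  obtain ⟨R, h1, h2⟩ := h
  exact ⟨_, h1.subst (f := fun i M v => v (f i)) (fun i => Tt.var _), fun v => h2 _⟩
theorem S1.ex {k : ℕ} {Q : (Fin k → ℕ) → ℕ → Prop}
    (h : S1 (fun w : Fin (k+1) → ℕ => Q (fun i => w i.castSucc) (w (Fin.last k)))) :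
    S1 fun v => ∃ x, Q v x := by
  obtain ⟨R, h1, h2⟩ := h
  refine ⟨fun M v => ∃ x, R M (Fin.snoc v x), Sg.ex (Sg.congr h1 fun M w => ?_), fun v => ?_⟩
  · rw [← Fin.snoc_init_self w]
    simp only [Fin.snoc_castSucc, Fin.snoc_last]
  · have key : ∀ x : ℕ, R NN (Fin.snoc (fun i => (v i : NN)) (x : NN)) ↔ Q v x := by
      intro x
      have := h2 (Fin.snoc v x)
      simp only [Fin.snoc_castSucc, Fin.snoc_last] at this
      rw [← this]
      refine iff_of_eq (congrArg _ ?_)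
      funext i
      refine Fin.lastCases ?_ (fun i => ?_) i <;> simp
    constructor
    · rintro ⟨x, hx⟩
      obtain ⟨m, rfl⟩ := NN_cast x
      exact ⟨m, (key m).1 hx⟩
    · rintro ⟨x, hx⟩
      exact ⟨x, (key x).2 hx⟩
theorem S1.ball {k : ℕ} (j : Fin k) {Q : (Fin k → ℕ) → ℕ → Prop}
    (h : S1 (fun w : Fin (k+1) → ℕ => Q (fun i => w i.castSucc) (w (Fin.last k)))) :
    S1 fun v => ∀ x, x < v j → Q v x := by
  obtain ⟨R, h1, h2⟩ := h
  refine ⟨fun M v => ∀ x, x ≤ v j → ¬ x < v j ∨ R M (Fin.snoc v x),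
    (cl 1).ball (Q := fun M v x => ¬ x < v j ∨ R M (Fin.snoc v x)) (Tt.var _)
      (Sg.or (D0.sg (D0.not (D0.lt (Tt.var _) (Tt.var _)))) (Sg.congr h1 fun M w => ?_)), fun v => ?_⟩
  · rw [← Fin.snoc_init_self w]
    simp only [Fin.snoc_castSucc, Fin.snoc_last]
  · have key : ∀ x : ℕ, R NN (Fin.snoc (fun i => (v i : NN)) (x : NN)) ↔ Q v x := by
      intro x
      have := h2 (Fin.snoc v x)
      simp only [Fin.snoc_castSucc, Fin.snoc_last] at this
      rw [← this]
      refine iff_of_eq (congrArg _ ?_)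
      funext i
      refine Fin.lastCases ?_ (fun i => ?_) i <;> simp
    dsimp only
    constructor
    · intro hh x hx
      rcases hh x (by exact_mod_cast hx.le) with h | h
      · exact absurd (by exact_mod_cast hx) h
      · exact (key x).1 h
    · intro hh x hx
      obtain ⟨m, rfl⟩ := NN_cast x
      by_cases hm : m < v j
      · exact Or.inr ((key m).2 (hh m hm))
      · left; intro h'; exact hm (by exact_mod_cast h')

theorem S1.rel2 {P : ℕ → ℕ → Prop} (h : S1 fun v : Fin 2 → ℕ => P (v 0) (v 1)) {k : ℕ} (i j : Fin k) :
    S1 fun v : Fin k → ℕ => P (v i) (v j) := h.comp ![i, j]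
theorem S1.rel3 {P : ℕ → ℕ → ℕ → Prop} (h : S1 fun v : Fin 3 → ℕ => P (v 0) (v 1) (v 2)) {k : ℕ} (i j l : Fin k) :
    S1 fun v : Fin k → ℕ => P (v i) (v j) (v l) := h.comp ![i, j, l]
theorem S1.rel4 {P : ℕ → ℕ → ℕ → ℕ → Prop} (h : S1 fun v : Fin 4 → ℕ => P (v 0) (v 1) (v 2) (v 3)) {k : ℕ}
    (i j l m : Fin k) :
    S1 fun v : Fin k → ℕ => P (v i) (v j) (v l) (v m) := h.comp ![i, j, l, m]

theorem S1_pair {k : ℕ} (i j l : Fin k) : S1 fun v : Fin k → ℕ => Nat.pair (v i) (v j) = v l := by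
  refine S1.d0 (R := fun M v => (v i < v j ∧ v j * v j + v i = v l) ∨ (v j ≤ v i ∧ v i * v i + v i + v j = v l)) ?_ ?_
  · repeat' first | apply D0.lt | apply D0.and | apply D0.or | apply D0.eq | apply D0.le | apply Tt.var | apply Tt.add | apply Tt.mul
  · intro v
    simp only [Nat.pair]
    norm_cast
    split_ifs with h
    · simp [h, not_le.2 h]
    · simp [h, not_lt.1 h]
theorem S1_succ {k : ℕ} (i j : Fin k) : S1 fun v : Fin k → ℕ => v i + 1 = v j := by
  refine S1.d0 (R := fun M v => v i + 1 = v j) ?_ ?_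
  · repeat' first | apply D0.eq | apply Tt.var | apply Tt.add | apply Tt.one
  · intro v
    dsimp only
    norm_cast
theorem S1_zero {k : ℕ} (i : Fin k) : S1 fun v : Fin k → ℕ => 0 = v i := by
  refine S1.d0 (R := fun M v => 0 = v i) ?_ ?_
  · repeat' first | apply D0.eq | apply Tt.var | apply Tt.zero
  · intro v
    dsimp only
    norm_cast
theorem S1_one {k : ℕ} (i : Fin k) : S1 fun v : Fin k → ℕ => v i = 1 := by
  refine S1.d0 (R := fun M v => v i = 1) ?_ ?_
  · repeat' first | apply D0.eq | apply Tt.var | apply Tt.one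
  · intro v
    dsimp only
    norm_cast
theorem S1_beta {k : ℕ} (a d i u : Fin k) :
    S1 fun v : Fin k → ℕ => v a % ((v i + 1) * v d + 1) = v u := by
  refine S1.congr (S1.ex (Q := fun v q => v u < (v i + 1) * v d + 1 ∧ v a = q * ((v i + 1) * v d + 1) + v u) ?_) ?_
  · refine S1.d0 (R := fun M w => w u.castSucc < (w i.castSucc + 1) * w d.castSucc + 1 ∧
      w a.castSucc = w (Fin.last k) * ((w i.castSucc + 1) * w d.castSucc + 1) + w u.castSucc) ?_ ?_
    · repeat' first | apply D0.lt | apply D0.and | apply D0.eq | apply Tt.var | apply Tt.add | apply Tt.mul | apply Tt.one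
    · intro v
      dsimp only
      norm_cast
  · intro v
    constructor
    · intro h
      refine ⟨v a / ((v i + 1) * v d + 1), ?_, ?_⟩
      · rw [← h]; exact Nat.mod_lt _ (Nat.succ_pos _)
      · rw [← h]; exact (Nat.div_add_mod' _ _).symm
    · rintro ⟨q, h1, h2⟩
      rw [h2, Nat.mul_add_mod_self_right, Nat.mod_eq_of_lt h1]

theorem beta_ex (n : ℕ) (F : ℕ → ℕ) : ∃ a d : ℕ, ∀ i ≤ n, a % ((i + 1) * d + 1) = F i := by
  set l := (List.range (n+1)).map F with hl
  refine ⟨(Nat.unbeta l).unpair.1, (Nat.unbeta l).unpair.2, fun i hi => ?_⟩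
  have hlen : i < l.length := by simp [hl]; omega
  have := Nat.beta_unbeta_coe l ⟨i, hlen⟩
  simp only [Nat.beta] at this
  rw [this]
  simp [hl]

theorem primrec_S1 {f : ℕ → ℕ} (hf : Nat.Primrec f) : S1 fun v : Fin 2 → ℕ => f (v 0) = v 1 := by
  induction hf with
  | zero => exact S1_zero _
  | succ => exact S1_succ _ _
  | left =>
    refine S1.congr (S1.ex (Q := fun v x => Nat.pair (v 1) x = v 0) (S1_pair _ _ _)) fun v => ?_
    constructor
    · intro h; exact ⟨(v 0).unpair.2, by rw [← h, Nat.pair_unpair]⟩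
    · rintro ⟨x, h⟩; rw [← h]; simp only [Nat.unpair_pair]
  | right =>
    refine S1.congr (S1.ex (Q := fun v x => Nat.pair x (v 1) = v 0) (S1_pair _ _ _)) fun v => ?_
    constructor
    · intro h; exact ⟨(v 0).unpair.1, by rw [← h, Nat.pair_unpair]⟩
    · rintro ⟨x, h⟩; rw [← h]; simp only [Nat.unpair_pair]
  | @pair f g _ _ hf hg =>
    refine S1.congr (S1.ex (Q := fun v x => ∃ y, f (v 0) = x ∧ g (v 0) = y ∧ Nat.pair x y = v 1)
      (S1.ex (Q := fun w y => f (w 0) = w 2 ∧ g (w 0) = y ∧ Nat.pair (w 2) y = w 1) ?_)) fun v => ?_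
    · exact S1.and (hf.rel2 (P := fun a b => f a = b) _ _)
        (S1.and (hg.rel2 (P := fun a b => g a = b) _ _) (S1_pair _ _ _))
    · simp
  | @comp f g _ _ hf hg =>
    refine S1.congr (S1.ex (Q := fun v x => g (v 0) = x ∧ f x = v 1) ?_) fun v => ?_
    · exact S1.and (hg.rel2 (P := fun a b => g a = b) _ _) (hf.rel2 (P := fun a b => f a = b) _ _)
    · simp
  | @prec f g _ _ hf hg =>
    -- variables: p y z n a d
    have hf' := fun {k : ℕ} (i j : Fin k) => hf.rel2 (P := fun a b => f a = b) i j
    have hg' := fun {k : ℕ} (i j : Fin k) => hg.rel2 (P := fun a b => g a = b) i j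
    have h0 : ∀ {k : ℕ} (z a d : Fin k), S1 fun v : Fin k → ℕ =>
        ∃ o u, 0 = o ∧ v a % ((o + 1) * v d + 1) = u ∧ f (v z) = u := by
      intro k z a d
      refine S1.ex (Q := fun v o => ∃ u, 0 = o ∧ v a % ((o + 1) * v d + 1) = u ∧ f (v z) = u) ?_
      refine S1.ex (Q := fun w u => 0 = w (Fin.last k) ∧ w a.castSucc % ((w (Fin.last k) + 1) * w d.castSucc + 1) = u ∧ f (w z.castSucc) = u) ?_
      exact S1.and (S1_zero _) (S1.and (S1_beta _ _ _ _) (hf' _ _))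
    have h1 : S1 fun v : Fin 4 → ℕ => ∃ j u w s t,
        v 3 + 1 = j ∧ v 1 % ((v 3 + 1) * v 2 + 1) = u ∧ v 1 % ((j + 1) * v 2 + 1) = w ∧
        Nat.pair (v 3) u = s ∧ Nat.pair (v 0) s = t ∧ g t = w := by
      refine S1.ex (Q := fun v j => ∃ u w s t,
        v 3 + 1 = j ∧ v 1 % ((v 3 + 1) * v 2 + 1) = u ∧ v 1 % ((j + 1) * v 2 + 1) = w ∧
        Nat.pair (v 3) u = s ∧ Nat.pair (v 0) s = t ∧ g t = w) ?_
      refine S1.ex (Q := fun (v : Fin 5 → ℕ) u => ∃ w s t,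
        v 3 + 1 = v 4 ∧ v 1 % ((v 3 + 1) * v 2 + 1) = u ∧ v 1 % ((v 4 + 1) * v 2 + 1) = w ∧
        Nat.pair (v 3) u = s ∧ Nat.pair (v 0) s = t ∧ g t = w) ?_
      refine S1.ex (Q := fun (v : Fin 6 → ℕ) w => ∃ s t,
        v 3 + 1 = v 4 ∧ v 1 % ((v 3 + 1) * v 2 + 1) = v 5 ∧ v 1 % ((v 4 + 1) * v 2 + 1) = w ∧
        Nat.pair (v 3) (v 5) = s ∧ Nat.pair (v 0) s = t ∧ g t = w) ?_
      refine S1.ex (Q := fun (v : Fin 7 → ℕ) s => ∃ t,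
        v 3 + 1 = v 4 ∧ v 1 % ((v 3 + 1) * v 2 + 1) = v 5 ∧ v 1 % ((v 4 + 1) * v 2 + 1) = v 6 ∧
        Nat.pair (v 3) (v 5) = s ∧ Nat.pair (v 0) s = t ∧ g t = v 6) ?_
      refine S1.ex (Q := fun (v : Fin 8 → ℕ) t => 
        v 3 + 1 = v 4 ∧ v 1 % ((v 3 + 1) * v 2 + 1) = v 5 ∧ v 1 % ((v 4 + 1) * v 2 + 1) = v 6 ∧
        Nat.pair (v 3) (v 5) = v 7 ∧ Nat.pair (v 0) (v 7) = t ∧ g t = v 6) ?_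
      exact S1.and (S1_succ _ _) (S1.and (S1_beta _ _ _ _) (S1.and (S1_beta _ _ _ _) (S1.and (S1_pair _ _ _)
        (S1.and (S1_pair _ _ _) (hg' _ _)))))
    have h2 : S1 fun v : Fin 4 → ℕ => v 1 % ((v 3 + 1 + 1) * v 2 + 1) =
        g (Nat.pair (v 0) (Nat.pair (v 3) (v 1 % ((v 3 + 1) * v 2 + 1)))) := by
      refine h1.congr fun v => ?_
      constructor
      · intro h; exact ⟨_, _, _, _, _, rfl, rfl, rfl, rfl, rfl, h.symm⟩
      · rintro ⟨_, _, _, _, _, rfl, rfl, rfl, rfl, rfl, h⟩; exact h.symm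
    have h2' := fun {k : ℕ} (i j l m : Fin k) => h2.rel4 (P := fun z a d i => a % ((i + 1 + 1) * d + 1) =
        g (Nat.pair z (Nat.pair i (a % ((i + 1) * d + 1))))) i j l m
    have h3 : S1 fun v : Fin 2 → ℕ => ∃ z n a d, Nat.pair z n = v 0 ∧ (∃ o u, 0 = o ∧ a % ((o + 1) * d + 1) = u ∧ f z = u) ∧
        (∀ i, i < n → a % ((i + 1 + 1) * d + 1) = g (Nat.pair z (Nat.pair i (a % ((i + 1) * d + 1))))) ∧
        a % ((n + 1) * d + 1) = v 1 := by
      refine S1.ex (Q := fun (v : Fin 2 → ℕ) z => ∃ n a d, Nat.pair z n = v 0 ∧ (∃ o u, 0 = o ∧ a % ((o + 1) * d + 1) = u ∧ f z = u) ∧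
        (∀ i, i < n → a % ((i + 1 + 1) * d + 1) = g (Nat.pair z (Nat.pair i (a % ((i + 1) * d + 1))))) ∧
        a % ((n + 1) * d + 1) = v 1) ?_
      refine S1.ex (Q := fun (v : Fin 3 → ℕ) n => ∃ a d, Nat.pair (v 2) n = v 0 ∧ (∃ o u, 0 = o ∧ a % ((o + 1) * d + 1) = u ∧ f (v 2) = u) ∧
        (∀ i, i < n → a % ((i + 1 + 1) * d + 1) = g (Nat.pair (v 2) (Nat.pair i (a % ((i + 1) * d + 1))))) ∧
        a % ((n + 1) * d + 1) = v 1) ?_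
      refine S1.ex (Q := fun (v : Fin 4 → ℕ) a => ∃ d, Nat.pair (v 2) (v 3) = v 0 ∧ (∃ o u, 0 = o ∧ a % ((o + 1) * d + 1) = u ∧ f (v 2) = u) ∧
        (∀ i, i < v 3 → a % ((i + 1 + 1) * d + 1) = g (Nat.pair (v 2) (Nat.pair i (a % ((i + 1) * d + 1))))) ∧
        a % ((v 3 + 1) * d + 1) = v 1) ?_
      refine S1.ex (Q := fun (v : Fin 5 → ℕ) d => Nat.pair (v 2) (v 3) = v 0 ∧ (∃ o u, 0 = o ∧ v 4 % ((o + 1) * d + 1) = u ∧ f (v 2) = u) ∧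
        (∀ i, i < v 3 → v 4 % ((i + 1 + 1) * d + 1) = g (Nat.pair (v 2) (Nat.pair i (v 4 % ((i + 1) * d + 1))))) ∧
        v 4 % ((v 3 + 1) * d + 1) = v 1) ?_
      refine S1.and (S1_pair _ _ _) (S1.and (h0 _ _ _) (S1.and ?_ (S1_beta _ _ _ _)))
      refine S1.ball (k := 6) 3 (Q := fun v i => v 4 % ((i + 1 + 1) * v 5 + 1) = g (Nat.pair (v 2) (Nat.pair i (v 4 % ((i + 1) * v 5 + 1))))) ?_
      exact h2' _ _ _ _
    refine h3.congr fun v => ?_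
    have hu : ∀ (z n a d : ℕ), a % ((0 + 1) * d + 1) = f z →
        (∀ i, i < n → a % ((i + 1 + 1) * d + 1) = g (Nat.pair z (Nat.pair i (a % ((i + 1) * d + 1))))) →
        ∀ i, i ≤ n → a % ((i + 1) * d + 1) = Nat.rec (f z) (fun y IH => g (Nat.pair z (Nat.pair y IH))) i := by
      intro z n a d h4 h5 i
      induction i with
      | zero => exact fun _ => h4
      | succ i ih =>
        intro hi
        rw [h5 i hi, ih (by omega)]
    constructor
    · intro h
      obtain ⟨a, d, had⟩ := beta_ex (v 0).unpair.2 (fun i => Nat.rec (f (v 0).unpair.1) (fun y IH => g (Nat.pair (v 0).unpair.1 (Nat.pair y IH))) i)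
      refine ⟨_, _, a, d, Nat.pair_unpair _, ⟨0, _, rfl, rfl, (had 0 (Nat.zero_le _)).symm⟩, ?_, ?_⟩
      · intro i hi
        rw [had i hi.le, had (i+1) hi]
      · rw [had _ le_rfl]; exact h
    · rintro ⟨z, n, a, d, h4, ⟨_, _, rfl, rfl, h5⟩, h6, h7⟩
      have := hu z n a d h5.symm h6 n le_rfl
      rw [← h4, ← h7, this]
      simp [Nat.unpaired]

/-- Provability of instances of a formula is `Σ_1` over the standard model. -/
theorem prov_S1 {T : Thy} (hc : CompThy T) (hT : ExtPA T) (χ : LA.BoundedFormula Empty 3) :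
    S1 fun v : Fin 3 → ℕ => ∀ M : PAM, MT M T → χ.Realize default ![(v 0 : M), (v 1 : M), (v 2 : M)] := by
  obtain ⟨g, hg, h⟩ := prov_re hc hT χ
  have hg' := fun {k : ℕ} (i j : Fin k) => (primrec_S1 hg).rel2 (P := fun a b => g a = b) i j
  have : S1 fun v : Fin 3 → ℕ => ∃ B a b c d, Nat.pair (v 1) (v 2) = a ∧ Nat.pair (v 0) a = b ∧ Nat.pair b B = c ∧
      g c = d ∧ d = 1 := by
    refine S1.ex (Q := fun (v : Fin 3 → ℕ) B => ∃ a b c d, Nat.pair (v 1) (v 2) = a ∧ Nat.pair (v 0) a = b ∧ Nat.pair b B = c ∧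
      g c = d ∧ d = 1) ?_
    refine S1.ex (Q := fun (v : Fin 4 → ℕ) a => ∃ b c d, Nat.pair (v 1) (v 2) = a ∧ Nat.pair (v 0) a = b ∧ Nat.pair b (v 3) = c ∧
      g c = d ∧ d = 1) ?_
    refine S1.ex (Q := fun (v : Fin 5 → ℕ) b => ∃ c d, Nat.pair (v 1) (v 2) = v 4 ∧ Nat.pair (v 0) (v 4) = b ∧ Nat.pair b (v 3) = c ∧
      g c = d ∧ d = 1) ?_
    refine S1.ex (Q := fun (v : Fin 6 → ℕ) c => ∃ d, Nat.pair (v 1) (v 2) = v 4 ∧ Nat.pair (v 0) (v 4) = v 5 ∧ Nat.pair (v 5) (v 3) = c ∧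
      g c = d ∧ d = 1) ?_
    refine S1.ex (Q := fun (v : Fin 7 → ℕ) d => Nat.pair (v 1) (v 2) = v 4 ∧ Nat.pair (v 0) (v 4) = v 5 ∧ Nat.pair (v 5) (v 3) = v 6 ∧
      g (v 6) = d ∧ d = 1) ?_
    exact S1.and (S1_pair _ _ _) (S1.and (S1_pair _ _ _) (S1.and (S1_pair _ _ _) (S1.and (hg' _ _) (S1_one _))))
  refine this.congr fun v => ?_
  rw [← h]
  constructor
  · rintro ⟨B, hB⟩; exact ⟨B, _, _, _, _, rfl, rfl, rfl, rfl, hB⟩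
  · rintro ⟨B, _, _, _, _, rfl, rfl, rfl, rfl, hB⟩; exact ⟨B, hB⟩

end

section
open PAM

/-- The self-reference lemma: a bounded matrix enumerating every r.e. relation, with its own index. -/
theorem selfref : ∃ H : ∀ M : PAM, (Fin 3 → M) → M → Prop,
    D0 (fun M (w : Fin 4 → M) => H M (fun i => w i.castSucc) (w (Fin.last 3))) ∧
    ∀ p : ℕ → ℕ → ℕ → Prop, S1 (fun v : Fin 3 → ℕ => p (v 0) (v 1) (v 2)) →
      ∃ f : ℕ, ∀ e e' : ℕ, (∃ w, H NN ![(f : NN), (e : NN), (e' : NN)] w) ↔ p f e e' := by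
  have : Sg 1 (fun M (v : Fin 3 → M) => UN 0 M (v 0) (pr (v 0) (pr (v 1) (v 2)))) := by
    refine Sg.subst (m := 2) (UN_sg 0) (f := ![fun M v => v 0, fun M v => pr (v 0) (pr (v 1) (v 2))]) fun i => ?_
    fin_cases i
    · exact Tt.var _
    · exact Tt.pr (Tt.var _) (Tt.pr (Tt.var _) (Tt.var _))
  obtain ⟨H, hH, e⟩ := this.elim
  refine ⟨H, D0.congr (D0.not hH) (fun M v => not_not.symm), fun p hp => ?_⟩
  obtain ⟨R, hR, hR'⟩ := hp
  have h1 : Sg 1 (fun M (v : Fin 1 → M) => ∃ a b c, v 0 = pr a (pr b c) ∧ R M ![a, b, c]) := by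
    refine Sg.ex (Q := fun M (v : Fin 1 → M) a => ∃ b c, v 0 = pr a (pr b c) ∧ R M ![a, b, c]) ?_
    refine Sg.ex (Q := fun M (v : Fin 2 → M) b => ∃ c, v 0 = pr (v 1) (pr b c) ∧ R M ![v 1, b, c]) ?_
    refine Sg.ex (Q := fun M (v : Fin 3 → M) c => v 0 = pr (v 1) (pr (v 2) c) ∧ R M ![v 1, v 2, c]) ?_
    refine Sg.and (D0.sg (D0.eq (Tt.var _) (Tt.pr (Tt.var _) (Tt.pr (Tt.var _) (Tt.var _))))) ?_
    refine Sg.congr (Sg.subst hR (k := 4) (f := ![fun M v => v 1, fun M v => v 2, fun M v => v 3]) fun i => ?_) ?_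
    · fin_cases i <;> exact Tt.var _
    · intro M v
      refine iff_of_eq (congrArg _ ?_)
      funext i; fin_cases i <;> rfl
  obtain ⟨f, hf⟩ := UN_univ 0 h1
  refine ⟨f, fun e1 e2 => ?_⟩
  have h2 := congrFun (congrFun e NN) ![(f : NN), (e1 : NN), (e2 : NN)]
  rw [← iff_of_eq h2]
  show UN 0 NN (f : NN) (pr (f : NN) (pr (e1 : NN) (e2 : NN))) ↔ _
  rw [hf]
  refine Iff.trans ?_ (hR' ![f, e1, e2])
  have h3 : (fun i => ((![f, e1, e2] i : ℕ) : NN)) = ![(f : NN), (e1 : NN), (e2 : NN)] := by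
    funext i; fin_cases i <;> rfl
  rw [h3]
  constructor
  · rintro ⟨a, b, c, h, h'⟩
    obtain ⟨h4, h5⟩ := pr_inj h
    obtain ⟨h5, h6⟩ := pr_inj h5
    rw [h4, h5, h6]; exact h'
  · intro h
    exact ⟨_, _, _, rfl, h⟩

section
variable (A : ∀ M : PAM, (Fin 1 → M) → M → Prop) (H : ∀ M : PAM, (Fin 3 → M) → M → Prop)

/-- Truth of the `e`th sentence. -/
def Tru (M : PAM) (e : M) : Prop := ∃ x, A M (fun _ => e) x
/-- `e` is witnessed no later than `d`. -/
def WLE (M : PAM) (e d : M) : Prop := ∃ x, A M (fun _ => e) x ∧ ∀ y, y < x → ¬ A M (fun _ => d) y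
/-- `d` is witnessed strictly before `e`. -/
def WLT (M : PAM) (d e : M) : Prop := ∃ x, A M (fun _ => d) x ∧ ∀ y, y ≤ x → ¬ A M (fun _ => e) y
/-- at stage `z` the pair `e, d` is enumerated. -/
def Ev (M : PAM) (f z e d : M) : Prop := ∃ w, w ≤ z ∧ (z = pr (pr e d) w ∧ H M ![f, e, d] w)
/-- the sentence `φ`. -/
def Ph (M : PAM) (f : M) : Prop := ∃ z, (∃ e, e ≤ z ∧ ∃ d, d ≤ z ∧ (Ev H M f z (e+1) d ∧ WLT A M d e)) ∧
  ∀ z', z' < z → ∀ d, d ≤ z' → ¬ Ev H M f z' 0 d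
/-- the sentence `C`. -/
def Cs (M : PAM) (f : M) : Prop := ∃ z, (∃ d, d ≤ z ∧ Ev H M f z 0 d) ∧
  ∀ z', z' ≤ z → ∀ e, e ≤ z' → ∀ d, d ≤ z' → (¬ Ev H M f z' (e+1) d ∨ WLE A M e d)

variable {A H}

theorem hh_D0 (hH : D0 (fun M (w : Fin 4 → M) => H M (fun i => w i.castSucc) (w (Fin.last 3)))) {k : ℕ} 
    {a b c d : ∀ M : PAM, (Fin k → M) → M} (ha : Tt a) (hb : Tt b) (hc : Tt c) (hd : Tt d) :
    D0 (fun M v => H M ![a M v, b M v, c M v] (d M v)) := by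
  refine D0.congr (D0.subst hH (f := ![a, b, c, d]) fun i => ?_) ?_
  · fin_cases i
    · exact ha
    · exact hb
    · exact hc
    · exact hd
  · intro M v
    have : ![a M v, b M v, c M v] = (fun i : Fin 3 => (![a, b, c, d] : Fin 4 → ∀ M : PAM, (Fin k → M) → M) i.castSucc M v) := by
      funext i; fin_cases i <;> rfl
    rw [this]; rfl

theorem ev_D0 (hH : D0 (fun M (w : Fin 4 → M) => H M (fun i => w i.castSucc) (w (Fin.last 3)))) {k : ℕ} 
    {f z e d : ∀ M : PAM, (Fin k → M) → M} (hf : Tt f) (hz : Tt z) (he : Tt e) (hd : Tt d) :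
    D0 (fun M v => Ev H M (f M v) (z M v) (e M v) (d M v)) := by
  refine D0.bex (Q := fun M v w => z M v = pr (pr (e M v) (d M v)) w ∧ H M ![f M v, e M v, d M v] w) hz ?_
  exact D0.and (D0.eq hz.up (Tt.pr (Tt.pr he.up hd.up) (Tt.var _))) (hh_D0 hH hf.up he.up hd.up (Tt.var _))

theorem D0.abs {k : ℕ} {R : ∀ M : PAM, (Fin k → M) → Prop} (h : D0 R) (v : Fin k → ℕ) (M N : PAM) :
    R M (fun i => (v i : M)) ↔ R N (fun i => (v i : N)) := by
  obtain ⟨φ, h1, h2⟩ := h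
  rw [← h2, ← h2]
  exact delta0_abs h1 v M N

theorem ev_abs (hH : D0 (fun M (w : Fin 4 → M) => H M (fun i => w i.castSucc) (w (Fin.last 3)))) 
    (f z e d : ℕ) (M N : PAM) : Ev H M (f : M) (z : M) (e : M) (d : M) ↔ Ev H N (f : N) (z : N) (e : N) (d : N) :=
  D0.abs (ev_D0 hH (Tt.var 0) (Tt.var 1) (Tt.var 2) (Tt.var 3)) ![f, z, e, d] M N

variable {n : ℕ}
theorem tru_Sg (hA : Pg n (fun M (w : Fin 2 → M) => A M (fun i => w i.castSucc) (w (Fin.last 1)))) {k : ℕ}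
    {e : ∀ M : PAM, (Fin k → M) → M} (he : Tt e) : Sg (n+1) (fun M v => Tru A M (e M v)) := by
  refine Pg.ex (Q := fun M v x => A M (fun _ => e M v) x) ?_
  exact (cl n).pcomp hA (f := fun _ M w => e M (fun i => w i.castSucc)) (fun _ => he.up) (Tt.var _)
theorem wle_Sg (hA : Pg n (fun M (w : Fin 2 → M) => A M (fun i => w i.castSucc) (w (Fin.last 1)))) {k : ℕ}
    {e d : ∀ M : PAM, (Fin k → M) → M} (he : Tt e) (hd : Tt d) : Sg (n+1) (fun M v => WLE A M (e M v) (d M v)) := by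
  refine cmp_lt (A := fun M v x => A M (fun _ => e M v) x) (B := fun M v x => A M (fun _ => d M v) x) ?_ ?_
  · exact (cl n).pcomp hA (f := fun _ M w => e M (fun i => w i.castSucc)) (fun _ => he.up) (Tt.var _)
  · exact (cl n).pcomp hA (f := fun _ M w => d M (fun i => w i.castSucc)) (fun _ => hd.up) (Tt.var _)
theorem wlt_Sg (hA : Pg n (fun M (w : Fin 2 → M) => A M (fun i => w i.castSucc) (w (Fin.last 1)))) {k : ℕ}
    {e d : ∀ M : PAM, (Fin k → M) → M} (he : Tt e) (hd : Tt d) : Sg (n+1) (fun M v => WLT A M (e M v) (d M v)) := by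
  refine cmp_le (A := fun M v x => A M (fun _ => e M v) x) (B := fun M v x => A M (fun _ => d M v) x) ?_ ?_
  · exact (cl n).pcomp hA (f := fun _ M w => e M (fun i => w i.castSucc)) (fun _ => he.up) (Tt.var _)
  · exact (cl n).pcomp hA (f := fun _ M w => d M (fun i => w i.castSucc)) (fun _ => hd.up) (Tt.var _)

theorem ph_Sg (hA : Pg n (fun M (w : Fin 2 → M) => A M (fun i => w i.castSucc) (w (Fin.last 1))))
    (hH : D0 (fun M (w : Fin 4 → M) => H M (fun i => w i.castSucc) (w (Fin.last 3)))) {k : ℕ}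
    {f : ∀ M : PAM, (Fin k → M) → M} (hf : Tt f) : Sg (n+1) (fun M v => Ph A H M (f M v)) := by
  refine Sg.ex (Q := fun M v z => (∃ e, e ≤ z ∧ ∃ d, d ≤ z ∧ (Ev H M (f M v) z (e+1) d ∧ WLT A M d e)) ∧
    ∀ z', z' < z → ∀ d, d ≤ z' → ¬ Ev H M (f M v) z' 0 d) ?_
  refine Sg.and ?_ (D0.sg ?_)
  · refine (cl (n+1)).bex (Q := fun M w e => ∃ d, d ≤ w (Fin.last k) ∧
      (Ev H M (f M fun i => w i.castSucc) (w (Fin.last k)) (e+1) d ∧ WLT A M d e)) (Tt.var _) ?_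
    refine (cl (n+1)).bex (Q := fun M w d => 
      (Ev H M (f M fun i => w i.castSucc.castSucc) (w (Fin.last k).castSucc) (w (Fin.last (k+1)) +1) d ∧ WLT A M d (w (Fin.last (k+1))))) (Tt.var _) ?_
    exact Sg.and (D0.sg (ev_D0 hH hf.up.up.up (Tt.var _) (Tt.add (Tt.var _) Tt.one) (Tt.var _))) (wlt_Sg hA (Tt.var _) (Tt.var _))
  · refine D0.ballt (Q := fun M w z' => ∀ d, d ≤ z' → ¬ Ev H M (f M fun i => w i.castSucc) z' 0 d) (Tt.var _) ?_
    refine D0.ball (Q := fun M w d => ¬ Ev H M (f M fun i => w i.castSucc.castSucc) (w (Fin.last (k+1))) 0 d) (Tt.var _) ?_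
    exact D0.not (ev_D0 hH hf.up.up.up (Tt.var _) Tt.zero (Tt.var _))

theorem cs_Sg (hA : Pg n (fun M (w : Fin 2 → M) => A M (fun i => w i.castSucc) (w (Fin.last 1))))
    (hH : D0 (fun M (w : Fin 4 → M) => H M (fun i => w i.castSucc) (w (Fin.last 3)))) {k : ℕ}
    {f : ∀ M : PAM, (Fin k → M) → M} (hf : Tt f) : Sg (n+1) (fun M v => Cs A H M (f M v)) := by
  refine Sg.ex (Q := fun M v z => (∃ d, d ≤ z ∧ Ev H M (f M v) z 0 d) ∧
    ∀ z', z' ≤ z → ∀ e, e ≤ z' → ∀ d, d ≤ z' → (¬ Ev H M (f M v) z' (e+1) d ∨ WLE A M e d)) ?_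
  refine Sg.and (D0.sg ?_) ?_
  · refine D0.bex (Q := fun M w d => Ev H M (f M fun i => w i.castSucc) (w (Fin.last k)) 0 d) (Tt.var _) ?_
    exact ev_D0 hH hf.up.up (Tt.var _) Tt.zero (Tt.var _)
  · refine (cl (n+1)).ball (Q := fun M w z' => ∀ e, e ≤ z' → ∀ d, d ≤ z' →
      (¬ Ev H M (f M fun i => w i.castSucc) z' (e+1) d ∨ WLE A M e d)) (Tt.var _) ?_
    refine (cl (n+1)).ball (Q := fun M w e => ∀ d, d ≤ w (Fin.last (k+1)) →
      (¬ Ev H M (f M fun i => w i.castSucc.castSucc) (w (Fin.last (k+1))) (e+1) d ∨ WLE A M e d)) (Tt.var _) ?_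
    refine (cl (n+1)).ball (Q := fun M w d => 
      (¬ Ev H M (f M fun i => w i.castSucc.castSucc.castSucc) (w (Fin.last (k+1)).castSucc) (w (Fin.last (k+2)) +1) d ∨
        WLE A M (w (Fin.last (k+2))) d)) (Tt.var _) ?_
    exact Sg.or (D0.sg (D0.not (ev_D0 hH hf.up.up.up.up (Tt.var _) (Tt.add (Tt.var _) Tt.one) (Tt.var _))))
      (wle_Sg hA (Tt.var _) (Tt.var _))

theorem ph_not_cs {M : PAM} {f : M} (h : Ph A H M f) : ¬ Cs A H M f := by
  rintro ⟨c, ⟨d', hd', h1⟩, h2⟩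
  obtain ⟨z, ⟨e, he, d, hd, h3, h4⟩, h5⟩ := h
  rcases lt_or_ge c z with h | h
  · exact h5 c h d' hd' h1
  · rcases h2 z h e he d hd with h6 | h6
    · exact h6 h3
    · exact cmp_not h6 h4

theorem fin_conj {k : ℕ} (N : ℕ) (P : ℕ → Prop) (R : ℕ → ∀ M : PAM, (Fin k → M) → Prop) (h : ∀ i, Sg n (R i)) :
    Sg n (fun M v => ∀ i ≤ N, P i → R i M v) := by
  have step : ∀ i, Sg n (fun M v => P i → R i M v) := by
    intro i
    by_cases hp : P i
    · exact (h i).congr (fun M v => by simp [hp])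
    · exact (D0.sg D0.true).congr (fun M v => by simp [hp])
  induction N with
  | zero => exact (step 0).congr (fun M v => by simp)
  | succ N ih =>
    refine (ih.and (step (N+1))).congr fun M v => ⟨fun h => ⟨fun i hi => h i (by omega), h _ le_rfl⟩, fun h i hi => ?_⟩
    rcases Nat.lt_or_ge N i with h' | h'
    · have : i = N + 1 := by omega
      rw [this]; exact h.2
    · exact h.1 i h'

theorem conj_sentence (hA : Pg n (fun M (w : Fin 2 → M) => A M (fun i => w i.castSucc) (w (Fin.last 1))))
    (z : ℕ) (P : ℕ → ℕ → ℕ → Prop) : ∃ s ∈ SigmaS (n+1), ∀ M, Sat M s ↔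
      ∀ z' ≤ z, ∀ e ≤ z', ∀ d ≤ z', P z' e d → WLE A M (e : M) (d : M) := by
  have : Sg (n+1) (fun M (_ : Fin 0 → M) => ∀ z' ≤ z, True → ∀ e ≤ z', True → ∀ d ≤ z', P z' e d → WLE A M (e : M) (d : M)) :=
    fin_conj z (fun _ => True) (fun z' M _ => ∀ e ≤ z', True → ∀ d ≤ z', P z' e d → WLE A M (e : M) (d : M)) fun z' =>
    fin_conj z' (fun _ => True) (fun e M _ => ∀ d ≤ z', P z' e d → WLE A M (e : M) (d : M)) fun e =>
    fin_conj z' (fun d => P z' e d) (fun d M _ => WLE A M (e : M) (d : M)) fun d => wle_Sg hA (Tt.num e) (Tt.num d)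
  obtain ⟨s, h1, h2⟩ := this.sentence
  exact ⟨s, h1, fun M => by rw [h2]; simp⟩

end
end

section
open PAM

section
variable {A : ∀ M : PAM, (Fin 1 → M) → M → Prop} {H : ∀ M : PAM, (Fin 3 → M) → M → Prop} {n : ℕ}

/-- `S` proves that `e, d` are a complementary pair and that `φ` implies `e`. -/
def Typ (A : ∀ M : PAM, (Fin 1 → M) → M → Prop) (H : ∀ M : PAM, (Fin 3 → M) → M → Prop)
    (S : Thy) (f e d : ℕ) : Prop :=
  ∀ M : PAM, MT M S → (Tru A M (e : M) ↔ ¬ Tru A M (d : M)) ∧ (Ph A H M (f : M) → Tru A M (e : M))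

/-- `S` decides one of the critical sentences. -/
def Crit (A : ∀ M : PAM, (Fin 1 → M) → M → Prop) (H : ∀ M : PAM, (Fin 3 → M) → M → Prop)
    (S : Thy) (f : ℕ) : Prop :=
  (∀ M : PAM, MT M S → Ph A H M (f : M)) ∨ (∀ M : PAM, MT M S → ¬ Cs A H M (f : M))

theorem typ_S1 (hA : Pg n (fun M (w : Fin 2 → M) => A M (fun i => w i.castSucc) (w (Fin.last 1))))
    (hH : D0 (fun M (w : Fin 4 → M) => H M (fun i => w i.castSucc) (w (Fin.last 3))))
    {S : Thy} (hS : GoodThy S) : S1 fun v : Fin 3 → ℕ => Typ A H S (v 2) (v 0) (v 1) := by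
  obtain ⟨a, _, ha⟩ := (tru_Sg hA (Tt.var (0 : Fin 3))).formula.1
  obtain ⟨b, _, hb⟩ := (tru_Sg hA (Tt.var (1 : Fin 3))).formula.1
  obtain ⟨c, _, hc⟩ := (ph_Sg hA hH (Tt.var (2 : Fin 3))).formula.1
  refine (prov_S1 hS.1 hS.2.2 ((a ⇔ ∼b) ⊓ (c ⟹ a))).congr fun v => ?_
  refine forall_congr' fun M => imp_congr_right fun _ => ?_
  rw [BoundedFormula.realize_inf, BoundedFormula.realize_iff, BoundedFormula.realize_imp,
    BoundedFormula.realize_not, ha, hb, hc]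
  rfl

theorem crit_S1 (hA : Pg n (fun M (w : Fin 2 → M) => A M (fun i => w i.castSucc) (w (Fin.last 1))))
    (hH : D0 (fun M (w : Fin 4 → M) => H M (fun i => w i.castSucc) (w (Fin.last 3))))
    {S : Thy} (hS : GoodThy S) : S1 fun v : Fin 3 → ℕ => Crit A H S (v 0) := by
  obtain ⟨c, _, hc⟩ := (ph_Sg hA hH (Tt.var (0 : Fin 3))).formula.1
  obtain ⟨b, _, hb⟩ := (cs_Sg hA hH (Tt.var (0 : Fin 3))).formula.1
  refine ((prov_S1 hS.1 hS.2.2 c).or (prov_S1 hS.1 hS.2.2 (∼b))).congr fun v => ?_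
  refine or_congr (forall_congr' fun M => imp_congr_right fun _ => ?_)
    (forall_congr' fun M => imp_congr_right fun _ => ?_)
  · rw [hc]; rfl
  · rw [BoundedFormula.realize_not, hb]; rfl

/-- The enumerated relation. -/
def Enum (A : ∀ M : PAM, (Fin 1 → M) → M → Prop) (H : ∀ M : PAM, (Fin 3 → M) → M → Prop)
    (T U : Thy) (f e d : ℕ) : Prop :=
  (0 = e ∧ (Crit A H T f ∨ Crit A H U f)) ∨ ∃ c, c + 1 = e ∧ (Typ A H T f c d ∨ Typ A H U f c d)

theorem enum_S1 (hA : Pg n (fun M (w : Fin 2 → M) => A M (fun i => w i.castSucc) (w (Fin.last 1))))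
    (hH : D0 (fun M (w : Fin 4 → M) => H M (fun i => w i.castSucc) (w (Fin.last 3))))
    {T U : Thy} (hT : GoodThy T) (hU : GoodThy U) :
    S1 fun v : Fin 3 → ℕ => Enum A H T U (v 0) (v 1) (v 2) := by
  refine S1.or (S1.and (S1_zero _) (S1.or (crit_S1 hA hH hT) (crit_S1 hA hH hU))) ?_
  refine S1.ex (Q := fun (v : Fin 3 → ℕ) c => c + 1 = v 1 ∧ (Typ A H T (v 0) c (v 2) ∨ Typ A H U (v 0) c (v 2))) ?_
  refine S1.and (S1_succ _ _) (S1.or ?_ ?_)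
  · exact (typ_S1 hA hH hT).rel3 (P := fun a b c => Typ A H T c a b) _ _ _
  · exact (typ_S1 hA hH hU).rel3 (P := fun a b c => Typ A H U c a b) _ _ _

theorem typ_wle (hA : Pg n (fun M (w : Fin 2 → M) => A M (fun i => w i.castSucc) (w (Fin.last 1))))
    {S : Thy} {f e d z : ℕ} (h : Typ A H S f e d) {M : PAM} (hM : MT M S)
    (hev : Ev H M (f : M) (z : M) (e + 1 : M) (d : M)) (he : e ≤ z) (hd : d ≤ z)
    (hno : ∀ z', z' < (z : M) → ∀ d, d ≤ z' → ¬ Ev H M (f : M) z' 0 d) : WLE A M (e : M) (d : M) := by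
  obtain ⟨h1, h2⟩ := h M hM
  have h3 : (∃ x, A M (fun _ => (e : M)) x) ∨ ∃ x, A M (fun _ => (d : M)) x := by
    by_cases h : Tru A M (d : M)
    · exact Or.inr h
    · exact Or.inl (h1.2 h)
  rcases cmp_or (hA.d1 _) h3 with h4 | h4
  · exact h4
  · exfalso
    have h5 : Ph A H M (f : M) :=
      ⟨z, ⟨e, by exact_mod_cast he, d, by exact_mod_cast hd, hev, h4⟩, hno⟩
    obtain ⟨x, hx, _⟩ := h4
    exact h1.1 (h2 h5) ⟨x, hx⟩

theorem not_crit (hA : Pg n (fun M (w : Fin 2 → M) => A M (fun i => w i.castSucc) (w (Fin.last 1))))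
    (hH : D0 (fun M (w : Fin 4 → M) => H M (fun i => w i.castSucc) (w (Fin.last 3))))
    {T U : Thy} (hT : ExtPA T) (hU : ExtPA U) {f z d0 : ℕ} (hd0 : d0 ≤ z)
    (hz : Ev H NN (f : NN) (z : NN) 0 (d0 : NN))
    (hmin : ∀ z' < z, ∀ d ≤ z', ¬ Ev H NN (f : NN) (z' : NN) 0 (d : NN))
    (hp : ∀ z' e d : ℕ, Ev H NN (f : NN) (z' : NN) (e + 1 : NN) (d : NN) → Typ A H T f e d ∨ Typ A H U f e d)
    (hcon : Con (T ∪ ThIn (SigAndPiS (n+1)) U)) : ¬ Crit A H T f := by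
  have abs1 : ∀ (M : PAM) (z' e d : ℕ), Ev H M (f : M) (z' : M) (e + 1 : M) (d : M) ↔
      Ev H NN (f : NN) (z' : NN) (e + 1 : NN) (d : NN) := by
    intro M z' e d
    have := ev_abs hH f z' (e+1) d M NN
    push_cast at this
    exact this
  have abs0 : ∀ (M : PAM) (z' d : ℕ), Ev H M (f : M) (z' : M) 0 (d : M) ↔
      Ev H NN (f : NN) (z' : NN) 0 (d : NN) := by
    intro M z' d
    have := ev_abs hH f z' 0 d M NN
    push_cast at this
    exact this
  have hno : ∀ (M : PAM) (y : ℕ), y ≤ z → ∀ z', z' < (y : M) → ∀ d, d ≤ z' → ¬ Ev H M (f : M) z' 0 d := by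
    intro M y hy z' hz' d hd
    obtain ⟨m, hm, rfl⟩ := le_cast hz'.le
    obtain ⟨d, hd', rfl⟩ := le_cast hd
    rw [abs0]
    have : m < y := by exact_mod_cast hz'
    exact hmin m (by omega) d hd'
  have key : ∀ S : Thy, ∀ M, MT M S → ∀ z' ≤ z, ∀ e ≤ z', ∀ d ≤ z',
      (Ev H NN (f : NN) (z' : NN) (e + 1 : NN) (d : NN) ∧ Typ A H S f e d) → WLE A M (e : M) (d : M) := by
    intro S M hM z' hz' e he d hd h
    exact typ_wle hA h.2 hM ((abs1 M z' e d).2 h.1) he hd (hno M z' hz')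
  obtain ⟨s, hs, hs'⟩ := conj_sentence hA z
    (fun z' e d => Ev H NN (f : NN) (z' : NN) (e + 1 : NN) (d : NN) ∧ Typ A H U f e d)
  obtain ⟨M, hM, hMs⟩ := cap_model hT hcon hU hs (fun M hM => (hs' M).2 (key U M hM))
  have hC : Cs A H M (f : M) := by
    refine ⟨z, ⟨d0, by exact_mod_cast hd0, (abs0 M z d0).2 hz⟩, fun z' hz' e he d hd => ?_⟩
    obtain ⟨z', hz'', rfl⟩ := le_cast hz'
    obtain ⟨e, he', rfl⟩ := le_cast he
    obtain ⟨d, hd', rfl⟩ := le_cast hd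
    by_cases hev : Ev H NN (f : NN) (z' : NN) (e + 1 : NN) (d : NN)
    · right
      rcases hp z' e d hev with h | h
      · exact key T M hM z' hz'' e he' d hd' ⟨hev, h⟩
      · exact (hs' M).1 hMs z' hz'' e he' d hd' ⟨hev, h⟩
    · left; rwa [abs1]
  rintro (h | h)
  · exact ph_not_cs (h M hM) hC
  · exact h M hM hC

theorem hdelta {T : Thy} (hT : ExtPA T) (hA : Pg n (fun M (w : Fin 2 → M) => A M (fun i => w i.castSucc) (w (Fin.last 1))))
    (hH : D0 (fun M (w : Fin 4 → M) => H M (fun i => w i.castSucc) (w (Fin.last 3))))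
    (hu : ∀ s ∈ SigmaS (n+1), ∃ e : ℕ, ∀ M : PAM, Sat M s ↔ Tru A M (e : M)) {f : ℕ} {φ : Snt}
    (hφ : ∀ M, Sat M φ ↔ Ph A H M (f : M))
    (hp : ∀ e d : ℕ, Typ A H T f e d → ∃ z : ℕ, e ≤ z ∧ d ≤ z ∧ Ev H NN (f : NN) (z : NN) (e + 1 : NN) (d : NN))
    (hno : ∀ z d : ℕ, ¬ Ev H NN (f : NN) (z : NN) 0 (d : NN)) : HDeltaCons (n+1) T φ := by
  rintro V ⟨hV, hVT⟩ δ ⟨⟨s, hs, hds⟩, ⟨p, hp', hdp⟩⟩ hδ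
  have hMV : ∀ {M}, MT M T → MT M V := fun {M} hM ψ hψ => prv_of (hVT ψ (prv_mem hψ)) hM
  have hds : ∀ M, MT M V → (Sat M δ ↔ Sat M s) := fun M hM => sat_iff.1 (prv_of hds (mt_th.2 hM))
  have hdp : ∀ M, MT M V → (Sat M δ ↔ Sat M p) := fun M hM => sat_iff.1 (prv_of hdp (mt_th.2 hM))
  rw [prv_add hV] at hδ
  obtain ⟨e, he⟩ := hu s hs
  obtain ⟨q, hq, hq'⟩ := (pg_sat hp').not.sentence
  obtain ⟨d, hd⟩ := hu q hq
  have hd : ∀ M, ¬ Sat M p ↔ Tru A M (d : M) := fun M => (hq' M).symm.trans (hd M)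
  have htyp : Typ A H T f e d := by
    intro M hM
    have hM := hMV hM
    refine ⟨?_, fun h => ?_⟩
    · rw [← he, ← hd, not_not, ← hds M hM, ← hdp M hM]
    · rw [← he, ← hds M hM]
      exact hδ M hM ((hφ M).2 h)
  obtain ⟨z, hez, hdz, hev⟩ := hp e d htyp
  refine (prv_iff hV).2 fun M hM => ?_
  by_contra hc
  apply hc
  refine hδ M hM ((hφ M).2 ?_)
  have h1 : ¬ Tru A M (e : M) := by rwa [← he, ← hds M hM]
  have h2 : Tru A M (d : M) := by rwa [← hd, ← hdp M hM]
  refine ⟨z, ⟨e, by exact_mod_cast hez, d, by exact_mod_cast hdz, ?_, ?_⟩, ?_⟩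
  · have := ev_abs hH f z (e+1) d M NN
    push_cast at this
    exact this.2 hev
  · obtain ⟨x, hx⟩ := h2
    exact ⟨x, hx, fun y _ hy => h1 ⟨y, hy⟩⟩
  · intro z' hz' d hd
    obtain ⟨m, hm, rfl⟩ := le_cast hz'.le
    obtain ⟨d, hd', rfl⟩ := le_cast hd
    have := ev_abs hH f m 0 d M NN
    push_cast at this
    rw [this]
    exact hno m d
end

theorem part1 {T U : Thy} (hT : GoodThy T) (hU : GoodThy U) {n : ℕ} (hc : Capair (n+1) T U) :
    ∃ φ ∈ SigmaS (n+1), SimExHDelta (n+1) T U φ := by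
  obtain ⟨A, hA, hu⟩ := universal n
  obtain ⟨H, hH, hself⟩ := selfref
  obtain ⟨f, hf⟩ := hself (Enum A H T U) (enum_S1 hA hH hT hU)
  have ev_of : ∀ z e d : ℕ, Ev H NN (f : NN) (z : NN) (e : NN) (d : NN) → Enum A H T U f e d := by
    rintro z e d ⟨w, _, _, h⟩
    exact (hf e d).1 ⟨w, h⟩
  have of_ev : ∀ e d : ℕ, Enum A H T U f e d → ∃ z : ℕ, e ≤ z ∧ d ≤ z ∧ Ev H NN (f : NN) (z : NN) (e : NN) (d : NN) := by
    intro e d h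
    obtain ⟨w, hw⟩ := (hf e d).2 h
    obtain ⟨z, hz⟩ := NN_cast (pr (pr (e : NN) (d : NN)) w)
    have h1 : pr (e : NN) (d : NN) ≤ (z : NN) := hz ▸ le_pr_left _ _
    refine ⟨z, ?_, ?_, w, ?_, hz.symm, hw⟩
    · have := (le_pr_left (e : NN) (d : NN)).trans h1
      exact_mod_cast this
    · have := (le_pr_right (e : NN) (d : NN)).trans h1
      exact_mod_cast this
    · exact hz ▸ le_pr_right _ _
  have hp : ∀ z' e d : ℕ, Ev H NN (f : NN) (z' : NN) (e + 1 : NN) (d : NN) → Typ A H T f e d ∨ Typ A H U f e d := by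
    intro z' e d h
    rcases ev_of z' (e+1) d (by push_cast; exact h) with ⟨h1, _⟩ | ⟨c, h1, h2⟩
    · omega
    · obtain rfl : c = e := by omega
      exact h2
  have hnc : ¬ (Crit A H T f ∨ Crit A H U f) := by
    intro hcr
    obtain ⟨z1, _, h2, h3⟩ := of_ev 0 0 (Or.inl ⟨rfl, hcr⟩)
    have hex : ∃ z : ℕ, ∃ d ≤ z, Ev H NN (f : NN) (z : NN) 0 (d : NN) := ⟨z1, 0, h2, by push_cast at h3 ⊢; exact h3⟩
    classical
    obtain ⟨d, hd, hz⟩ := Nat.find_spec hex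
    have hmin : ∀ z' < Nat.find hex, ∀ d ≤ z', ¬ Ev H NN (f : NN) (z' : NN) 0 (d : NN) := by
      intro z' hz' d hd h
      exact Nat.find_min hex hz' ⟨d, hd, h⟩
    rcases hcr with h | h
    · exact not_crit hA hH hT.2.2 hU.2.2 hd hz hmin hp hc.1 h
    · exact not_crit hA hH hU.2.2 hT.2.2 hd hz hmin (fun a b c h => (hp a b c h).symm) hc.2 h
  have hno : ∀ z d : ℕ, ¬ Ev H NN (f : NN) (z : NN) 0 (d : NN) := by
    intro z d h
    rcases ev_of z 0 d (by push_cast; exact h) with ⟨_, h⟩ | ⟨c, h1, _⟩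
    · exact hnc h
    · omega
  have hex : ∀ e d : ℕ, (Typ A H T f e d ∨ Typ A H U f e d) →
      ∃ z : ℕ, e ≤ z ∧ d ≤ z ∧ Ev H NN (f : NN) (z : NN) (e + 1 : NN) (d : NN) := by
    intro e d h
    obtain ⟨z, h1, h2, h3⟩ := of_ev (e+1) d (Or.inr ⟨e, rfl, h⟩)
    push_cast at h3
    exact ⟨z, by omega, h2, h3⟩
  obtain ⟨φ, h1, h2⟩ := (ph_Sg (k := 0) hA hH (Tt.num f)).sentence
  obtain ⟨ψ, h3, h4⟩ := (cs_Sg (k := 0) hA hH (Tt.num f)).not.sentence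
  rw [not_or, Crit, Crit, not_or, not_or] at hnc
  obtain ⟨⟨a, b⟩, c, d⟩ := hnc
  refine ⟨φ, h1, hdelta hT.2.2 hA hH hu h2 (fun e d h => hex e d (Or.inl h)) hno,
    hdelta hU.2.2 hA hH hu h2 (fun e d h => hex e d (Or.inr h)) hno, ⟨φ, h1, ?_, ?_, ?_⟩, ⟨ψ, h3, ?_, ?_, ?_⟩⟩
  · exact (prv_add extPA_PA).2 fun M _ h => h
  · rw [prv_iff hT.2.2]; simpa only [h2] using a
  · rw [prv_iff hU.2.2]; simpa only [h2] using c
  · exact (prv_add extPA_PA).2 fun M _ h => (h4 M).2 (ph_not_cs ((h2 M).1 h))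
  · rw [prv_iff hT.2.2]; simpa only [h4] using b
  · rw [prv_iff hU.2.2]; simpa only [h4] using d

end

/-- Theorem 6.3. -/
theorem stmt_12 (T U : Thy) (hT : GoodThy T) (hU : GoodThy U) (n : ℕ) (hn : 1 ≤ n) :
    (Capair n T U → ∃ φ ∈ SigmaS n, SimExHDelta n T U φ) ∧
    ((∃ φ : Snt, SimExHDelta n T U φ) → Cpair n T U) := by
  obtain ⟨m, rfl⟩ : ∃ m, n = m + 1 := ⟨n - 1, by omega⟩
  exact ⟨part1 hT hU, part2 hT.2.2 hU.2.2⟩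

end Guaspari
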